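/- arXiv:2507.12354 — 3 statements merged into one kernel-verified Lean document; each statement's English description precedes it below -/
import Mathlib

section
/- There exist a constant ε > 0 and an integer N₀ such that for every n ≥ N₀, every 𝔽-free 3-graph H on n vertices with minimum ℓ2-norm degree δ_{ℓ2}(H) ≥ (5/4 − ε)·n³ is bipartite. -/
/-- A 3-graph: every edge is a 3-element subset of the vertex set `Fin n`. -/
def Is3Graph {n : ℕ} (H : Finset (Finset (Fin n))) : Prop := ∀ e ∈ H, e.card = 3

/-- The shadow of a 3-graph: the pairs contained in at least one edge. -/
def shadow3 {n : ℕ} (H : Finset (Finset (Fin n))) : Finset (Finset (Fin n)) :=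
  Finset.univ.filter fun e => e.card = 2 ∧ ∃ E ∈ H, e ⊆ E

/-- The codegree of a pair `e`: the number of vertices `v` with `e ∪ {v} ∈ H`. -/
def codeg3 {n : ℕ} (H : Finset (Finset (Fin n))) (e : Finset (Fin n)) : ℕ :=
  (Finset.univ.filter fun v => v ∉ e ∧ insert v e ∈ H).card

/-- The ℓ2-norm of a 3-graph: `‖H‖₂ = ∑_{e ∈ ∂H} d_H(e)²`. -/
def l2norm {n : ℕ} (H : Finset (Finset (Fin n))) : ℕ :=
  ∑ e ∈ shadow3 H, (codeg3 H e) ^ 2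

/-- `H − v`: delete the vertex `v` and all edges containing it. -/
def delVert {n : ℕ} (H : Finset (Finset (Fin n))) (v : Fin n) : Finset (Finset (Fin n)) :=
  H.filter fun e => v ∉ e

/-- The ℓ2-norm degree of a vertex: `d_{2,H}(v) = ‖H‖₂ − ‖H − v‖₂`. -/
noncomputable def d2deg {n : ℕ} (H : Finset (Finset (Fin n))) (v : Fin n) : ℝ :=
  (l2norm H : ℝ) - (l2norm (delVert H v) : ℝ)
/-- The edges of the Fano plane, as a 3-graph on `Fin 7` (0-indexed version of
the edge set {123, 345, 561, 174, 275, 376, 246}). -/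
def fanoEdges : Finset (Finset (Fin 7)) :=
  {({0, 1, 2} : Finset (Fin 7)), {2, 3, 4}, {4, 5, 0}, {0, 6, 3}, {1, 6, 4}, {2, 6, 5}, {1, 3, 5}}

/-- A 3-graph is 𝔽-free if it contains no subgraph isomorphic to the Fano plane. -/
def FanoFree {n : ℕ} (H : Finset (Finset (Fin n))) : Prop :=
  ¬ ∃ f : Fin 7 → Fin n, Function.Injective f ∧ ∀ e ∈ fanoEdges, e.image f ∈ H
/-- A 3-graph is bipartite if its vertex set can be partitioned into `A` and `Aᶜ` such
that every edge intersects both parts. -/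
def Bipartite3 {n : ℕ} (H : Finset (Finset (Fin n))) : Prop :=
  ∃ A : Finset (Fin n), ∀ e ∈ H, (e ∩ A).Nonempty ∧ (e \ A).Nonempty

section FanoStability

open Finset

/-- The indicator of the edges of `H` on ordered triples of vertices. -/
def edgeInd {n : ℕ} (H : Finset (Finset (Fin n))) (x y z : Fin n) : Bool :=
  decide (({x, y, z} : Finset (Fin n)) ∈ H)

/-- A symmetric Boolean function on ordered triples, vanishing on degenerate triples, for which no
map from the points of the Fano plane sends all seven lines to edges. -/
structure FanoFreeInd {V : Type*} (h : V → V → V → Bool) : Prop where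
  swap_left : ∀ x y z, h x y z = h y x z
  swap_right : ∀ x y z, h x y z = h x z y
  diag : ∀ x y, h x x y = false
  no_fano : ∀ a b c d e f g : V, h a b c → h c d e → h e f a → h a g d → h b g e → h c g f →
    h b d f → False

/-- The codegree of an ordered pair. -/
def codInd {V : Type*} [Fintype V] (h : V → V → V → Bool) (x y : V) : ℤ :=
  ∑ z, (h x y z).toInt

/-- An upper bound for the ℓ2-norm degree, as a sum over ordered tuples. -/
def l2Ind {V : Type*} [Fintype V] (h : V → V → V → Bool) (v : V) : ℤ :=
  ∑ u, codInd h v u ^ 2 + ∑ x, ∑ y, (h v x y).toInt * codInd h x y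

section Translation

variable {n : ℕ} {H : Finset (Finset (Fin n))}

lemma fanoFreeInd_edgeInd (h3 : Is3Graph H) (hF : FanoFree H) : FanoFreeInd (edgeInd H) := by
  refine ⟨?_, ?_, ?_, ?_⟩
  · intro x y z
    simp only [edgeInd, Finset.insert_comm x y]
  · intro x y z
    simp only [edgeInd, Finset.pair_comm y z]
  · intro x y
    simp only [edgeInd, decide_eq_false_iff_not]
    intro hx
    have := h3 _ hx
    have h2 : ({x, x, y} : Finset (Fin n)).card ≤ 2 := by
      simpa using Finset.card_le_two (a := x) (b := y)
    omega
  · intro a b c d e f g h1 h2 h3' h4 h5 h6 h7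
    simp only [edgeInd, decide_eq_true_eq] at h1 h2 h3' h4 h5 h6 h7
    have key : ∀ x y z : Fin n, ({x, y, z} : Finset (Fin n)) ∈ H → x ≠ y ∧ x ≠ z ∧ y ≠ z := by
      intro x y z hx
      have hc := h3 _ hx
      refine ⟨?_, ?_, ?_⟩ <;> rintro rfl
      · have := Finset.card_le_two (a := x) (b := z)
        simp at hc
        omega
      · have := Finset.card_le_two (a := y) (b := x)
        simp at hc
        omega
      · have := Finset.card_le_two (a := x) (b := y)
        simp at hc
        omega
    obtain ⟨_, _, _⟩ := key _ _ _ h1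
    obtain ⟨_, _, _⟩ := key _ _ _ h2
    obtain ⟨_, _, _⟩ := key _ _ _ h3'
    obtain ⟨_, _, _⟩ := key _ _ _ h4
    obtain ⟨_, _, _⟩ := key _ _ _ h5
    obtain ⟨_, _, _⟩ := key _ _ _ h6
    obtain ⟨_, _, _⟩ := key _ _ _ h7
    apply hF
    refine ⟨![a, b, c, d, e, f, g], ?_, ?_⟩
    · intro i j hij
      fin_cases i <;> fin_cases j <;>
        first
          | rfl
          | exact absurd hij (by assumption)
          | exact absurd hij.symm (by assumption)
    · intro E hE
      simp only [fanoEdges, Finset.mem_insert, Finset.mem_singleton] at hE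
      rcases hE with rfl | rfl | rfl | rfl | rfl | rfl | rfl <;>
        simpa [Finset.image_insert]

lemma codInd_edgeInd (h3 : Is3Graph H) {x y : Fin n} (hxy : x ≠ y) :
    codInd (edgeInd H) x y = codeg3 H {x, y} := by
  unfold codInd codeg3
  rw [Finset.card_filter]
  push_cast
  refine Finset.sum_congr rfl fun z _ => ?_
  have e : ({x, y, z} : Finset (Fin n)) = insert z {x, y} := by
    ext; simp; tauto
  by_cases hz : z ∈ ({x, y} : Finset (Fin n))
  · have : insert z ({x, y} : Finset (Fin n)) ∉ H := by
      intro hh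
      have := h3 _ hh
      rw [Finset.insert_eq_of_mem hz, Finset.card_pair hxy] at this
      omega
    simp [edgeInd, e, this]
  · by_cases hh : insert z ({x, y} : Finset (Fin n)) ∈ H
    · simp [edgeInd, e, hh] at hz ⊢
      tauto
    · simp [edgeInd, e, hh]

lemma codInd_self (h3 : Is3Graph H) (x : Fin n) : codInd (edgeInd H) x x = 0 := by
  refine Finset.sum_eq_zero fun z _ => ?_
  have : ({x, x, z} : Finset (Fin n)) ∉ H := by
    intro hx
    have h1 := h3 _ hx
    have h2 := Finset.card_le_two (a := x) (b := z)
    simp at h1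
    omega
  simp [edgeInd] at this ⊢
  simp [this]

lemma sum_pairs_eq_two_mul (F : Finset (Fin n) → ℤ) :
    ∑ p ∈ (univ : Finset (Fin n)).offDiag, F {p.1, p.2} = 2 * ∑ e ∈ powersetCard 2 univ, F e := by
  rw [← Finset.sum_fiberwise_of_maps_to (s := (univ : Finset (Fin n)).offDiag)
    (t := powersetCard 2 univ) (g := fun p => ({p.1, p.2} : Finset (Fin n)))]
  · rw [Finset.mul_sum]
    refine Finset.sum_congr rfl fun e he => ?_
    obtain ⟨a, b, hab, rfl⟩ := Finset.card_eq_two.mp (Finset.mem_powersetCard.mp he).2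
    have : {p ∈ (univ : Finset (Fin n)).offDiag | ({p.1, p.2} : Finset (Fin n)) = {a, b}}
        = {(a, b), (b, a)} := by
      ext ⟨p, q⟩
      simp only [mem_filter, mem_offDiag, mem_univ, true_and, mem_insert, mem_singleton,
        Prod.mk.injEq]
      constructor
      · rintro ⟨hpq, h⟩
        have h1 : p ∈ ({a, b} : Finset (Fin n)) := by rw [← h]; simp
        have h2 : q ∈ ({a, b} : Finset (Fin n)) := by rw [← h]; simp
        simp only [mem_insert, mem_singleton] at h1 h2
        grind
      · rintro (⟨rfl, rfl⟩ | ⟨rfl, rfl⟩)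
        · exact ⟨hab, rfl⟩
        · exact ⟨hab.symm, Finset.pair_comm _ _⟩
    rw [this, Finset.sum_pair (by simp [hab])]
    simp only [Finset.pair_comm b a]
    ring
  · rintro ⟨p, q⟩ hp
    simp only [mem_offDiag, mem_univ, true_and] at hp
    simp [Finset.mem_powersetCard, Finset.card_pair hp]

lemma two_mul_l2norm (h3 : Is3Graph H) :
    2 * (l2norm H : ℤ) = ∑ x, ∑ y, codInd (edgeInd H) x y ^ 2 := by
  have h1 : (l2norm H : ℤ) = ∑ e ∈ powersetCard 2 (univ : Finset (Fin n)), (codeg3 H e : ℤ) ^ 2 := by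
    unfold l2norm
    push_cast
    refine Finset.sum_subset ?_ ?_
    · intro e he
      simp only [shadow3, mem_filter] at he
      simp [Finset.mem_powersetCard, he.2.1]
    · intro e he hes
      have : codeg3 H e = 0 := by
        unfold codeg3
        rw [Finset.card_eq_zero, Finset.filter_eq_empty_iff]
        rintro v - ⟨-, hv⟩
        apply hes
        simp only [shadow3, mem_filter, mem_univ, true_and]
        exact ⟨(Finset.mem_powersetCard.mp he).2, _, hv, Finset.subset_insert _ _⟩
      simp [this]
  rw [h1, ← sum_pairs_eq_two_mul fun e => (codeg3 H e : ℤ) ^ 2, ← Finset.sum_product']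
  rw [Finset.univ_product_univ]
  symm
  rw [← Finset.sum_subset (Finset.subset_univ ((univ : Finset (Fin n)).offDiag))]
  · refine Finset.sum_congr rfl fun p hp => ?_
    rw [codInd_edgeInd h3 (by simpa using hp)]
  · rintro ⟨x, y⟩ - hp
    simp only [mem_offDiag, mem_univ, true_and, not_not] at hp
    subst hp
    simp [codInd_self h3]

lemma d2deg_le_l2Ind (h3 : Is3Graph H) (v : Fin n) : d2deg H v ≤ (l2Ind (edgeInd H) v : ℝ) := by
  have h3' : Is3Graph (delVert H v) := fun e he => h3 e (Finset.mem_of_mem_filter e he)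
  have e1 := two_mul_l2norm h3
  have e2 := two_mul_l2norm h3'
  have hd : ∀ x y z, (edgeInd (delVert H v) x y z).toInt =
      if v = x ∨ v = y ∨ v = z then 0 else (edgeInd H x y z).toInt := by
    intro x y z
    have : edgeInd (delVert H v) x y z =
        (edgeInd H x y z && decide (¬ (v = x ∨ v = y ∨ v = z))) := by
      rw [Bool.eq_iff_iff]
      simp [edgeInd, delVert]
    rw [this]
    split_ifs with hv <;> simp [hv]
  have hsymm : ∀ x y z, edgeInd H x y z = edgeInd H z x y := by
    intro x y z
    have e : ({x, y, z} : Finset (Fin n)) = {z, x, y} := by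
      ext; simp; tauto
    simp only [edgeInd, e]
  have hsymm2 : ∀ x y z, edgeInd H x y z = edgeInd H y x z := by
    intro x y z
    simp only [edgeInd, Finset.insert_comm x y]
  have hc2 : ∀ x y, codInd (edgeInd H) x y = codInd (edgeInd H) y x := fun x y =>
    Finset.sum_congr rfl fun z _ => by rw [hsymm2]
  have hpt : ∀ x y, codInd (edgeInd H) x y ^ 2 - codInd (edgeInd (delVert H v)) x y ^ 2 ≤
      (if x = v then codInd (edgeInd H) v y ^ 2 else 0) +
      (if y = v then codInd (edgeInd H) v x ^ 2 else 0) +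
      2 * ((edgeInd H v x y).toInt * codInd (edgeInd H) x y) := by
    intro x y
    have hnn : 0 ≤ codInd (edgeInd H) x y := Finset.sum_nonneg fun z _ => by
      cases edgeInd H x y z <;> simp
    have hi : 0 ≤ (edgeInd H v x y).toInt := by cases edgeInd H v x y <;> simp
    by_cases hx : x = v
    · subst hx
      have := mul_nonneg hi hnn
      have := sq_nonneg (codInd (edgeInd (delVert H x)) x y)
      have : 0 ≤ (if y = x then codInd (edgeInd H) x x ^ 2 else 0) := by
        split_ifs <;> positivity
      simp only [if_true]
      linarith
    by_cases hy : y = v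
    · subst hy
      have := mul_nonneg hi hnn
      have := sq_nonneg (codInd (edgeInd (delVert H y)) x y)
      have : 0 ≤ (if x = y then codInd (edgeInd H) y y ^ 2 else 0) := by
        split_ifs
        positivity
      simp only [if_true]
      rw [hc2 x y] at *
      linarith
    have e : codInd (edgeInd (delVert H v)) x y =
        codInd (edgeInd H) x y - (edgeInd H v x y).toInt := by
      unfold codInd
      rw [eq_sub_iff_add_eq, ← hsymm x y v]
      rw [← Finset.add_sum_erase _ _ (mem_univ v), ← Finset.add_sum_erase (f := fun z => (edgeInd H x y z).toInt) _ (mem_univ v)]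
      rw [hd]
      have : ∑ z ∈ univ.erase v, (edgeInd (delVert H v) x y z).toInt =
          ∑ z ∈ univ.erase v, (edgeInd H x y z).toInt := by
        refine Finset.sum_congr rfl fun z hz => ?_
        rw [hd, if_neg]
        have := (Finset.mem_erase.mp hz).1
        grind
      rw [this]
      simp
    rw [if_neg hx, if_neg hy, e]
    nlinarith [sq_nonneg (edgeInd H v x y).toInt]
  have hsum := Finset.sum_le_sum fun x (_ : x ∈ univ) =>
    Finset.sum_le_sum fun y (_ : y ∈ univ) => hpt x y
  simp only [Finset.sum_sub_distrib, Finset.sum_add_distrib, ← e1, ← e2, ← Finset.mul_sum,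
    Finset.sum_ite_eq', Finset.sum_comm (f := fun x y => if x = v then _ else _), mem_univ,
    if_true] at hsum
  have h4 : (l2norm H : ℤ) - l2norm (delVert H v) ≤ l2Ind (edgeInd H) v := by
    unfold l2Ind
    have e5 : ∑ x, ∑ y, (if x = v then codInd (edgeInd H) v y ^ 2 else 0) =
        ∑ y, codInd (edgeInd H) v y ^ 2 := by
      rw [Finset.sum_comm]
      simp
    linarith
  unfold d2deg
  exact_mod_cast h4

end Translation

section FourSet

lemma toInt_nonneg : ∀ b : Bool, 0 ≤ b.toInt := by decide

lemma toInt_le_one : ∀ b : Bool, b.toInt ≤ 1 := by decide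

/-- The contribution of one colour to a triple whose three pairs carry `a`, `b`, `c`, where `t` tells
whether the triple is an edge. -/
def triWeight (a b c t : Bool) : ℤ :=
  a.toInt * b.toInt + a.toInt * c.toInt + b.toInt * c.toInt -
    (1 - t.toInt) * (a.toInt + b.toInt + c.toInt)

/-- The contribution of one colour to a 4-set `{x, y, u, v}`; the six pairs `xy, xu, xv, yu, yv, uv`
carry `a, b, c, d, e, f` and the four triples `xyu, xyv, xuv, yuv` carry `p, q, r, s`. -/
def quadWeight (a b c d e f p q r s : Bool) : ℤ :=
  triWeight a b d p + triWeight a c e q + triWeight b c f r + triWeight d e f s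

/-- The bound on `3 * quadWeight` per edge, in terms of the perfect matchings present. -/
def matchWeight : Bool → Bool → Bool → ℤ
  | false, false, false => 3
  | true, true, true => 9
  | true, true, false => 6
  | true, false, true => 6
  | false, true, true => 6
  | _, _, _ => 5

lemma quadWeight_le : ∀ a b c d e f p q r s : Bool, 3 * quadWeight a b c d e f p q r s ≤
    matchWeight (a && f) (b && e) (c && d) * (p.toInt + q.toInt + r.toInt + s.toInt) := by
  decide +kernel

/-- Three distinct colours contain the three perfect matchings, respectively. -/
def hasTransversal (a b c d a' b' c' d' a'' b'' c'' d'' : Bool) : Bool :=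
  (a && (b' && (c'' || d'') || c' && (b'' || d'') || d' && (b'' || c''))) ||
  (b && (a' && (c'' || d'') || c' && (a'' || d'') || d' && (a'' || c''))) ||
  (c && (a' && (b'' || d'') || b' && (a'' || d'') || d' && (a'' || b''))) ||
  (d && (a' && (b'' || c'') || b' && (a'' || c'') || c' && (a'' || b'')))

/-- No three distinct colours contain the three perfect matchings, respectively. -/
def NoTransversal (m₁ m₂ m₃ : Fin 4 → Bool) : Prop :=
  ∀ i j l : Fin 4, i ≠ j → i ≠ l → j ≠ l → m₁ i → m₂ j → m₃ l → False

lemma NoTransversal.hasTransversal_eq {m₁ m₂ m₃ : Fin 4 → Bool} (h : NoTransversal m₁ m₂ m₃) :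
    hasTransversal (m₁ 0) (m₁ 1) (m₁ 2) (m₁ 3) (m₂ 0) (m₂ 1) (m₂ 2) (m₂ 3)
      (m₃ 0) (m₃ 1) (m₃ 2) (m₃ 3) = false := by
  by_contra hc
  simp only [Bool.not_eq_false, hasTransversal, Bool.or_eq_true, Bool.and_eq_true] at hc
  rcases hc with ((hc | hc) | hc) | hc <;> obtain ⟨h1, hc⟩ := hc <;>
    rcases hc with (hc | hc) | hc <;> obtain ⟨h2, h3 | h3⟩ := hc <;>
    exact h _ _ _ (by decide) (by decide) (by decide) h1 h2 h3

lemma sum_matchWeight_le : ∀ a b c d a' b' c' d' a'' b'' c'' d'' : Bool,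
    hasTransversal a b c d a' b' c' d' a'' b'' c'' d'' = false →
    matchWeight a a' a'' + matchWeight b b' b'' + matchWeight c c' c'' +
      matchWeight d d' d'' ≤ 24 ∧
    a.toInt + a'.toInt + a''.toInt + (b.toInt + b'.toInt + b''.toInt) +
      (c.toInt + c'.toInt + c''.toInt) + (d.toInt + d'.toInt + d''.toInt) ≤ 8 := by
  decide +kernel

lemma sum_pairs_le : ∀ a b c d e f : Bool,
    a.toInt + b.toInt + c.toInt + d.toInt + e.toInt + f.toInt ≤
      3 + ((a && f).toInt + (b && e).toInt + (c && d).toInt) := by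
  decide +kernel

/-- The five remaining colour sets in a tight 4-set whose first pair carries the colour. -/
def tightList (p q r s : Bool) : List (Bool × Bool × Bool × Bool × Bool) :=
  (do
    let b ← [true, false]
    let c ← [true, false]
    let d ← [true, false]
    let e ← [true, false]
    let f ← [true, false]
    return (b, c, d, e, f)).filter fun g =>
      3 * quadWeight true g.1 g.2.1 g.2.2.1 g.2.2.2.1 g.2.2.2.2 p q r s ==
        matchWeight g.2.2.2.2 (g.1 && g.2.2.2.1) (g.2.1 && g.2.2.1) *
          (p.toInt + q.toInt + r.toInt + s.toInt)

lemma mem_tightList : ∀ b c d e f p q r s : Bool,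
    3 * quadWeight true b c d e f p q r s =
      matchWeight f (b && e) (c && d) * (p.toInt + q.toInt + r.toInt + s.toInt) →
    (b, c, d, e, f) ∈ tightList p q r s := by
  decide +kernel

/-- The multiplicities of the pairs `xu, xv, yu, yv, uv` in tight 4-sets `{x, y, u, v}` for which
`xy` carries all four colours. -/
def tightMult : List (ℤ × ℤ × ℤ × ℤ × ℤ) :=
  [(0, 4, 4, 4, 4), (4, 4, 0, 4, 4), (4, 0, 4, 4, 4), (4, 4, 4, 0, 4), (4, 4, 4, 4, 0),
    (2, 2, 4, 4, 2), (4, 4, 2, 2, 2), (1, 4, 4, 3, 4), (2, 4, 4, 2, 4), (3, 4, 4, 1, 4),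
    (4, 1, 3, 4, 4), (4, 2, 2, 4, 4), (4, 3, 1, 4, 4)]

lemma mem_tightMult_aux : ∀ p q r s : Bool, ∀ g₀ ∈ tightList p q r s, ∀ g₁ ∈ tightList p q r s,
    ∀ g₂ ∈ tightList p q r s, ∀ g₃ ∈ tightList p q r s,
    hasTransversal g₀.2.2.2.2 g₁.2.2.2.2 g₂.2.2.2.2 g₃.2.2.2.2
      (g₀.1 && g₀.2.2.2.1) (g₁.1 && g₁.2.2.2.1) (g₂.1 && g₂.2.2.2.1) (g₃.1 && g₃.2.2.2.1)
      (g₀.2.1 && g₀.2.2.1) (g₁.2.1 && g₁.2.2.1) (g₂.2.1 && g₂.2.2.1) (g₃.2.1 && g₃.2.2.1)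
      = false →
    (matchWeight g₀.2.2.2.2 (g₀.1 && g₀.2.2.2.1) (g₀.2.1 && g₀.2.2.1) +
      matchWeight g₁.2.2.2.2 (g₁.1 && g₁.2.2.2.1) (g₁.2.1 && g₁.2.2.1) +
      matchWeight g₂.2.2.2.2 (g₂.1 && g₂.2.2.2.1) (g₂.2.1 && g₂.2.2.1) +
      matchWeight g₃.2.2.2.2 (g₃.1 && g₃.2.2.2.1) (g₃.2.1 && g₃.2.2.1)) *
        (p.toInt + q.toInt + r.toInt + s.toInt) = 24 * (p.toInt + q.toInt + r.toInt + s.toInt) →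
    (g₀.1.toInt + g₁.1.toInt + g₂.1.toInt + g₃.1.toInt,
      g₀.2.1.toInt + g₁.2.1.toInt + g₂.2.1.toInt + g₃.2.1.toInt,
      g₀.2.2.1.toInt + g₁.2.2.1.toInt + g₂.2.2.1.toInt + g₃.2.2.1.toInt,
      g₀.2.2.2.1.toInt + g₁.2.2.2.1.toInt + g₂.2.2.2.1.toInt + g₃.2.2.2.1.toInt,
      g₀.2.2.2.2.toInt + g₁.2.2.2.2.toInt + g₂.2.2.2.2.toInt + g₃.2.2.2.2.toInt) ∈ tightMult := by
  decide +kernel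

variable {a b c d e f : Fin 4 → Bool}

/-- The weight of a 4-set with colour sets `a, …, f` and edges `p, q, r, s`. -/
def quadSum (a b c d e f : Fin 4 → Bool) (p q r s : Bool) : ℤ :=
  ∑ i, quadWeight (a i) (b i) (c i) (d i) (e i) (f i) p q r s -
    8 * (p.toInt + q.toInt + r.toInt + s.toInt)

lemma quadSum_nonpos
    (h : NoTransversal (fun i => a i && f i) (fun i => b i && e i) fun i => c i && d i)
    (p q r s : Bool) : quadSum a b c d e f p q r s ≤ 0 := by
  have h1 := (sum_matchWeight_le _ _ _ _ _ _ _ _ _ _ _ _ h.hasTransversal_eq).1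
  have h2 := fun i => quadWeight_le (a i) (b i) (c i) (d i) (e i) (f i) p q r s
  have h20 := h2 0
  have h21 := h2 1
  have h22 := h2 2
  have h23 := h2 3
  have hn : 0 ≤ p.toInt + q.toInt + r.toInt + s.toInt := by
    linarith [toInt_nonneg p, toInt_nonneg q, toInt_nonneg r, toInt_nonneg s]
  have := mul_le_mul_of_nonneg_right h1 hn
  simp only [quadSum, Fin.sum_univ_four]
  linarith

lemma sum_mult_le
    (h : NoTransversal (fun i => a i && f i) (fun i => b i && e i) fun i => c i && d i) :
    ∑ i, (a i).toInt + ∑ i, (b i).toInt + ∑ i, (c i).toInt + ∑ i, (d i).toInt +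
      ∑ i, (e i).toInt + ∑ i, (f i).toInt ≤ 20 := by
  have h1 := (sum_matchWeight_le _ _ _ _ _ _ _ _ _ _ _ _ h.hasTransversal_eq).2
  have h2 := fun i => sum_pairs_le (a i) (b i) (c i) (d i) (e i) (f i)
  have h20 := h2 0
  have h21 := h2 1
  have h22 := h2 2
  have h23 := h2 3
  simp only [Fin.sum_univ_four]
  linarith

lemma mem_tightMult
    (h : NoTransversal (fun i => a i && f i) (fun i => b i && e i) fun i => c i && d i)
    (ha : ∀ i, a i = true) {p q r s : Bool} (ht : quadSum a b c d e f p q r s = 0) :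
    (∑ i, (b i).toInt, ∑ i, (c i).toInt, ∑ i, (d i).toInt, ∑ i, (e i).toInt, ∑ i, (f i).toInt) ∈
      tightMult := by
  have ht' := h.hasTransversal_eq
  have h1 := (sum_matchWeight_le _ _ _ _ _ _ _ _ _ _ _ _ ht').1
  have h2 := fun i => quadWeight_le (a i) (b i) (c i) (d i) (e i) (f i) p q r s
  have h20 := h2 0
  have h21 := h2 1
  have h22 := h2 2
  have h23 := h2 3
  have hn : 0 ≤ p.toInt + q.toInt + r.toInt + s.toInt := by
    linarith [toInt_nonneg p, toInt_nonneg q, toInt_nonneg r, toInt_nonneg s]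
  have h3 := mul_le_mul_of_nonneg_right h1 hn
  simp only [quadSum, Fin.sum_univ_four] at ht
  simp only [ha, Bool.true_and] at *
  have k : ∀ i, (b i, c i, d i, e i, f i) ∈ tightList p q r s := by
    intro i
    apply mem_tightList
    fin_cases i <;> simp only [Fin.zero_eta, Fin.mk_one, Fin.reduceFinMk] <;> linarith
  have := mem_tightMult_aux p q r s _ (k 0) _ (k 1) _ (k 2) _ (k 3) ht' (by linarith)
  simpa only [Fin.sum_univ_four] using this

end FourSet

section DenseMultigraph

variable {V : Type*} [DecidableEq V]

lemma sum_sum_insert_of_symm {w : V → V → ℤ} (hs : ∀ x y, w x y = w y x) (h0 : ∀ x, w x x = 0)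
    {x : V} {S : Finset V} (hx : x ∉ S) :
    ∑ u ∈ insert x S, ∑ v ∈ insert x S, w u v = ∑ u ∈ S, ∑ v ∈ S, w u v + 2 * ∑ u ∈ S, w u x := by
  rw [Finset.sum_insert hx, Finset.sum_insert hx, h0]
  simp only [Finset.sum_insert hx, Finset.sum_add_distrib, hs x]
  ring

/-- A multigraph with edge multiplicities at most `4` in which every four vertices span at most
`20` edges has at most `3 m² / 2` edges on any `m` vertices. -/
lemma sum_sum_mult_le {w : V → V → ℤ} (hs : ∀ x y, w x y = w y x) (h0 : ∀ x, w x x = 0)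
    (h4 : ∀ x y, w x y ≤ 4)
    (hQ : ∀ x y u v, w x y + w x u + w x v + w y u + w y v + w u v ≤ 20) (S : Finset V) :
    ∑ x ∈ S, ∑ y ∈ S, w x y ≤ 3 * (#S : ℤ) ^ 2 := by
  induction S using Finset.strongInduction with
  | H S ih =>
  by_cases hT : ∃ x ∈ S, ∃ y ∈ S, ∃ z ∈ S, 11 ≤ w x y + w x z + w y z
  · obtain ⟨x, hx, y, hy, z, hz, hw⟩ := hT
    have hxy : x ≠ y := by
      rintro rfl
      have := h4 x z
      have := h0 x
      omega
    have hxz : x ≠ z := by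
      rintro rfl
      have := h4 x y
      have := h4 y x
      have := h0 x
      omega
    have hyz : y ≠ z := by
      rintro rfl
      have := h4 x y
      have := h0 y
      omega
    set S' := ((S.erase x).erase y).erase z with hS'
    have e1 : z ∉ S' := by simp [hS']
    have e2 : y ∉ insert z S' := by simp [hS', hyz]
    have e3 : x ∉ insert y (insert z S') := by simp [hS', hxy, hxz]
    have eS : S = insert x (insert y (insert z S')) := by
      rw [hS', Finset.insert_erase, Finset.insert_erase, Finset.insert_erase hx]
      · simp [hy, hxy.symm]
      · simp [hz, hxz.symm, hyz.symm]
    have hlt : S' ⊂ S := by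
      rw [Finset.ssubset_iff_of_subset]
      · exact ⟨x, hx, fun h => e3 (by simp [h])⟩
      · rw [eS]
        intro u hu
        simp [hu]
    have hc : #S = #S' + 3 := by
      rw [eS, Finset.card_insert_of_notMem e3, Finset.card_insert_of_notMem e2,
        Finset.card_insert_of_notMem e1]
    have hsum : ∑ u ∈ S', (w u x + w u y + w u z) ≤ ∑ u ∈ S', (9 : ℤ) := by
      refine Finset.sum_le_sum fun u _ => ?_
      have := hQ x y z u
      rw [hs u x, hs u y, hs u z]
      linarith
    rw [Finset.sum_add_distrib, Finset.sum_add_distrib, Finset.sum_const, nsmul_eq_mul] at hsum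
    have := ih S' hlt
    rw [hc, eS, sum_sum_insert_of_symm hs h0 e3, sum_sum_insert_of_symm hs h0 e2,
      sum_sum_insert_of_symm hs h0 e1, Finset.sum_insert e2, Finset.sum_insert e1,
      Finset.sum_insert e1]
    push_cast
    have := h4 y x
    have := h4 z x
    have := h4 z y
    nlinarith
  by_cases hP : ∃ x ∈ S, ∃ y ∈ S, w x y = 4
  · obtain ⟨x, hx, y, hy, hw⟩ := hP
    have hxy : x ≠ y := by
      rintro rfl
      have := h0 x
      omega
    set S' := (S.erase x).erase y with hS'
    have e2 : y ∉ S' := by simp [hS']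
    have e3 : x ∉ insert y S' := by simp [hS', hxy]
    have eS : S = insert x (insert y S') := by
      rw [hS', Finset.insert_erase, Finset.insert_erase hx]
      simp [hy, hxy.symm]
    have hlt : S' ⊂ S := by
      rw [Finset.ssubset_iff_of_subset]
      · exact ⟨x, hx, fun h => e3 (by simp [h])⟩
      · rw [eS]
        intro u hu
        simp [hu]
    have hc : #S = #S' + 2 := by
      rw [eS, Finset.card_insert_of_notMem e3, Finset.card_insert_of_notMem e2]
    have hsum : ∑ u ∈ S', (w u x + w u y) ≤ ∑ u ∈ S', (6 : ℤ) := by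
      refine Finset.sum_le_sum fun u hu => ?_
      by_contra hcon
      refine hT ⟨x, hx, y, hy, u, hlt.1 hu, ?_⟩
      rw [hs x u, hs y u]
      omega
    rw [Finset.sum_add_distrib, Finset.sum_const, nsmul_eq_mul] at hsum
    have := ih S' hlt
    rw [hc, eS, sum_sum_insert_of_symm hs h0 e3, sum_sum_insert_of_symm hs h0 e2,
      Finset.sum_insert e2]
    push_cast
    have := h4 y x
    nlinarith
  · have : ∑ x ∈ S, ∑ y ∈ S, w x y ≤ ∑ x ∈ S, ∑ y ∈ S, (3 : ℤ) := by
      refine Finset.sum_le_sum fun x hx => Finset.sum_le_sum fun y hy => ?_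
      have h1 := h4 x y
      by_contra hcon
      exact hP ⟨x, hx, y, hy, by omega⟩
    simp only [Finset.sum_const, nsmul_eq_mul] at this
    linarith

end DenseMultigraph

section Turan

variable {V : Type*} {h : V → V → V → Bool}

/-- The colour sets of pairs, for colours given by the link graphs of four vertices. -/
def linkMult (h : V → V → V → Bool) (k : Fin 4 → V) (x y : V) : ℤ :=
  ∑ i, (h (k i) x y).toInt

/-- Four vertices spanning a complete 3-graph. -/
def IsK4 (h : V → V → V → Bool) (k : Fin 4 → V) : Prop :=
  ∀ i j l : Fin 4, i ≠ j → i ≠ l → j ≠ l → h (k i) (k j) (k l)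

lemma FanoFreeInd.rotate (hh : FanoFreeInd h) (x y z : V) : h x y z = h z x y := by
  rw [hh.swap_right x y z, hh.swap_left x z y]

lemma linkMult_le_four (k : Fin 4 → V) (x y : V) : linkMult h k x y ≤ 4 :=
  (Finset.sum_le_sum fun _ _ => toInt_le_one _).trans (by simp)

lemma FanoFreeInd.linkMult_comm (hh : FanoFreeInd h) (k : Fin 4 → V) (x y : V) :
    linkMult h k x y = linkMult h k y x :=
  Finset.sum_congr rfl fun i _ => by rw [hh.swap_right]

lemma FanoFreeInd.linkMult_self (hh : FanoFreeInd h) (k : Fin 4 → V) (x : V) :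
    linkMult h k x x = 0 :=
  Finset.sum_eq_zero fun i _ => by rw [← hh.rotate, hh.diag]; rfl

lemma FanoFreeInd.noTransversal (hh : FanoFreeInd h) {k : Fin 4 → V} (hk : IsK4 h k)
    (x y u v : V) :
    NoTransversal (fun i => h (k i) x y && h (k i) u v) (fun i => h (k i) x u && h (k i) y v)
      fun i => h (k i) x v && h (k i) y u := by
  intro i j l hij hil hjl h1 h2 h3
  simp only [Bool.and_eq_true] at h1 h2 h3
  refine hh.no_fano (k i) (k j) (k l) v x y u (hk i j l hij hil hjl) ?_ ?_ ?_ ?_ ?_ ?_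
  · rw [hh.swap_right]; exact h3.1
  · rw [hh.rotate]; exact h1.1
  · exact h1.2
  · rw [hh.swap_right]; exact h2.1
  · rw [hh.swap_right]; exact h3.2
  · rw [hh.swap_right]; exact h2.2

lemma FanoFreeInd.sum_linkMult_le [DecidableEq V] (hh : FanoFreeInd h) {k : Fin 4 → V}
    (hk : IsK4 h k) (S : Finset V) :
    ∑ x ∈ S, ∑ y ∈ S, linkMult h k x y ≤ 3 * (#S : ℤ) ^ 2 :=
  sum_sum_mult_le (hh.linkMult_comm k) (hh.linkMult_self k) (linkMult_le_four k)
    (fun x y u v => by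
      have := sum_mult_le (hh.noTransversal hk x y u v)
      simp only [linkMult]
      linarith) S

lemma isK4_vec (hh : FanoFreeInd h) {x y z u : V} (h1 : h x y z) (h2 : h x y u) (h3 : h x z u)
    (h4 : h y z u) : IsK4 h ![x, y, z, u] := by
  intro i j l hij hil hjl
  have s1 := hh.swap_left
  have s2 := hh.swap_right
  fin_cases i <;> fin_cases j <;> fin_cases l <;>
    first
      | exact absurd rfl hij
      | exact absurd rfl hil
      | exact absurd rfl hjl
      | (simp; grind)

lemma FanoFreeInd.sum_insert [DecidableEq V] (hh : FanoFreeInd h) {v : V} {S : Finset V}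
    (hv : v ∉ S) :
    ∑ x ∈ insert v S, ∑ y ∈ insert v S, ∑ z ∈ insert v S, (h x y z).toInt =
      ∑ x ∈ S, ∑ y ∈ S, ∑ z ∈ S, (h x y z).toInt + 3 * ∑ y ∈ S, ∑ z ∈ S, (h v y z).toInt := by
  have e1 : ∀ x z, h x v z = h v x z := fun x z => hh.swap_left x v z
  have e2 : ∀ x y, h x y v = h v x y := fun x y => hh.rotate x y v
  simp only [Finset.sum_insert hv, Finset.sum_add_distrib, e1, e2, hh.diag, Bool.toInt_false,
    Finset.sum_const_zero]
  simp
  ring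

/-- If no four vertices of `S` span a complete 3-graph, then the edge density in `S` is at most
`3 / 4`. -/
lemma sum_le_of_K4_free (S : Finset V)
    (hS : ∀ x ∈ S, ∀ y ∈ S, ∀ z ∈ S, ∀ u ∈ S, ¬ (h x y z ∧ h x y u ∧ h x z u ∧ h y z u)) :
    4 * ∑ x ∈ S, ∑ y ∈ S, ∑ z ∈ S, (h x y z).toInt ≤ 3 * (#S : ℤ) ^ 3 := by
  rcases S.eq_empty_or_nonempty with rfl | hne
  · simp
  have hpos : (0 : ℤ) < #S := by exact_mod_cast hne.card_pos
  have : ∑ x ∈ S, ∑ y ∈ S, ∑ z ∈ S, ∑ u ∈ S,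
      ((h x y z).toInt + (h x y u).toInt + (h x z u).toInt + (h y z u).toInt) ≤
      ∑ x ∈ S, ∑ y ∈ S, ∑ z ∈ S, ∑ u ∈ S, 3 := by
    refine Finset.sum_le_sum fun x hx => Finset.sum_le_sum fun y hy => Finset.sum_le_sum fun z hz =>
      Finset.sum_le_sum fun u hu => ?_
    have := hS x hx y hy z hz u hu
    revert this
    generalize h x y z = a
    generalize h x y u = b
    generalize h x z u = c
    generalize h y z u = d
    revert a b c d
    decide
  simp only [Finset.sum_add_distrib, Finset.sum_const, nsmul_eq_mul, ← Finset.mul_sum] at this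
  refine le_of_mul_le_mul_left ?_ hpos
  linarith

/-- An asymptotically sharp bound for the number of edges on any set of vertices. -/
lemma FanoFreeInd.sum_le [DecidableEq V] (hh : FanoFreeInd h) (S : Finset V) :
    4 * ∑ x ∈ S, ∑ y ∈ S, ∑ z ∈ S, (h x y z).toInt ≤ 3 * (#S : ℤ) ^ 3 + 24 * (#S : ℤ) ^ 2 := by
  induction S using Finset.strongInduction with
  | H S ih =>
  by_cases hK : ∃ x ∈ S, ∃ y ∈ S, ∃ z ∈ S, ∃ u ∈ S, h x y z ∧ h x y u ∧ h x z u ∧ h y z u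
  · obtain ⟨x, hx, y, hy, z, hz, u, hu, h1, h2, h3, h4⟩ := hK
    have hk := isK4_vec hh h1 h2 h3 h4
    set k := ![x, y, z, u] with hkdef
    have hkS : ∀ i, k i ∈ S := by
      intro i
      fin_cases i <;> simp [*]
    have hsum := hh.sum_linkMult_le hk S
    obtain ⟨i, hi⟩ : ∃ i, 4 * ∑ a ∈ S, ∑ b ∈ S, (h (k i) a b).toInt ≤ 3 * (#S : ℤ) ^ 2 := by
      by_contra! hcon
      have h0 := hcon 0
      have h1 := hcon 1
      have h2 := hcon 2
      have h3 := hcon 3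
      simp only [linkMult, Fin.sum_univ_four, Finset.sum_add_distrib] at hsum
      linarith
    set v := k i
    have hv : v ∈ S := hkS i
    have hlt := Finset.erase_ssubset hv
    have := ih _ hlt
    have hcard : (#S : ℤ) = #(S.erase v) + 1 := by
      exact_mod_cast (Finset.card_erase_add_one hv).symm
    have hle : ∑ a ∈ S.erase v, ∑ b ∈ S.erase v, (h v a b).toInt ≤
        ∑ a ∈ S, ∑ b ∈ S, (h v a b).toInt := by
      refine (Finset.sum_le_sum fun a _ => Finset.sum_le_sum_of_subset_of_nonneg hlt.1
        fun _ _ _ => toInt_nonneg _).trans ?_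
      exact Finset.sum_le_sum_of_subset_of_nonneg hlt.1
        fun _ _ _ => Finset.sum_nonneg fun _ _ => toInt_nonneg _
    have e := hh.sum_insert (Finset.notMem_erase v S)
    rw [Finset.insert_erase hv] at e
    rw [e]
    rw [hcard] at hi ⊢
    nlinarith [Nat.cast_nonneg (α := ℤ) #(S.erase v)]
  · have := sum_le_of_K4_free (h := h) S fun x hx y hy z hz u hu hc =>
      hK ⟨x, hx, y, hy, z, hz, u, hu, hc⟩
    nlinarith [sq_nonneg (#S : ℤ)]

variable [Fintype V]

lemma FanoFreeInd.sum_l2Ind (hh : FanoFreeInd h) :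
    ∑ v, l2Ind h v = 2 * ∑ x, ∑ y, codInd h x y ^ 2 := by
  unfold l2Ind
  rw [Finset.sum_add_distrib]
  have : ∑ v, ∑ x, ∑ y, (h v x y).toInt * codInd h x y = ∑ x, ∑ y, codInd h x y ^ 2 := by
    rw [Finset.sum_comm]
    refine Finset.sum_congr rfl fun x _ => ?_
    rw [Finset.sum_comm]
    refine Finset.sum_congr rfl fun y _ => ?_
    rw [← Finset.sum_mul, pow_two]
    congr 1
    exact Finset.sum_congr rfl fun v _ => by rw [← hh.rotate]
  rw [this]
  ring

lemma FanoFreeInd.codInd_sq (x y : V) :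
    codInd h x y ^ 2 = ∑ z, ∑ u, (h x y z).toInt * (h x y u).toInt := by
  rw [codInd, pow_two, Finset.sum_mul_sum]

/-- A 3-graph whose ℓ2-norm is large contains a complete 3-graph on four vertices. -/
lemma FanoFreeInd.exists_isK4 (hh : FanoFreeInd h)
    (hX : (Fintype.card V : ℤ) ^ 4 < ∑ v, l2Ind h v) : ∃ k, IsK4 h k := by
  by_contra! hk
  rw [hh.sum_l2Ind] at hX
  have key : ∑ x : V, ∑ y : V, ∑ z : V, ∑ u : V,
      ((h x y z).toInt * (h x y u).toInt + (h x z y).toInt * (h x z u).toInt +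
       (h x u y).toInt * (h x u z).toInt + (h y z x).toInt * (h y z u).toInt +
       (h y u x).toInt * (h y u z).toInt + (h z u x).toInt * (h z u y).toInt) ≤
      ∑ x : V, ∑ y : V, ∑ z : V, ∑ u : V, 3 := by
    refine Finset.sum_le_sum fun x _ => Finset.sum_le_sum fun y _ => Finset.sum_le_sum fun z _ =>
      Finset.sum_le_sum fun u _ => ?_
    have hno : ¬ (h x y z ∧ h x y u ∧ h x z u ∧ h y z u) :=
      fun hc => hk _ (isK4_vec hh hc.1 hc.2.1 hc.2.2.1 hc.2.2.2)
    rw [hh.swap_right x z y, hh.swap_right x u y, hh.swap_right x u z, hh.rotate y z x,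
      hh.rotate y u x, hh.swap_right y u z, hh.rotate z u x, hh.rotate z u y]
    revert hno
    generalize h x y z = a
    generalize h x y u = b
    generalize h x z u = c
    generalize h y z u = d
    revert a b c d
    decide
  simp only [Finset.sum_add_distrib, Finset.sum_const, nsmul_eq_mul, Finset.card_univ] at key
  set X := ∑ x, ∑ y, codInd h x y ^ 2 with hXdef
  simp only [FanoFreeInd.codInd_sq] at hXdef
  have e1 : ∑ x : V, ∑ y : V, ∑ z : V, ∑ u : V, (h x z y).toInt * (h x z u).toInt = X := by
    rw [hXdef]
    exact Finset.sum_congr rfl fun x _ => Finset.sum_comm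
  have e2 : ∑ x : V, ∑ y : V, ∑ z : V, ∑ u : V, (h x u y).toInt * (h x u z).toInt = X := by
    rw [hXdef]
    refine Finset.sum_congr rfl fun x _ => ?_
    rw [Finset.sum_congr rfl fun y _ => Finset.sum_comm, Finset.sum_comm]
  have e3 : ∑ x : V, ∑ y : V, ∑ z : V, ∑ u : V, (h y z x).toInt * (h y z u).toInt = X := by
    rw [hXdef, Finset.sum_comm]
    exact Finset.sum_congr rfl fun x _ => Finset.sum_comm
  have e4 : ∑ x : V, ∑ y : V, ∑ z : V, ∑ u : V, (h y u x).toInt * (h y u z).toInt = X := by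
    rw [hXdef, Finset.sum_comm]
    refine Finset.sum_congr rfl fun x _ => ?_
    rw [Finset.sum_congr rfl fun y _ => Finset.sum_comm, Finset.sum_comm]
  have e5 : ∑ x : V, ∑ y : V, ∑ z : V, ∑ u : V, (h z u x).toInt * (h z u y).toInt = X := by
    rw [hXdef, Finset.sum_congr rfl fun x _ => Finset.sum_comm, Finset.sum_comm]
    refine Finset.sum_congr rfl fun z _ => ?_
    rw [Finset.sum_congr rfl fun x _ => Finset.sum_comm, Finset.sum_comm]
  rw [e1, e2, e3, e4, e5, ← hXdef] at key
  linarith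

end Turan

section Counting

variable {V : Type*} {h : V → V → V → Bool} {k : Fin 4 → V}

/-- The weight of the triple `x, y, z` with respect to the links of four vertices. -/
def triSum (h : V → V → V → Bool) (k : Fin 4 → V) (x y z : V) : ℤ :=
  ∑ i, triWeight (h (k i) x y) (h (k i) x z) (h (k i) y z) (h x y z) - 8 * (h x y z).toInt

/-- The weight of the 4-tuple `x, y, u, v` with respect to the links of four vertices. -/
def linkQuadSum (h : V → V → V → Bool) (k : Fin 4 → V) (x y u v : V) : ℤ :=
  quadSum (fun i => h (k i) x y) (fun i => h (k i) x u) (fun i => h (k i) x v)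
    (fun i => h (k i) y u) (fun i => h (k i) y v) (fun i => h (k i) u v)
    (h x y u) (h x y v) (h x u v) (h y u v)

lemma linkQuadSum_eq (x y u v : V) : linkQuadSum h k x y u v =
    triSum h k x y u + triSum h k x y v + triSum h k x u v + triSum h k y u v := by
  simp only [linkQuadSum, quadSum, quadWeight, triSum, Finset.sum_add_distrib]
  ring

lemma FanoFreeInd.linkQuadSum_nonpos (hh : FanoFreeInd h) (hk : IsK4 h k) (x y u v : V) :
    linkQuadSum h k x y u v ≤ 0 :=
  quadSum_nonpos (hh.noTransversal hk x y u v) _ _ _ _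

/-- The indicator that the 4-tuple `x, y, u, v` is not tight. -/
def slack (h : V → V → V → Bool) (k : Fin 4 → V) (x y u v : V) : ℤ :=
  if linkQuadSum h k x y u v = 0 then 0 else 1

lemma slack_nonneg (x y u v : V) : 0 ≤ slack h k x y u v := by
  unfold slack; split_ifs <;> simp

variable [Fintype V]

lemma sum_linkQuadSum : ∑ x, ∑ y, ∑ u, ∑ v, linkQuadSum h k x y u v =
    4 * (Fintype.card V * ∑ x, ∑ y, ∑ z, triSum h k x y z) := by
  simp only [linkQuadSum_eq, Finset.sum_add_distrib, Finset.sum_const, nsmul_eq_mul,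
    Finset.card_univ, ← Finset.mul_sum]
  ring

lemma FanoFreeInd.sum_triSum (hh : FanoFreeInd h) : ∑ x, ∑ y, ∑ z, triSum h k x y z =
    3 * ∑ i, l2Ind h (k i) - 8 * ∑ x, ∑ y, ∑ z, (h x y z).toInt -
      3 * (Fintype.card V * ∑ x, ∑ y, linkMult h k x y) := by
  have key : ∀ w : V, ∑ x, ∑ y, ∑ z, triWeight (h w x y) (h w x z) (h w y z) (h x y z) =
      3 * l2Ind h w - 3 * (Fintype.card V * ∑ x, ∑ y, (h w x y).toInt) := by
    intro w
    have hs : ∀ x y, h w x y = h w y x := fun x y => hh.swap_right w x y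
    have a1 : ∑ x, ∑ y, ∑ z, (h w x y).toInt * (h w x z).toInt = ∑ u, codInd h w u ^ 2 :=
      Finset.sum_congr rfl fun x _ => (codInd_sq w x).symm
    have a2 : ∑ x, ∑ y, ∑ z, (h w x y).toInt * (h w y z).toInt = ∑ u, codInd h w u ^ 2 := by
      rw [← a1, Finset.sum_comm]
      exact Finset.sum_congr rfl fun x _ => Finset.sum_congr rfl fun y _ => by rw [hs]
    have a3 : ∑ x, ∑ y, ∑ z, (h w x z).toInt * (h w y z).toInt = ∑ u, codInd h w u ^ 2 := by
      rw [← a1, Finset.sum_congr rfl fun x _ => Finset.sum_comm, Finset.sum_comm]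
      exact Finset.sum_congr rfl fun x _ => Finset.sum_congr rfl fun y _ =>
        Finset.sum_congr rfl fun z _ => by rw [hs y x, hs z x]
    have b1 : ∑ x, ∑ y, ∑ z, (h x y z).toInt * (h w x y).toInt =
        ∑ x, ∑ y, (h w x y).toInt * codInd h x y :=
      Finset.sum_congr rfl fun x _ => Finset.sum_congr rfl fun y _ => by
        rw [codInd, Finset.mul_sum]
        exact Finset.sum_congr rfl fun z _ => mul_comm _ _
    have b2 : ∑ x, ∑ y, ∑ z, (h x y z).toInt * (h w x z).toInt =
        ∑ x, ∑ y, (h w x y).toInt * codInd h x y := by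
      rw [← b1]
      refine Finset.sum_congr rfl fun x _ => ?_
      rw [Finset.sum_comm]
      exact Finset.sum_congr rfl fun y _ => Finset.sum_congr rfl fun z _ => by
        rw [hh.swap_right x z y]
    have b3 : ∑ x, ∑ y, ∑ z, (h x y z).toInt * (h w y z).toInt =
        ∑ x, ∑ y, (h w x y).toInt * codInd h x y := by
      rw [← b2, Finset.sum_comm]
      exact Finset.sum_congr rfl fun x _ => Finset.sum_congr rfl fun y _ =>
        Finset.sum_congr rfl fun z _ => by rw [hh.swap_left y x z]
    have c1 : ∑ x : V, ∑ y : V, ∑ z : V, (h w x y).toInt =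
        Fintype.card V * ∑ x, ∑ y, (h w x y).toInt := by
      simp only [Finset.sum_const, nsmul_eq_mul, Finset.card_univ, ← Finset.mul_sum]
    have c2 : ∑ x : V, ∑ y : V, ∑ z : V, (h w x z).toInt =
        Fintype.card V * ∑ x, ∑ y, (h w x y).toInt := by
      simp only [Finset.sum_const, nsmul_eq_mul, Finset.card_univ, ← Finset.mul_sum]
    have c3 : ∑ x : V, ∑ y : V, ∑ z : V, (h w y z).toInt =
        Fintype.card V * ∑ x, ∑ y, (h w x y).toInt := by
      simp only [Finset.sum_const, nsmul_eq_mul, Finset.card_univ]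
    have e : ∀ x y z, triWeight (h w x y) (h w x z) (h w y z) (h x y z) =
        (h w x y).toInt * (h w x z).toInt + (h w x y).toInt * (h w y z).toInt +
        (h w x z).toInt * (h w y z).toInt + (h x y z).toInt * (h w x y).toInt +
        (h x y z).toInt * (h w x z).toInt + (h x y z).toInt * (h w y z).toInt -
        ((h w x y).toInt + (h w x z).toInt + (h w y z).toInt) := by
      intro x y z
      unfold triWeight
      ring
    simp only [e, Finset.sum_add_distrib, Finset.sum_sub_distrib, a1, a2, a3, b1, b2, b3, c1, c2,
      c3, l2Ind]
    ring
  have k0 := key (k 0)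
  have k1 := key (k 1)
  have k2 := key (k 2)
  have k3 := key (k 3)
  simp only [triSum, linkMult, Fin.sum_univ_four, Finset.sum_add_distrib, Finset.sum_sub_distrib,
    k0, k1, k2, k3, ← Finset.mul_sum]
  ring

/-- The numerical consequences of a large minimum ℓ2-norm degree. -/
lemma FanoFreeInd.numerics [DecidableEq V] (hh : FanoFreeInd h) (hk : IsK4 h k)
    (hn : (10 : ℤ) ^ 18 ≤ Fintype.card V)
    (hQ : ∀ v, (5 * 10 ^ 15 - 4) * (Fintype.card V : ℤ) ^ 3 ≤ 4 * 10 ^ 15 * l2Ind h v) :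
    10 ^ 13 * ∑ x, ∑ y, ∑ u, ∑ v, slack h k x y u v ≤ (Fintype.card V : ℤ) ^ 4 ∧
    (3 * 10 ^ 13 - 4) * (Fintype.card V : ℤ) ^ 3 ≤
      4 * 10 ^ 13 * ∑ x, ∑ y, ∑ z, (h x y z).toInt ∧
    (3 * 10 ^ 13 - 1) * (Fintype.card V : ℤ) ^ 2 ≤ 10 ^ 13 * ∑ x, ∑ y, linkMult h k x y ∧
    4 * 10 ^ 13 * ∑ x, ∑ y, ∑ z, (h x y z).toInt ≤ (3 * 10 ^ 13 + 1) * (Fintype.card V : ℤ) ^ 3 := by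
  have e1 := sum_linkQuadSum (h := h) (k := k)
  have e2 := hh.sum_triSum (k := k)
  have i1 := hh.sum_le univ
  have i2 := hh.sum_linkMult_le hk univ
  rw [Finset.card_univ] at i1 i2
  have i3 : ∑ x, ∑ y, ∑ u, ∑ v, slack h k x y u v ≤
      ∑ x, ∑ y, ∑ u, ∑ v, -linkQuadSum h k x y u v := by
    refine Finset.sum_le_sum fun x _ => Finset.sum_le_sum fun y _ => Finset.sum_le_sum fun u _ =>
      Finset.sum_le_sum fun v _ => ?_
    have := hh.linkQuadSum_nonpos hk x y u v
    unfold slack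
    split_ifs <;> omega
  have i4 : ∑ x, ∑ y, ∑ u, ∑ v, linkQuadSum h k x y u v ≤ 0 :=
    Finset.sum_nonpos fun x _ => Finset.sum_nonpos fun y _ => Finset.sum_nonpos fun u _ =>
      Finset.sum_nonpos fun v _ => hh.linkQuadSum_nonpos hk x y u v
  simp only [Finset.sum_neg_distrib] at i3
  have q0 := hQ (k 0)
  have q1 := hQ (k 1)
  have q2 := hQ (k 2)
  have q3 := hQ (k 3)
  rw [Fin.sum_univ_four] at e2
  generalize ∑ x, ∑ y, ∑ u, ∑ v, linkQuadSum h k x y u v = P at *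
  generalize ∑ x, ∑ y, ∑ z, triSum h k x y z = T at *
  generalize ∑ x, ∑ y, linkMult h k x y = W at *
  generalize ∑ x, ∑ y, ∑ z, (h x y z).toInt = S at *
  generalize ∑ x, ∑ y, ∑ u, ∑ v, slack h k x y u v = Z at *
  generalize (Fintype.card V : ℤ) = n at *
  have hn0 : 0 < n := by linarith
  have hn2 : 10 ^ 18 * n ^ 2 ≤ n ^ 3 := by nlinarith [sq_nonneg n]
  have hnW : n * W ≤ 3 * n ^ 3 := by nlinarith
  have hT0 : T ≤ 0 := by
    by_contra hc
    have : 0 < n * T := mul_pos hn0 (by omega)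
    linarith
  refine ⟨?_, ?_, ?_, ?_⟩
  · have hT : -(2 * n ^ 3) ≤ 10 ^ 14 * T := by
      linarith
    nlinarith
  · linarith
  · refine le_of_mul_le_mul_left ?_ hn0
    linarith
  · linarith

end Counting

section Structure

variable {V : Type*} {h : V → V → V → Bool} {k : Fin 4 → V}

/-- The multiplicity of a triple. -/
def triMult (h : V → V → V → Bool) (k : Fin 4 → V) (x y z : V) : ℤ :=
  linkMult h k x y + linkMult h k x z + linkMult h k y z

/-- The indicator of a triple for which edge status and multiplicity do not match. -/
def atypical (h : V → V → V → Bool) (k : Fin 4 → V) (x y z : V) : ℤ :=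
  if (9 ≤ triMult h k x y z ∧ h x y z = false) ∨ (triMult h k x y z ≤ 7 ∧ h x y z = true) then 1
  else 0

/-- The triple meets both classes of the bipartition given by `a`. -/
def crossing (a : V → Bool) (x y z : V) : Bool := !(a x == a y && a x == a z)

/-- The indicator of a triple for which being an edge differs from being crossing. -/
def mismatch (h : V → V → V → Bool) (a : V → Bool) (x y z : V) : ℤ :=
  if h x y z = crossing a x y z then 0 else 1

lemma quadSum_true (a b c d e f : Fin 4 → Bool) (q r s : Bool) :
    quadSum a b c d e f true q r s = quadSum a b c d e f false q r s +
      (∑ i, (a i).toInt + ∑ i, (b i).toInt + ∑ i, (d i).toInt) - 8 := by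
  simp only [quadSum, quadWeight, triWeight, Finset.sum_add_distrib, Finset.sum_sub_distrib,
    Bool.toInt_true, Bool.toInt_false, ← Finset.mul_sum]
  ring

lemma FanoFreeInd.atypical_le_slack (hh : FanoFreeInd h) (hk : IsK4 h k) (x y u v : V) :
    atypical h k x y u ≤ slack h k x y u v := by
  unfold atypical slack
  split_ifs with h1 h2 h2
  · exfalso
    have key := fun p => quadSum_nonpos (hh.noTransversal hk x y u v) p (h x y v) (h x u v) (h y u v)
    have e := quadSum_true (fun i => h (k i) x y) (fun i => h (k i) x u) (fun i => h (k i) x v)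
      (fun i => h (k i) y u) (fun i => h (k i) y v) (fun i => h (k i) u v)
      (h x y v) (h x u v) (h y u v)
    have k1 := key true
    have k2 := key false
    simp only [triMult, linkMult] at h1
    unfold linkQuadSum at h2
    rcases h1 with ⟨h1, h3⟩ | ⟨h1, h3⟩ <;> rw [h3] at h2 <;> linarith
  all_goals simp

/-- The possible multiplicities on tight 4-tuples, whose first pair has multiplicity four. -/
lemma FanoFreeInd.mem_tightMult (hh : FanoFreeInd h) (hk : IsK4 h k) {x y u v : V}
    (hxy : linkMult h k x y = 4) (hs : slack h k x y u v = 0) :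
    (linkMult h k x u, linkMult h k x v, linkMult h k y u, linkMult h k y v, linkMult h k u v) ∈
      tightMult := by
  refine _root_.mem_tightMult (a := fun i => h (k i) x y) (b := fun i => h (k i) x u)
    (c := fun i => h (k i) x v) (d := fun i => h (k i) y u) (e := fun i => h (k i) y v)
    (f := fun i => h (k i) u v) (hh.noTransversal hk x y u v) ?_
    (p := h x y u) (q := h x y v) (r := h x u v) (s := h y u v) ?_
  · simp only [linkMult, Fin.sum_univ_four] at hxy
    have h0 := toInt_le_one (h (k 0) x y)
    have h1 := toInt_le_one (h (k 1) x y)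
    have h2 := toInt_le_one (h (k 2) x y)
    have h3 := toInt_le_one (h (k 3) x y)
    have : ∀ b : Bool, b.toInt = 1 → b = true := by decide
    intro i
    fin_cases i <;> apply this <;> simp <;> linarith
  · unfold slack at hs
    split_ifs at hs with h1
    · exact h1
    · simp at hs

variable [Fintype V]

lemma FanoFreeInd.sum_atypical_le (hh : FanoFreeInd h) (hk : IsK4 h k) :
    Fintype.card V * ∑ x, ∑ y, ∑ z, atypical h k x y z ≤ ∑ x, ∑ y, ∑ u, ∑ v, slack h k x y u v := by
  have : ∑ x, ∑ y, ∑ z, ∑ _u : V, atypical h k x y z ≤ ∑ x, ∑ y, ∑ u, ∑ v, slack h k x y u v :=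
    Finset.sum_le_sum fun x _ => Finset.sum_le_sum fun y _ => Finset.sum_le_sum fun u _ =>
      Finset.sum_le_sum fun v _ => hh.atypical_le_slack hk x y u v
  simpa only [Finset.sum_const, nsmul_eq_mul, Finset.card_univ, ← Finset.mul_sum] using this

/-- Many pairs have multiplicity four. -/
lemma FanoFreeInd.card_four_le
    (hn : (10 : ℤ) ^ 18 ≤ Fintype.card V)
    (hA : 10 ^ 13 * ∑ x, ∑ y, ∑ z, atypical h k x y z ≤ (Fintype.card V : ℤ) ^ 3)
    (hW : (3 * 10 ^ 13 - 1) * (Fintype.card V : ℤ) ^ 2 ≤ 10 ^ 13 * ∑ x, ∑ y, linkMult h k x y)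
    (hS : 4 * 10 ^ 13 * ∑ x, ∑ y, ∑ z, (h x y z).toInt ≤
      (3 * 10 ^ 13 + 1) * (Fintype.card V : ℤ) ^ 3) :
    (Fintype.card V : ℤ) ^ 2 ≤ 13 * ∑ x, ∑ y, if linkMult h k x y = 4 then 1 else 0 := by
  set low : V → V → ℤ := fun x y => if linkMult h k x y ≤ 2 then 1 else 0 with hlow
  have h1 : ∑ x, ∑ y, low x y ≤
      ∑ x, ∑ y, (3 - linkMult h k x y + if linkMult h k x y = 4 then 1 else 0) := by
    refine Finset.sum_le_sum fun x _ => Finset.sum_le_sum fun y _ => ?_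
    have := linkMult_le_four (h := h) k x y
    simp only [hlow]
    split_ifs <;> omega
  have h2 : ∑ x, ∑ y, ∑ z, (1 - (h x y z).toInt) ≤
      ∑ x, ∑ y, ∑ z, (low x y + low x z + low y z + atypical h k x y z) := by
    refine Finset.sum_le_sum fun x _ => Finset.sum_le_sum fun y _ => Finset.sum_le_sum fun z _ => ?_
    simp only [hlow, atypical, triMult]
    cases h x y z <;> simp <;> split_ifs <;> omega
  simp only [Finset.sum_add_distrib, Finset.sum_sub_distrib, Finset.sum_const, nsmul_eq_mul,
    Finset.card_univ, ← Finset.mul_sum] at h1 h2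
  generalize ∑ x, ∑ y, ∑ z, atypical h k x y z = A at *
  generalize ∑ x, ∑ y, linkMult h k x y = W at *
  generalize ∑ x, ∑ y, ∑ z, (h x y z).toInt = S at *
  generalize ∑ x, ∑ y, low x y = L at *
  generalize (∑ x, ∑ y, if linkMult h k x y = 4 then (1 : ℤ) else 0) = F at *
  generalize (Fintype.card V : ℤ) = n at *
  have hn0 : 0 < n := by linarith
  refine le_of_mul_le_mul_left ?_ hn0
  have : n * L ≤ n * (n * (n * 3) - W + F) := mul_le_mul_of_nonneg_left h1 hn0.le
  have : n * ((3 * 10 ^ 13 - 1) * n ^ 2) ≤ n * (10 ^ 13 * W) := mul_le_mul_of_nonneg_left hW hn0.le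
  have : 0 < n ^ 3 := by positivity
  nlinarith

/-- Some pair of multiplicity four lies in few 4-tuples that are not tight. -/
lemma exists_mult_four
    (hn : (10 : ℤ) ^ 18 ≤ Fintype.card V)
    (hZ : 10 ^ 13 * ∑ x, ∑ y, ∑ u, ∑ v, slack h k x y u v ≤ (Fintype.card V : ℤ) ^ 4)
    (hF : (Fintype.card V : ℤ) ^ 2 ≤ 13 * ∑ x, ∑ y, if linkMult h k x y = 4 then 1 else 0) :
    ∃ x y, linkMult h k x y = 4 ∧
      10 ^ 13 * ∑ u, ∑ v, slack h k x y u v ≤ 13 * (Fintype.card V : ℤ) ^ 2 := by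
  by_contra! hcon
  have h1 : ∑ x, ∑ y, (if linkMult h k x y = 4 then 1 else 0) *
      (13 * (Fintype.card V : ℤ) ^ 2 + 1) ≤ ∑ x, ∑ y, 10 ^ 13 * ∑ u, ∑ v, slack h k x y u v := by
    refine Finset.sum_le_sum fun x _ => Finset.sum_le_sum fun y _ => ?_
    split_ifs with hw
    · have := hcon x y hw
      linarith
    · have : 0 ≤ ∑ u, ∑ v, slack h k x y u v :=
        Finset.sum_nonneg fun _ _ => Finset.sum_nonneg fun _ _ => slack_nonneg _ _ _ _
      linarith
  simp only [← Finset.sum_mul, ← Finset.mul_sum] at h1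
  generalize (∑ x, ∑ y, if linkMult h k x y = 4 then (1 : ℤ) else 0) = F at *
  generalize (Fintype.card V : ℤ) = n at *
  have : 0 < n ^ 2 := by positivity
  nlinarith

end Structure

section Profiles

/-- Balanced profiles: these vertices form the two classes of the bipartition. -/
def profC (X Y : ℤ) : ℤ := if (X = 2 ∧ Y = 4) ∨ (X = 4 ∧ Y = 2) then 1 else 0

/-- Profiles with multiplicities three and four. -/
def profG (X Y : ℤ) : ℤ := if (X = 3 ∧ Y = 4) ∨ (X = 4 ∧ Y = 3) then 1 else 0

/-- Profiles with multiplicities one and four. -/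
def profE (X Y : ℤ) : ℤ := if (X = 1 ∧ Y = 4) ∨ (X = 4 ∧ Y = 1) then 1 else 0

/-- The profile with both multiplicities four. -/
def profZ (X Y : ℤ) : ℤ := if X = 4 ∧ Y = 4 then 1 else 0

/-- Profiles with multiplicities zero and four. -/
def profT (X Y : ℤ) : ℤ := if (X = 0 ∧ Y = 4) ∨ (X = 4 ∧ Y = 0) then 1 else 0

lemma prof_nonneg (X Y : ℤ) :
    0 ≤ profC X Y ∧ 0 ≤ profG X Y ∧ 0 ≤ profE X Y ∧ 0 ≤ profZ X Y ∧ 0 ≤ profT X Y := by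
  unfold profC profG profE profZ profT
  refine ⟨?_, ?_, ?_, ?_, ?_⟩ <;> split_ifs <;> simp

lemma prof_sum_le (X Y : ℤ) : profC X Y + profG X Y + profE X Y + profZ X Y + profT X Y ≤ 1 := by
  unfold profC profG profE profZ profT
  split_ifs <;> omega

lemma one_le_of_mem_tightMult {X X' Y Y' W : ℤ} (hm : (X, X', Y, Y', W) ∈ tightMult) :
    1 ≤ profC X Y * profC X' Y' + profG X Y * profE X' Y' + profE X Y * profG X' Y' +
      (profZ X Y + profT X Y) * (profZ X' Y' + profT X' Y') ∧
    1 ≤ profC X Y * profC X' Y' + profG X Y * profE X' Y' + profE X Y * profG X' Y' +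
      (if W = 0 then 1 else 0) + profZ X Y * profT X' Y' + profT X Y * profZ X' Y' ∧
    (profC X Y = 1 → profC X' Y' = 1 → W = if X = X' then 2 else 4) := by
  simp only [tightMult, List.mem_cons, Prod.mk.injEq, List.not_mem_nil, or_false] at hm
  rcases hm with hm | hm | hm | hm | hm | hm | hm | hm | hm | hm | hm | hm | hm <;>
    obtain ⟨rfl, rfl, rfl, rfl, rfl⟩ := hm <;> decide

/-- The optimisation behind the dominance of balanced profiles. -/
lemma profile_dominance {n C G E Z T N : ℤ} (hn : 0 < n) (hC : 0 ≤ C) (hG : 0 ≤ G) (hE : 0 ≤ E)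
    (hZ : 0 ≤ Z) (hT : 0 ≤ T) (hsum : C + G + E + Z + T ≤ n)
    (h1 : (10 ^ 13 - 13) * n ^ 2 ≤ 10 ^ 13 * (C * C + G * E + E * G + (Z + T) * (Z + T)))
    (h2 : (10 ^ 13 - 13) * n ^ 2 ≤ 10 ^ 13 * (C * C + G * E + E * G + N + Z * T + T * Z))
    (hN : 4 * 10 ^ 13 * N ≤ (10 ^ 13 + 1) * n ^ 2) :
    (10 ^ 13 - 20) * n ≤ 10 ^ 13 * C := by
  by_contra! hc
  have hge : 2 * (G * E + E * G) ≤ (G + E) * (G + E) := by nlinarith [sq_nonneg (G - E)]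
  have hzt : 2 * (Z * T + T * Z) ≤ (Z + T) * (Z + T) := by nlinarith [sq_nonneg (Z - T)]
  by_cases hz : 10 ^ 13 * (Z + T) ≤ (10 ^ 13 - 20) * n
  · have i1 : 10 ^ 13 * (C * C) ≤ (10 ^ 13 - 20) * n * C := by nlinarith
    have i2 : 10 ^ 13 * ((Z + T) * (Z + T)) ≤ (10 ^ 13 - 20) * n * (Z + T) := by nlinarith
    have i3 : (G + E) * (G + E) ≤ n * (G + E) := by nlinarith
    have i4 : n * (C + G + E + Z + T) ≤ n * n := by nlinarith
    have i5 : 0 ≤ n * (G + E) := by positivity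
    have i6 : 0 < n * n := by positivity
    nlinarith
  · have i1 : 10 ^ 13 * (C + G + E) ≤ 20 * n := by linarith
    have i2 : 10 ^ 13 * ((C + G + E) * (C + G + E)) ≤ 20 * n * (C + G + E) := by nlinarith
    have i3 : 20 * n * (C + G + E) ≤ 20 * n * n := by nlinarith
    have i4 : (Z + T) * (Z + T) ≤ n * n := by nlinarith
    have i5 : C * C + G * E + E * G ≤ (C + G + E) * (C + G + E) := by nlinarith [mul_nonneg hC hG, mul_nonneg hC hE, mul_nonneg hG hE, mul_nonneg hG hG, mul_nonneg hE hE]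
    have i6 : 0 < n * n := by positivity
    nlinarith

variable {V : Type*} {h : V → V → V → Bool} {k : Fin 4 → V}

lemma FanoFreeInd.mismatch_le (hh : FanoFreeInd h) (hk : IsK4 h k) {x y : V}
    (hxy : linkMult h k x y = 4) (u v t : V) :
    mismatch h (fun u => decide (linkMult h k x u = 2)) u v t ≤
      atypical h k u v t +
      ((1 - profC (linkMult h k x u) (linkMult h k y u)) +
       (1 - profC (linkMult h k x v) (linkMult h k y v)) +
       (1 - profC (linkMult h k x t) (linkMult h k y t))) +
      (slack h k x y u v + slack h k x y u t + slack h k x y v t) := by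
  have c01 : ∀ X Y, profC X Y = 0 ∨ profC X Y = 1 := by
    intro X Y
    unfold profC
    split_ifs <;> simp
  have s01 : ∀ u v, slack h k x y u v = 0 ∨ slack h k x y u v = 1 := by
    intro u v
    unfold slack
    split_ifs <;> simp
  have a0 : 0 ≤ atypical h k u v t := by unfold atypical; split_ifs <;> simp
  have m1 : mismatch h (fun u => decide (linkMult h k x u = 2)) u v t ≤ 1 := by
    unfold mismatch; split_ifs <;> simp
  rcases c01 (linkMult h k x u) (linkMult h k y u) with cu | cu
  · have := s01 u v; have := s01 u t; have := s01 v t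
    have := c01 (linkMult h k x v) (linkMult h k y v)
    have := c01 (linkMult h k x t) (linkMult h k y t)
    omega
  rcases c01 (linkMult h k x v) (linkMult h k y v) with cv | cv
  · have := s01 u v; have := s01 u t; have := s01 v t
    have := c01 (linkMult h k x t) (linkMult h k y t)
    omega
  rcases c01 (linkMult h k x t) (linkMult h k y t) with ct | ct
  · have := s01 u v; have := s01 u t; have := s01 v t
    omega
  rcases s01 u v with suv | suv
  swap
  · have := s01 u t; have := s01 v t
    omega
  rcases s01 u t with sut | sut
  swap
  · have := s01 v t
    omega
  rcases s01 v t with svt | svt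
  swap
  · omega
  have w1 := (one_le_of_mem_tightMult (hh.mem_tightMult hk hxy suv)).2.2 cu cv
  have w2 := (one_le_of_mem_tightMult (hh.mem_tightMult hk hxy sut)).2.2 cu ct
  have w3 := (one_le_of_mem_tightMult (hh.mem_tightMult hk hxy svt)).2.2 cv ct
  have pr : ∀ X Y, profC X Y = 1 → X = 2 ∨ X = 4 := by
    intro X Y hX
    unfold profC at hX
    split_ifs at hX with hX'
    · omega
    · simp at hX
  have pu := pr _ _ cu
  have pv := pr _ _ cv
  have pt := pr _ _ ct
  rw [cu, cv, ct, suv, sut, svt]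
  simp only [mismatch, atypical, triMult, crossing, w1, w2, w3]
  rcases pu with pu | pu <;> rcases pv with pv | pv <;> rcases pt with pt | pt <;>
    simp only [pu, pv, pt] <;> cases h u v t <;> simp

variable [Fintype V]

/-- The 3-graph is close to a complete bipartite one. -/
lemma FanoFreeInd.exists_bipartition (hh : FanoFreeInd h) (hk : IsK4 h k)
    (hn : (10 : ℤ) ^ 18 ≤ Fintype.card V)
    (hZ : 10 ^ 13 * ∑ x, ∑ y, ∑ u, ∑ v, slack h k x y u v ≤ (Fintype.card V : ℤ) ^ 4)
    (hW : (3 * 10 ^ 13 - 1) * (Fintype.card V : ℤ) ^ 2 ≤ 10 ^ 13 * ∑ x, ∑ y, linkMult h k x y)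
    (hS : 4 * 10 ^ 13 * ∑ x, ∑ y, ∑ z, (h x y z).toInt ≤
      (3 * 10 ^ 13 + 1) * (Fintype.card V : ℤ) ^ 3) :
    ∃ a : V → Bool, 10 ^ 10 * ∑ x, ∑ y, ∑ z, mismatch h a x y z ≤ (Fintype.card V : ℤ) ^ 3 := by
  have hn0 : (0 : ℤ) < Fintype.card V := by linarith
  have hA : 10 ^ 13 * ∑ x, ∑ y, ∑ z, atypical h k x y z ≤ (Fintype.card V : ℤ) ^ 3 := by
    have := hh.sum_atypical_le hk
    refine le_of_mul_le_mul_left ?_ hn0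
    linarith
  obtain ⟨x, y, hxy, hs⟩ := exists_mult_four hn hZ (FanoFreeInd.card_four_le hn hA hW hS)
  set X := linkMult h k x with hX
  set Y := linkMult h k y with hY
  have p1 : ∀ u v, 1 - slack h k x y u v ≤
      profC (X u) (Y u) * profC (X v) (Y v) + profG (X u) (Y u) * profE (X v) (Y v) +
      profE (X u) (Y u) * profG (X v) (Y v) +
      (profZ (X u) (Y u) + profT (X u) (Y u)) * (profZ (X v) (Y v) + profT (X v) (Y v)) ∧
      1 - slack h k x y u v ≤
      profC (X u) (Y u) * profC (X v) (Y v) + profG (X u) (Y u) * profE (X v) (Y v) +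
      profE (X u) (Y u) * profG (X v) (Y v) + (if linkMult h k u v = 0 then 1 else 0) +
      profZ (X u) (Y u) * profT (X v) (Y v) + profT (X u) (Y u) * profZ (X v) (Y v) := by
    intro u v
    by_cases h0 : slack h k x y u v = 0
    · have := one_le_of_mem_tightMult (hh.mem_tightMult hk hxy h0)
      rw [h0]
      exact ⟨by linarith [this.1], by linarith [this.2.1]⟩
    · have h1 : slack h k x y u v = 1 := by
        unfold slack at h0 ⊢
        split_ifs at h0 ⊢ <;> simp_all
      obtain ⟨c0, g0, e0, z0, t0⟩ := prof_nonneg (X u) (Y u)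
      obtain ⟨c1, g1, e1, z1, t1⟩ := prof_nonneg (X v) (Y v)
      have : (0 : ℤ) ≤ if linkMult h k u v = 0 then 1 else 0 := by split_ifs <;> simp
      rw [h1]
      constructor <;> positivity
  have q1 := Finset.sum_le_sum fun u (_ : u ∈ univ) => Finset.sum_le_sum fun v (_ : v ∈ univ) =>
    (p1 u v).1
  have q2 := Finset.sum_le_sum fun u (_ : u ∈ univ) => Finset.sum_le_sum fun v (_ : v ∈ univ) =>
    (p1 u v).2
  have q3 : ∑ u, ∑ v, linkMult h k u v ≤
      ∑ u, ∑ v, (4 - 4 * if linkMult h k u v = 0 then 1 else 0) := by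
    refine Finset.sum_le_sum fun u _ => Finset.sum_le_sum fun v _ => ?_
    have := linkMult_le_four (h := h) k u v
    split_ifs <;> omega
  have q4 := Finset.sum_le_sum fun u (_ : u ∈ univ) => prof_sum_le (X u) (Y u)
  have q5 := Finset.sum_le_sum fun u (_ : u ∈ univ) => Finset.sum_le_sum fun v (_ : v ∈ univ) =>
    Finset.sum_le_sum fun t (_ : t ∈ univ) => hh.mismatch_le hk hxy u v t
  refine ⟨fun u => decide (linkMult h k x u = 2), ?_⟩
  simp only [Finset.sum_add_distrib, Finset.sum_sub_distrib, Finset.sum_const, nsmul_eq_mul,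
    Finset.card_univ, ← Finset.mul_sum, ← Finset.sum_mul] at q1 q2 q3 q4 q5
  have nC : 0 ≤ ∑ u, profC (X u) (Y u) := Finset.sum_nonneg fun u _ => (prof_nonneg _ _).1
  have nG : 0 ≤ ∑ u, profG (X u) (Y u) := Finset.sum_nonneg fun u _ => (prof_nonneg _ _).2.1
  have nE : 0 ≤ ∑ u, profE (X u) (Y u) := Finset.sum_nonneg fun u _ => (prof_nonneg _ _).2.2.1
  have nZ : 0 ≤ ∑ u, profZ (X u) (Y u) := Finset.sum_nonneg fun u _ => (prof_nonneg _ _).2.2.2.1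
  have nT : 0 ≤ ∑ u, profT (X u) (Y u) := Finset.sum_nonneg fun u _ => (prof_nonneg _ _).2.2.2.2
  simp only [← hX, ← hY] at q5 ⊢
  generalize ∑ u, profC (X u) (Y u) = C at *
  generalize ∑ u, profG (X u) (Y u) = G at *
  generalize ∑ u, profE (X u) (Y u) = E at *
  generalize ∑ u, profZ (X u) (Y u) = Z at *
  generalize ∑ u, profT (X u) (Y u) = T at *
  generalize (∑ u, ∑ v, if linkMult h k u v = 0 then (1 : ℤ) else 0) = N at *
  generalize ∑ u, ∑ v, slack h k x y u v = s at *
  generalize ∑ x, ∑ y, ∑ z, atypical h k x y z = A at *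
  generalize (Fintype.card V : ℤ) = n at *
  have hCn := profile_dominance hn0 nC nG nE nZ nT (N := N) (by linarith) (by linarith)
    (by linarith) (by linarith)
  have j1 : n * n * (10 ^ 13 * (n - C)) ≤ n * n * (20 * n) := by
    apply mul_le_mul_of_nonneg_left <;> nlinarith
  have j2 : n * (10 ^ 13 * s) ≤ n * (13 * n ^ 2) := mul_le_mul_of_nonneg_left hs hn0.le
  nlinarith [pow_pos hn0 3]

end Profiles

section Cleaning

variable {V : Type*} {h : V → V → V → Bool} {a : V → Bool}

lemma mismatch_not (x y z : V) : mismatch h (fun x => !a x) x y z = mismatch h a x y z := by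
  have : crossing (fun x => !a x) x y z = crossing a x y z := by
    simp only [crossing]
    generalize a x = p
    generalize a y = q
    generalize a z = r
    revert p q r
    decide
  rw [mismatch, mismatch, this]

lemma mismatch_nonneg (x y z : V) : 0 ≤ mismatch h a x y z := by
  unfold mismatch; split_ifs <;> simp

lemma eq_crossing_of_mismatch {x y z : V} (hm : mismatch h a x y z = 0) :
    h x y z = crossing a x y z := by
  unfold mismatch at hm
  split_ifs at hm with hc
  · exact hc
  · simp at hm

/-- The indicator of link pairs of `v` inside the class `a`. -/
def innerInd (h : V → V → V → Bool) (a : V → Bool) (v x y : V) : ℤ :=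
  (a x && a y && h v x y).toInt

/-- The indicator of pairs not inside the class `a` that are missing from the link of `v`. -/
def missingInd (h : V → V → V → Bool) (a : V → Bool) (v x y : V) : ℤ :=
  (!(a x && a y) && !h v x y).toInt

lemma FanoFreeInd.inner_mul_le (hh : FanoFreeInd h) (v x x' z z' y y' : V) :
    innerInd h a v x x' * innerInd h a v z z' * innerInd h (fun u => !a u) v y y' ≤
      mismatch h a x' z y + mismatch h a x z' y + mismatch h a x' z' y' + mismatch h a x z y' := by
  have m1 := mismatch_nonneg (h := h) (a := a) x' z y
  have m2 := mismatch_nonneg (h := h) (a := a) x z' y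
  have m3 := mismatch_nonneg (h := h) (a := a) x' z' y'
  have m4 := mismatch_nonneg (h := h) (a := a) x z y'
  by_contra! hc
  have b1 := toInt_le_one (a x && a x' && h v x x')
  have b2 := toInt_le_one (a z && a z' && h v z z')
  have b3 := toInt_le_one (!a y && !a y' && h v y y')
  have c1 := toInt_nonneg (a x && a x' && h v x x')
  have c2 := toInt_nonneg (a z && a z' && h v z z')
  have c3 := toInt_nonneg (!a y && !a y' && h v y y')
  have hle : (a x && a x' && h v x x').toInt * (a z && a z' && h v z z').toInt *
      (!a y && !a y' && h v y y').toInt ≤ 1 :=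
    mul_le_one₀ (mul_le_one₀ b1 c2 b2) c3 b3
  simp only [innerInd] at hc
  have n1 := eq_crossing_of_mismatch (x := x') (y := z) (z := y) (h := h) (a := a) (by linarith)
  have n2 := eq_crossing_of_mismatch (x := x) (y := z') (z := y) (h := h) (a := a) (by linarith)
  have n3 := eq_crossing_of_mismatch (x := x') (y := z') (z := y') (h := h) (a := a) (by linarith)
  have n4 := eq_crossing_of_mismatch (x := x) (y := z) (z := y') (h := h) (a := a) (by linarith)
  have hpos : 0 < (a x && a x' && h v x x').toInt * (a z && a z' && h v z z').toInt *
      (!a y && !a y' && h v y y').toInt := by linarith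
  have t : ∀ b : Bool, b.toInt ≠ 0 → b = true := by decide
  have t1 := t _ (left_ne_zero_of_mul (left_ne_zero_of_mul hpos.ne'))
  have t2 := t _ (right_ne_zero_of_mul (left_ne_zero_of_mul hpos.ne'))
  have t3 := t _ (right_ne_zero_of_mul hpos.ne')
  simp only [Bool.and_eq_true, Bool.not_eq_true'] at t1 t2 t3
  obtain ⟨⟨ax, ax'⟩, hx⟩ := t1
  obtain ⟨⟨az, az'⟩, hz⟩ := t2
  obtain ⟨⟨ay, ay'⟩, hy⟩ := t3
  simp only [crossing, ax, ax', az, az', ay, ay'] at n1 n2 n3 n4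
  refine hh.no_fano v x x' z y y' z' hx (by simpa using n1) ?_ ?_ (by simpa using n2)
    (by simpa using n3) (by simpa using n4)
  · rw [hh.rotate]; exact hy
  · rw [hh.swap_right]; exact hz

lemma FanoFreeInd.prod_le_missing (hh : FanoFreeInd h) {x y z : V} (hxyz : h x y z = true)
    (d e f g : V) :
    (!a d).toInt * (!a e).toInt * (!a f).toInt * (!a g).toInt ≤
      missingInd h a z d e + missingInd h a x e f + missingInd h a x d g + missingInd h a y e g +
        missingInd h a z f g + missingInd h a y d f := by
  have n1 := toInt_nonneg (!(a d && a e) && !h z d e)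
  have n2 := toInt_nonneg (!(a e && a f) && !h x e f)
  have n3 := toInt_nonneg (!(a d && a g) && !h x d g)
  have n4 := toInt_nonneg (!(a e && a g) && !h y e g)
  have n5 := toInt_nonneg (!(a f && a g) && !h z f g)
  have n6 := toInt_nonneg (!(a d && a f) && !h y d f)
  unfold missingInd
  have ff : ¬ (h z d e ∧ h x e f ∧ h x d g ∧ h y e g ∧ h z f g ∧ h y d f) := by
    rintro ⟨h1, h2, h3, h4, h5, h6⟩
    refine hh.no_fano x y z d e f g hxyz h1 ?_ ?_ ?_ ?_ h6
    · rw [hh.rotate]; exact h2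
    · rw [hh.swap_right]; exact h3
    · rw [hh.swap_right]; exact h4
    · rw [hh.swap_right]; exact h5
  revert ff
  clear n1 n2 n3 n4 n5 n6
  generalize h z d e = h1
  generalize h x e f = h2
  generalize h x d g = h3
  generalize h y e g = h4
  generalize h z f g = h5
  generalize h y d f = h6
  generalize a d = p
  generalize a e = q
  generalize a f = r
  generalize a g = s
  revert h1 h2 h3 h4 h5 h6 p q r s
  decide +kernel

lemma link_mul_le (v u x y : V) : (h v u x).toInt * (h v u y).toInt ≤
    (1 - (a u).toInt * (a x).toInt) * (1 - (a u).toInt * (a y).toInt) +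
      innerInd h a v u x + innerInd h a v u y := by
  unfold innerInd
  generalize h v u x = h1
  generalize h v u y = h2
  generalize a u = p
  generalize a x = q
  generalize a y = r
  revert h1 h2 p q r
  decide +kernel

lemma link_mul_edge_le (v x y z : V) : (h v x y).toInt * (h x y z).toInt ≤
    1 - (a x).toInt * (a y).toInt -
      (1 - (a x).toInt) * (1 - (a y).toInt) * (1 - (a z).toInt) -
      missingInd h a v x y * (a z).toInt + innerInd h a v x y + mismatch h a x y z := by
  unfold innerInd missingInd mismatch crossing
  generalize h v x y = h1
  generalize h x y z = h2
  generalize a x = p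
  generalize a y = q
  generalize a z = r
  revert h1 h2 p q r
  decide +kernel

lemma edge_le (x y z : V) : (h x y z).toInt ≤
    1 - (a x).toInt * (a y).toInt * (a z).toInt -
      (1 - (a x).toInt) * (1 - (a y).toInt) * (1 - (a z).toInt) + mismatch h a x y z := by
  unfold mismatch crossing
  generalize h x y z = h2
  generalize a x = p
  generalize a y = q
  generalize a z = r
  revert h2 p q r
  decide +kernel

variable [Fintype V]

lemma FanoFreeInd.not_both_inner (hh : FanoFreeInd h) (hn : (0 : ℤ) < Fintype.card V)
    (hm : 10 ^ 10 * ∑ x, ∑ y, ∑ z, mismatch h a x y z ≤ (Fintype.card V : ℤ) ^ 3) (v : V)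
    (h1 : (Fintype.card V : ℤ) ^ 2 ≤ 1000 * ∑ x, ∑ y, innerInd h a v x y) :
    1000 * ∑ x, ∑ y, innerInd h (fun u => !a u) v x y ≤ (Fintype.card V : ℤ) ^ 2 := by
  by_contra! h2
  have key : ∑ x, ∑ x', ∑ z, ∑ z', ∑ y, ∑ y',
      innerInd h a v x x' * innerInd h a v z z' * innerInd h (fun u => !a u) v y y' ≤
      ∑ x, ∑ x', ∑ z, ∑ z', ∑ y, ∑ y',
      (mismatch h a x' z y + mismatch h a x z' y + mismatch h a x' z' y' + mismatch h a x z y') :=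
    Finset.sum_le_sum fun x _ => Finset.sum_le_sum fun x' _ => Finset.sum_le_sum fun z _ =>
      Finset.sum_le_sum fun z' _ => Finset.sum_le_sum fun y _ => Finset.sum_le_sum fun y' _ =>
        hh.inner_mul_le v x x' z z' y y'
  simp only [Finset.sum_add_distrib, Finset.sum_const, nsmul_eq_mul,
    Finset.card_univ, ← Finset.mul_sum, ← Finset.sum_mul] at key
  generalize ∑ x, ∑ y, innerInd h a v x y = P at *
  generalize ∑ x, ∑ y, innerInd h (fun u => !a u) v x y = Q at *
  generalize ∑ x, ∑ y, ∑ z, mismatch h a x y z = M at *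
  generalize (Fintype.card V : ℤ) = n at *
  have hn2 : 0 < n ^ 2 := by positivity
  have hP : 0 < P := by linarith
  have i1 : n ^ 2 * n ^ 2 ≤ 1000 * P * (1000 * P) := by nlinarith
  have i2 : n ^ 2 * n ^ 2 * n ^ 2 ≤ 1000 * P * (1000 * P) * (1000 * Q) := by
    apply mul_le_mul i1 h2.le hn2.le
    positivity
  have i3 : n ^ 3 * (10 ^ 10 * M) ≤ n ^ 3 * n ^ 3 := mul_le_mul_of_nonneg_left hm (by positivity)
  have i4 : 0 < n ^ 6 := by positivity
  nlinarith

/-- The two classes have almost the same size. -/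
lemma class_balance (hn : (0 : ℤ) < Fintype.card V)
    (hm : 10 ^ 10 * ∑ x, ∑ y, ∑ z, mismatch h a x y z ≤ (Fintype.card V : ℤ) ^ 3)
    (hS : (3 * 10 ^ 13 - 4) * (Fintype.card V : ℤ) ^ 3 ≤
      4 * 10 ^ 13 * ∑ x, ∑ y, ∑ z, (h x y z).toInt) :
    1000 * |2 * ∑ x, (a x).toInt - Fintype.card V| ≤ (Fintype.card V : ℤ) := by
  have key := Finset.sum_le_sum fun x (_ : x ∈ univ) => Finset.sum_le_sum fun y (_ : y ∈ univ) =>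
    Finset.sum_le_sum fun z (_ : z ∈ univ) => edge_le (h := h) (a := a) x y z
  simp only [Finset.sum_add_distrib, Finset.sum_sub_distrib, Finset.sum_const, nsmul_eq_mul,
    Finset.card_univ, ← Finset.mul_sum, ← Finset.sum_mul] at key
  generalize ∑ x, ∑ y, ∑ z, mismatch h a x y z = M at *
  generalize ∑ x, ∑ y, ∑ z, (h x y z).toInt = S at *
  generalize ∑ x, (a x).toInt = A at *
  generalize (Fintype.card V : ℤ) = n at *
  have hd : 10 ^ 6 * (2 * A - n) ^ 2 ≤ n ^ 2 := by
    refine le_of_mul_le_mul_left ?_ hn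
    have h1 : 4 * S ≤ 3 * n ^ 3 - 3 * (n * (2 * A - n) ^ 2) + 4 * M := by linarith
    have h2 : 0 ≤ n * (2 * A - n) ^ 2 := by positivity
    have h3 : 0 < n ^ 3 := by positivity
    linarith
  rw [← abs_of_pos (show (0 : ℤ) < 1000 by norm_num), ← abs_mul]
  refine abs_le_of_sq_le_sq ?_ hn.le
  linarith

/-- If the link of `v` has few pairs inside one class, then it contains almost all pairs that are
not inside that class. -/
lemma missing_le (hn : (0 : ℤ) < Fintype.card V)
    (hm : 10 ^ 10 * ∑ x, ∑ y, ∑ z, mismatch h a x y z ≤ (Fintype.card V : ℤ) ^ 3)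
    (hb : 1000 * |2 * ∑ x, (a x).toInt - Fintype.card V| ≤ (Fintype.card V : ℤ)) {v : V}
    (hQ : (5 * 10 ^ 15 - 4) * (Fintype.card V : ℤ) ^ 3 ≤ 4 * 10 ^ 15 * l2Ind h v)
    (hP : 1000 * ∑ x, ∑ y, innerInd h a v x y ≤ (Fintype.card V : ℤ) ^ 2) :
    1000 * ∑ x, ∑ y, missingInd h a v x y ≤ 8 * (Fintype.card V : ℤ) ^ 2 := by
  have k1 := Finset.sum_le_sum fun u (_ : u ∈ univ) => Finset.sum_le_sum fun x (_ : x ∈ univ) =>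
    Finset.sum_le_sum fun y (_ : y ∈ univ) => link_mul_le (h := h) (a := a) v u x y
  have k2 := Finset.sum_le_sum fun x (_ : x ∈ univ) => Finset.sum_le_sum fun y (_ : y ∈ univ) =>
    Finset.sum_le_sum fun z (_ : z ∈ univ) => link_mul_edge_le (h := h) (a := a) v x y z
  have e1 : ∑ u, codInd h v u ^ 2 = ∑ u, ∑ x, ∑ y, (h v u x).toInt * (h v u y).toInt :=
    Finset.sum_congr rfl fun u _ => FanoFreeInd.codInd_sq v u
  have e2 : ∑ x, ∑ y, (h v x y).toInt * codInd h x y =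
      ∑ x, ∑ y, ∑ z, (h v x y).toInt * (h x y z).toInt := by
    simp only [codInd, Finset.mul_sum]
  have e3 : ∑ u, ∑ x, ∑ y, (1 - (a u).toInt * (a x).toInt) * (1 - (a u).toInt * (a y).toInt) =
      (Fintype.card V : ℤ) ^ 3 - 2 * Fintype.card V * (∑ x, (a x).toInt) ^ 2 +
        (∑ x, (a x).toInt) ^ 3 := by
    have : ∀ u x y, (1 - (a u).toInt * (a x).toInt) * (1 - (a u).toInt * (a y).toInt) =
        1 - (a u).toInt * (a x).toInt - (a u).toInt * (a y).toInt +
          (a u).toInt * (a x).toInt * (a y).toInt := by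
      intro u x y
      cases a u
      · simp
      · simp
        ring
    simp only [this, Finset.sum_add_distrib, Finset.sum_sub_distrib, Finset.sum_const,
      nsmul_eq_mul, Finset.card_univ, ← Finset.mul_sum, ← Finset.sum_mul]
    ring
  unfold l2Ind at hQ
  rw [e1, e2] at hQ
  simp only [Finset.sum_add_distrib, e3] at k1
  simp only [Finset.sum_add_distrib, Finset.sum_sub_distrib, Finset.sum_const, nsmul_eq_mul,
    Finset.card_univ, ← Finset.mul_sum, ← Finset.sum_mul] at k1 k2 hQ
  generalize ∑ x, ∑ y, ∑ z, mismatch h a x y z = M at *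
  generalize ∑ x, ∑ y, missingInd h a v x y = D at *
  generalize ∑ x, ∑ y, innerInd h a v x y = P at *
  generalize ∑ x, (a x).toInt = A at *
  generalize (Fintype.card V : ℤ) = n at *
  obtain ⟨hd1, hd2⟩ := abs_le.1 (show |1000 * (2 * A - n)| ≤ n by
    rwa [abs_mul, abs_of_pos (show (0 : ℤ) < 1000 by norm_num)])
  have hn2 : 0 < n ^ 2 := by positivity
  have hn3 : 0 < n ^ 3 := by positivity
  have i1 : 0 ≤ (2 * A - n) ^ 2 * (3 * n - (2 * A - n)) :=
    mul_nonneg (sq_nonneg _) (by linarith)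
  have i2 : n ^ 2 * -n ≤ n ^ 2 * (1000 * (2 * A - n)) := mul_le_mul_of_nonneg_left hd1 hn2.le
  have i3 : n * (1000 * P) ≤ n * n ^ 2 := mul_le_mul_of_nonneg_left hP hn.le
  have i4 : 10 ^ 4 * (D * A) ≤ 38 * n ^ 3 := by linarith
  by_contra! hD
  have i5 : 999 * n * (8 * n ^ 2) ≤ 2000 * A * (1000 * D) :=
    mul_le_mul (by linarith) hD.le (by positivity) (by linarith)
  linarith

/-- Three vertices whose links miss few pairs do not form an edge. -/
lemma FanoFreeInd.not_edge (hh : FanoFreeInd h) (hn : (0 : ℤ) < Fintype.card V)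
    (hb : 1000 * |2 * ∑ x, (a x).toInt - Fintype.card V| ≤ (Fintype.card V : ℤ)) {x y z : V}
    (hx : 1000 * ∑ s, ∑ t, missingInd h a x s t ≤ 8 * (Fintype.card V : ℤ) ^ 2)
    (hy : 1000 * ∑ s, ∑ t, missingInd h a y s t ≤ 8 * (Fintype.card V : ℤ) ^ 2)
    (hz : 1000 * ∑ s, ∑ t, missingInd h a z s t ≤ 8 * (Fintype.card V : ℤ) ^ 2) :
    h x y z = false := by
  by_contra hc
  rw [Bool.not_eq_false] at hc
  have key : ∑ d, ∑ e, ∑ f, ∑ g, (!a d).toInt * (!a e).toInt * (!a f).toInt * (!a g).toInt ≤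
      ∑ d, ∑ e, ∑ f, ∑ g,
      (missingInd h a z d e + missingInd h a x e f + missingInd h a x d g + missingInd h a y e g +
        missingInd h a z f g + missingInd h a y d f) :=
    Finset.sum_le_sum fun d _ => Finset.sum_le_sum fun e _ => Finset.sum_le_sum fun f _ =>
      Finset.sum_le_sum fun g _ => hh.prod_le_missing hc d e f g
  have e : ∑ x, (!a x).toInt = Fintype.card V - ∑ x, (a x).toInt := by
    have : ∀ b : Bool, (!b).toInt = 1 - b.toInt := by decide
    simp [this]
  simp only [Finset.sum_add_distrib, Finset.sum_const, nsmul_eq_mul,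
    Finset.card_univ, ← Finset.mul_sum, ← Finset.sum_mul, e] at key
  generalize ∑ s, ∑ t, missingInd h a x s t = X at *
  generalize ∑ s, ∑ t, missingInd h a y s t = Y at *
  generalize ∑ s, ∑ t, missingInd h a z s t = Z at *
  generalize ∑ x, (a x).toInt = A at *
  generalize (Fintype.card V : ℤ) = n at *
  obtain ⟨hd1, hd2⟩ := abs_le.1 (show |1000 * (2 * A - n)| ≤ n by
    rwa [abs_mul, abs_of_pos (show (0 : ℤ) < 1000 by norm_num)])
  have hn2 : 0 < n ^ 2 := by positivity
  have hn4 : 0 < n ^ 4 := by positivity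
  have i1 : (999 * n) ^ 4 ≤ (2000 * (n - A)) ^ 4 :=
    pow_le_pow_left₀ (by positivity) (by linarith) 4
  have i2 := mul_le_mul_of_nonneg_left (add_le_add (add_le_add hx hy) hz) hn2.le
  linarith

end Cleaning

/-- An almost extremal Fano-free 3-graph with large minimum ℓ2-norm degree is bipartite. -/
lemma FanoFreeInd.exists_bipartite {V : Type*} [Fintype V] [DecidableEq V]
    {h : V → V → V → Bool} (hh : FanoFreeInd h) (hn : (10 : ℤ) ^ 18 ≤ Fintype.card V)
    (hQ : ∀ v, (5 * 10 ^ 15 - 4) * (Fintype.card V : ℤ) ^ 3 ≤ 4 * 10 ^ 15 * l2Ind h v) :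
    ∃ A : Finset V, ∀ x y z, h x y z →
      (x ∈ A ∨ y ∈ A ∨ z ∈ A) ∧ (x ∉ A ∨ y ∉ A ∨ z ∉ A) := by
  have hn0 : (0 : ℤ) < Fintype.card V := by linarith
  have hX : (Fintype.card V : ℤ) ^ 4 < ∑ v, l2Ind h v := by
    have hs := Finset.sum_le_sum fun v (_ : v ∈ univ) => hQ v
    simp only [Finset.sum_const, nsmul_eq_mul, Finset.card_univ, ← Finset.mul_sum] at hs
    have h4 : 0 < (Fintype.card V : ℤ) ^ 4 := by positivity
    linarith
  obtain ⟨k, hk⟩ := hh.exists_isK4 hX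
  obtain ⟨hZ, hS, hW, hS'⟩ := hh.numerics hk hn hQ
  obtain ⟨a, hm⟩ := hh.exists_bipartition hk hn hZ hW hS'
  have hm' : 10 ^ 10 * ∑ x, ∑ y, ∑ z, mismatch h (fun u => !a u) x y z ≤
      (Fintype.card V : ℤ) ^ 3 := by
    simpa only [mismatch_not] using hm
  have hb := class_balance hn0 hm hS
  have hb' := class_balance hn0 hm' hS
  refine ⟨univ.filter fun v =>
    1000 * ∑ x, ∑ y, innerInd h a v x y ≤ (Fintype.card V : ℤ) ^ 2, fun x y z hxyz => ?_⟩
  simp only [Finset.mem_filter, Finset.mem_univ, true_and]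
  constructor
  · by_contra! hc
    obtain ⟨hx, hy, hz⟩ := hc
    have key : ∀ v, (Fintype.card V : ℤ) ^ 2 < 1000 * ∑ x, ∑ y, innerInd h a v x y →
        1000 * ∑ x, ∑ y, missingInd h (fun u => !a u) v x y ≤ 8 * (Fintype.card V : ℤ) ^ 2 :=
      fun v hv => missing_le hn0 hm' hb' (hQ v) (hh.not_both_inner hn0 hm v hv.le)
    simp [hh.not_edge hn0 hb' (key x hx) (key y hy) (key z hz)] at hxyz
  · by_contra! hc
    obtain ⟨hx, hy, hz⟩ := hc
    simp [hh.not_edge hn0 hb (missing_le hn0 hm hb (hQ x) hx) (missing_le hn0 hm hb (hQ y) hy)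
      (missing_le hn0 hm hb (hQ z) hz)] at hxyz

end FanoStability

/-- There exist ε > 0 and N₀ such that for every n ≥ N₀, every 𝔽-free
3-graph on n vertices with minimum ℓ2-norm degree at least (5/4 − ε)·n³ is bipartite. -/
theorem fano_l2_AES :
    ∃ (ε : ℝ) (N₀ : ℕ), 0 < ε ∧
      ∀ n : ℕ, N₀ ≤ n → ∀ H : Finset (Finset (Fin n)),
        Is3Graph H → FanoFree H →
        (∀ v : Fin n, ((5 : ℝ) / 4 - ε) * (n : ℝ) ^ 3 ≤ d2deg H v) →
        Bipartite3 H := by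
  refine ⟨1 / 10 ^ 15, 10 ^ 18, by positivity, fun n hn H h3 hF hd => ?_⟩
  have hQ : ∀ v, (5 * 10 ^ 15 - 4) * (Fintype.card (Fin n) : ℤ) ^ 3 ≤
      4 * 10 ^ 15 * l2Ind (edgeInd H) v := by
    intro v
    have hv := (hd v).trans (d2deg_le_l2Ind h3 v)
    rw [Fintype.card_fin]
    have : (5 * 10 ^ 15 - 4) * (n : ℝ) ^ 3 ≤ 4 * 10 ^ 15 * (l2Ind (edgeInd H) v : ℝ) := by
      linarith
    exact_mod_cast this
  obtain ⟨A, hA⟩ := (fanoFreeInd_edgeInd h3 hF).exists_bipartite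
    (by rw [Fintype.card_fin]; exact_mod_cast hn) hQ
  refine ⟨A, fun e he => ?_⟩
  obtain ⟨x, y, z, -, -, -, rfl⟩ := Finset.card_eq_three.1 (h3 e he)
  obtain ⟨h1, h2⟩ := hA x y z (by simpa [edgeInd] using he)
  constructor
  · rcases h1 with h1 | h1 | h1
    · exact ⟨x, by simp [h1]⟩
    · exact ⟨y, by simp [h1]⟩
    · exact ⟨z, by simp [h1]⟩
  · rcases h2 with h2 | h2 | h2
    · exact ⟨x, by simp [h2]⟩
    · exact ⟨y, by simp [h2]⟩
    · exact ⟨z, by simp [h2]⟩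
end

section
/- Let n be a positive integer and let 𝒢 = (G₁,…,G₅) be a 𝕂₄-free 5-multigraph on n vertices. If δ(𝒢) ≥ 44n/13, then 𝒢 admits a nice partition. -/
/-- A 5-multigraph `(G₁,…,G₅)` on `Fin n`: each `G i` is the edge set of a simple graph,
so every edge is a 2-element subset. -/
def IsMulti5 {n : ℕ} (G : Fin 5 → Finset (Finset (Fin n))) : Prop :=
  ∀ i, ∀ e ∈ G i, e.card = 2

/-- The size of a 5-multigraph: `|𝒢| = ∑ᵢ |Gᵢ|`. -/
def msize {n : ℕ} (G : Fin 5 → Finset (Finset (Fin n))) : ℕ := ∑ i, (G i).card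

/-- The degree of a vertex in a 5-multigraph: `d_𝒢(v) = ∑ᵢ d_{Gᵢ}(v)`. -/
def mdeg {n : ℕ} (G : Fin 5 → Finset (Finset (Fin n))) (v : Fin n) : ℕ :=
  ∑ i, ((G i).filter fun e => v ∈ e).card

/-- The multiplicity of a pair `{u,v}`: the number of indices `i` with `uv ∈ Gᵢ`. -/
def mult5 {n : ℕ} (G : Fin 5 → Finset (Finset (Fin n))) (u v : Fin n) : ℕ :=
  (Finset.univ.filter fun i : Fin 5 => ({u, v} : Finset (Fin n)) ∈ G i).card

/-- A 5-multigraph contains `𝕂₄` if there are three distinct indices `i, j, k` and four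
distinct vertices `a, b, c, d` with `{ab, cd} ⊆ Gᵢ`, `{ac, bd} ⊆ Gⱼ`, `{ad, bc} ⊆ G_k`. -/
def ContainsK4 {n : ℕ} (G : Fin 5 → Finset (Finset (Fin n))) : Prop :=
  ∃ i j k : Fin 5, ∃ a b c d : Fin n,
    i ≠ j ∧ i ≠ k ∧ j ≠ k ∧
    a ≠ b ∧ a ≠ c ∧ a ≠ d ∧ b ≠ c ∧ b ≠ d ∧ c ≠ d ∧
    ({a, b} : Finset (Fin n)) ∈ G i ∧ ({c, d} : Finset (Fin n)) ∈ G i ∧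
    ({a, c} : Finset (Fin n)) ∈ G j ∧ ({b, d} : Finset (Fin n)) ∈ G j ∧
    ({a, d} : Finset (Fin n)) ∈ G k ∧ ({b, c} : Finset (Fin n)) ∈ G k
/-- A partition `V₁ ∪ V₁ᶜ` of the vertex set is *nice* if, after some permutation `σ` of
the indices, `G₁[V₂] = G₂[V₂] = G₃[V₁] = G₄[V₁] = G₅[V₁] = ∅` (with `V₂ = V₁ᶜ`) and
every pair of vertices inside `V₂` has multiplicity at most 2. -/
def NicePartition {n : ℕ} (G : Fin 5 → Finset (Finset (Fin n))) : Prop :=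
  ∃ (V₁ : Finset (Fin n)) (σ : Equiv.Perm (Fin 5)),
    (∀ e ∈ G (σ 0), ¬ e ⊆ V₁ᶜ) ∧ (∀ e ∈ G (σ 1), ¬ e ⊆ V₁ᶜ) ∧
    (∀ e ∈ G (σ 2), ¬ e ⊆ V₁) ∧ (∀ e ∈ G (σ 3), ¬ e ⊆ V₁) ∧ (∀ e ∈ G (σ 4), ¬ e ⊆ V₁) ∧
    (∀ u v : Fin n, u ≠ v → u ∈ V₁ᶜ → v ∈ V₁ᶜ → mult5 G u v ≤ 2)

/-- A symmetric assignment of colour sets to pairs of vertices which is `𝕂₄`-free and has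
minimum degree at least `44/13` times the number of vertices. -/
structure IsDenseK4Free {V : Type*} [Fintype V] (C : V → V → Finset (Fin 5)) : Prop where
  symm : ∀ u v, C u v = C v u
  irrefl : ∀ v, C v v = ∅
  k4free : ∀ a b c d i j k, i ≠ j → i ≠ k → j ≠ k → i ∈ C a b → i ∈ C c d →
    j ∈ C a c → j ∈ C b d → k ∈ C a d → k ∈ C b c → False
  degree : ∀ v, 44 * Fintype.card V ≤ 13 * ∑ u, (C v u).card

/-- Three sets have a system of distinct representatives. -/
def HasSDR (A B C : Finset (Fin 5)) : Prop :=
  ∃ i ∈ A, ∃ j ∈ B, ∃ k ∈ C, i ≠ j ∧ i ≠ k ∧ j ≠ k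

theorem HasSDR.swap_left {A B C : Finset (Fin 5)} : HasSDR A B C → HasSDR B A C :=
  fun ⟨i, hi, j, hj, k, hk, h₁, h₂, h₃⟩ => ⟨j, hj, i, hi, k, hk, h₁.symm, h₃, h₂⟩

theorem HasSDR.swap_right {A B C : Finset (Fin 5)} : HasSDR A B C → HasSDR A C B :=
  fun ⟨i, hi, j, hj, k, hk, h₁, h₂, h₃⟩ => ⟨i, hi, k, hk, j, hj, h₂, h₁, h₃.symm⟩

theorem HasSDR.of_card {A B C : Finset (Fin 5)} (hA : 1 ≤ A.card) (hB : 2 ≤ B.card)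
    (hC : 3 ≤ C.card) : HasSDR A B C := by
  obtain ⟨i, hi⟩ := Finset.card_pos.1 hA
  obtain ⟨j, hj, hji⟩ := Finset.exists_mem_ne hB i
  obtain ⟨k, hk, hk'⟩ := Finset.exists_mem_notMem_of_card_lt_card
    (s := {i, j}) (t := C) (Finset.card_le_two.trans_lt hC)
  simp only [Finset.mem_insert, Finset.mem_singleton, not_or] at hk'
  exact ⟨i, hi, j, hj, k, hk, hji.symm, Ne.symm hk'.1, Ne.symm hk'.2⟩

theorem card_le_of_not_hasSDR {A B C : Finset (Fin 5)} (h : ¬ HasSDR A B C) :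
    A.card = 0 ∨ B.card = 0 ∨ C.card = 0 ∨ (A.card ≤ 1 ∧ B.card ≤ 1) ∨
      (A.card ≤ 1 ∧ C.card ≤ 1) ∨ (B.card ≤ 1 ∧ C.card ≤ 1) ∨
      (A.card ≤ 2 ∧ B.card ≤ 2 ∧ C.card ≤ 2) := by
  by_contra hcon
  have key : ∀ {X Y Z : Finset (Fin 5)}, (HasSDR X Y Z → HasSDR A B C) →
      ¬ (1 ≤ X.card ∧ 2 ≤ Y.card ∧ 3 ≤ Z.card) :=
    fun f hc => h (f (HasSDR.of_card hc.1 hc.2.1 hc.2.2))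
  have h₁ := key id
  have h₂ := key HasSDR.swap_right
  have h₃ := key HasSDR.swap_left
  have h₄ := key fun h => h.swap_left.swap_right
  have h₅ := key fun h => h.swap_right.swap_left
  have h₆ := key fun h => h.swap_right.swap_left.swap_right
  omega

theorem eq_and_subset_of_not_hasSDR {A B C : Finset (Fin 5)} (hA : A.card = 2)
    (hB : B.card = 2) (hC : C.Nonempty) (h : ¬ HasSDR A B C) : A = B ∧ C ⊆ A := by
  have key : ∀ {A B : Finset (Fin 5)}, A.card = 2 → B.card = 2 → ¬ HasSDR A B C → C ⊆ A := by
    intro A B hA hB h c hc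
    by_contra hcA
    obtain ⟨j, hj, hjc⟩ := Finset.exists_mem_ne (by omega : 1 < B.card) c
    obtain ⟨i, hi, hij⟩ := Finset.exists_mem_ne (by omega : 1 < A.card) j
    exact h ⟨i, hi, j, hj, c, hc, hij, fun e => hcA (e ▸ hi), hjc⟩
  have hCA := key hA hB h
  have hCB := key hB hA (fun h' => h h'.swap_left)
  refine ⟨?_, hCA⟩
  by_contra hne
  obtain ⟨c, hc⟩ := hC
  obtain ⟨i, hi, hic⟩ := Finset.exists_mem_ne (by omega : 1 < A.card) c
  have hAB : ¬ A ⊆ B := fun hs => hne (Finset.eq_of_subset_of_card_le hs (by omega))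
  obtain ⟨p, hpA, hpB⟩ := Finset.not_subset.1 hAB
  obtain ⟨q, hq, hqc⟩ := Finset.exists_mem_ne (by omega : 1 < B.card) c
  exact h ⟨p, hpA, q, hq, c, hc, fun e => hpB (e ▸ hq), fun e => hpB (e ▸ hCB hc), hqc⟩

namespace IsDenseK4Free

variable {V : Type*} [Fintype V] {C : V → V → Finset (Fin 5)}

theorem not_hasSDR (hC : IsDenseK4Free C) (a b c d : V) :
    ¬ HasSDR (C a b ∩ C c d) (C a c ∩ C b d) (C a d ∩ C b c) := by
  rintro ⟨i, hi, j, hj, k, hk, hij, hik, hjk⟩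
  rw [Finset.mem_inter] at hi hj hk
  exact hC.k4free a b c d i j k hij hik hjk hi.1 hi.2 hj.1 hj.2 hk.1 hk.2

/-- The multiplicities on four vertices of a `𝕂₄`-free colouring. -/
theorem card_quadruple (hC : IsDenseK4Free C) (a b c d : V) {s₁ s₂ s₃ : ℕ}
    (h₁ : (C a b).card + (C c d).card = s₁) (h₂ : (C a c).card + (C b d).card = s₂)
    (h₃ : (C a d).card + (C b c).card = s₃) :
    s₁ ≤ 5 ∨ s₂ ≤ 5 ∨ s₃ ≤ 5 ∨ (s₁ ≤ 6 ∧ s₂ ≤ 6) ∨ (s₁ ≤ 6 ∧ s₃ ≤ 6) ∨ (s₂ ≤ 6 ∧ s₃ ≤ 6) ∨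
      (s₁ ≤ 7 ∧ s₂ ≤ 7 ∧ s₃ ≤ 7) := by
  have h := card_le_of_not_hasSDR (hC.not_hasSDR a b c d)
  have key : ∀ A B : Finset (Fin 5), A.card + B.card ≤ 5 + (A ∩ B).card := by
    intro A B
    have := Finset.card_union_add_card_inter A B
    have := (A ∪ B).card_le_univ
    simp only [Fintype.card_fin] at this
    omega
  have k₁ := key (C a b) (C c d)
  have k₂ := key (C a c) (C b d)
  have k₃ := key (C a d) (C b c)
  omega

omit [Fintype V] in
theorem card_le_five (u v : V) : (C u v).card ≤ 5 := by
  simpa using (C u v).card_le_univ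

/-- Averaging the degrees of finitely many weighted vertices. -/
theorem averaging (hC : IsDenseK4Free C) (w : V → ℕ)
    (h : ∀ d, 13 * ∑ s, w s * (C s d).card ≤ 44 * ∑ s, w s) (e : V)
    (he : 13 * ∑ s, w s * (C s e).card < 44 * ∑ s, w s) : False := by
  have h₁ : ∑ d, 13 * ∑ s, w s * (C s d).card < ∑ _d : V, 44 * ∑ s, w s :=
    Finset.sum_lt_sum (fun d _ => h d) ⟨e, Finset.mem_univ e, he⟩
  have h₂ : ∑ s, w s * (44 * Fintype.card V) ≤ ∑ s, w s * (13 * ∑ d, (C s d).card) :=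
    Finset.sum_le_sum fun s _ => Nat.mul_le_mul_left _ (hC.degree s)
  have h₃ : ∑ d, 13 * ∑ s, w s * (C s d).card = ∑ s, w s * (13 * ∑ d, (C s d).card) := by
    simp only [Finset.mul_sum]
    rw [Finset.sum_comm]
    exact Finset.sum_congr rfl fun _ _ => Finset.sum_congr rfl fun _ _ => by ring
  rw [h₃, Finset.sum_const, smul_eq_mul, Finset.card_univ] at h₁
  rw [← Finset.sum_mul] at h₂
  nlinarith

theorem averaging_four (hC : IsDenseK4Free C) (x y z t : V) (α β γ δ : ℕ)
    (h : ∀ d, 13 * (α * (C x d).card + β * (C y d).card + γ * (C z d).card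
      + δ * (C t d).card) ≤ 44 * (α + β + γ + δ))
    (he : 13 * (α * (C x z).card + β * (C y z).card + δ * (C t z).card)
      < 44 * (α + β + γ + δ)) : False := by
  classical
  let w : V → ℕ := fun s => (if s = x then α else 0) + (if s = y then β else 0)
    + (if s = z then γ else 0) + (if s = t then δ else 0)
  have hw : ∀ f : V → ℕ, ∑ s, w s * f s = α * f x + β * f y + γ * f z + δ * f t := by
    intro f
    simp [w, add_mul, Finset.sum_add_distrib]
  have hw' : ∑ s, w s = α + β + γ + δ := by simp [w, Finset.sum_add_distrib]
  refine hC.averaging w (fun d => ?_) z ?_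
  · rw [hw, hw']; exact h d
  · rw [hw, hw', hC.irrefl z]; simpa using he

theorem averaging_three (hC : IsDenseK4Free C) (x y z : V) (α β γ : ℕ)
    (h : ∀ d, 13 * (α * (C x d).card + β * (C y d).card + γ * (C z d).card)
      ≤ 44 * (α + β + γ))
    (he : 13 * (α * (C x z).card + β * (C y z).card) < 44 * (α + β + γ)) : False :=
  hC.averaging_four x y z z α β γ 0 (by simpa using h) (by simpa using he)

/-- Every triangle of multiplicities at least three has total multiplicity at most `W`. -/
def HeavyTriangleLE (C : V → V → Finset (Fin 5)) (W : ℕ) : Prop :=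
  ∀ x y z, 3 ≤ (C y z).card → 3 ≤ (C x z).card → 3 ≤ (C x y).card →
    (C y z).card + (C x z).card + (C x y).card ≤ W

/-- To improve the bound on heavy triangles, it suffices to exclude sorted ones. -/
theorem HeavyTriangleLE.pred (hC : IsDenseK4Free C) {W : ℕ} (hW : HeavyTriangleLE C (W + 1))
    (h : ∀ x y z, 3 ≤ (C x y).card → (C x y).card ≤ (C x z).card →
      (C x z).card ≤ (C y z).card → (C y z).card + (C x z).card + (C x y).card ≠ W + 1) :
    HeavyTriangleLE C W := by
  intro x y z h₁ h₂ h₃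
  have := hW x y z h₁ h₂ h₃
  have a₁ := h x y z
  have a₂ := h x z y
  have a₃ := h y x z
  have a₄ := h y z x
  have a₅ := h z x y
  have a₆ := h z y x
  rw [hC.symm z x, hC.symm z y] at *
  rw [hC.symm y x] at *
  omega

omit [Fintype V] in
/-- The constraints on the multiplicities between a triangle and a further vertex. -/
theorem HeavyTriangleLE.extension_bounds {W : ℕ} (hW : HeavyTriangleLE C W)
    (x y z d : V) :
    ((C x d).card ≤ 5 ∧ (C y d).card ≤ 5 ∧ (C z d).card ≤ 5) ∧
    (3 ≤ (C x d).card → 3 ≤ (C y d).card → 3 ≤ (C x y).card →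
      (C x d).card + (C y d).card + (C x y).card ≤ W) ∧
    (3 ≤ (C x d).card → 3 ≤ (C z d).card → 3 ≤ (C x z).card →
      (C x d).card + (C z d).card + (C x z).card ≤ W) ∧
    (3 ≤ (C y d).card → 3 ≤ (C z d).card → 3 ≤ (C y z).card →
      (C y d).card + (C z d).card + (C y z).card ≤ W) := by
  have h₁ := hW x y d
  have h₂ := hW x z d
  have h₃ := hW y z d
  have := card_le_five (C := C) x d
  have := card_le_five (C := C) y d
  have := card_le_five (C := C) z d
  omega

theorem not_triangle_of_weights (hC : IsDenseK4Free C) {W : ℕ} (hW : HeavyTriangleLE C W)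
    {x y z : V} {p q r : ℕ} (hp : (C y z).card = p) (hq : (C x z).card = q)
    (hr : (C x y).card = r) (α β γ : ℕ)
    (h : ∀ a b c : ℕ, a ≤ 5 ∧ b ≤ 5 ∧ c ≤ 5 →
      (3 ≤ a → 3 ≤ b → 3 ≤ r → a + b + r ≤ W) →
      (3 ≤ a → 3 ≤ c → 3 ≤ q → a + c + q ≤ W) →
      (3 ≤ b → 3 ≤ c → 3 ≤ p → b + c + p ≤ W) →
      (c + r ≤ 5 ∨ b + q ≤ 5 ∨ a + p ≤ 5 ∨ (c + r ≤ 6 ∧ b + q ≤ 6) ∨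
        (c + r ≤ 6 ∧ a + p ≤ 6) ∨ (b + q ≤ 6 ∧ a + p ≤ 6) ∨
        (c + r ≤ 7 ∧ b + q ≤ 7 ∧ a + p ≤ 7)) →
      13 * (α * a + β * b + γ * c) ≤ 44 * (α + β + γ))
    (he : 13 * (α * q + β * p) < 44 * (α + β + γ)) : False := by
  subst hp hq hr
  refine hC.averaging_three x y z α β γ (fun d => ?_) he
  obtain ⟨h₁, h₂, h₃, h₄⟩ := hW.extension_bounds x y z d
  exact h _ _ _ h₁ h₂ h₃ h₄ (hC.card_quadruple x y z d (by omega) (by omega) (by omega))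

/-- A triangle of multiplicities `5, 3, 3` extends to two such triangles sharing the vertices
of the light pairs, which send too little to the rest of the graph. -/
theorem not_triangle_five_three_three (hC : IsDenseK4Free C) (hW : HeavyTriangleLE C 11)
    (h443 : ∀ x y z, ¬ ((C y z).card = 4 ∧ (C x z).card = 4 ∧ (C x y).card = 3))
    {x y z : V} (hp : (C y z).card = 5) (hq : (C x z).card = 3) (hr : (C x y).card = 3) :
    False := by
  have key : ∀ {x y z : V}, (C y z).card = 5 → (C x z).card = 3 → (C x y).card = 3 → ∀ d,
      (C x d).card + (C y d).card + (C z d).card ≤ 10 ∨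
      (C x d).card = 5 ∧ (C y d).card = 3 ∧ (C z d).card = 3 := by
    intro x y z hp hq hr d
    obtain ⟨h₁, h₂, h₃, h₄⟩ := hW.extension_bounds x y z d
    have h := hC.card_quadruple x y z d rfl rfl rfl
    have a₁ := h443 x y d
    have a₂ := h443 x z d
    rw [hp, hq, hr] at h
    rw [hr] at h₂ a₁
    rw [hq] at h₃ a₂
    rw [hp] at h₄
    omega
  have hd : ∃ d, (C x d).card = 5 ∧ (C y d).card = 3 ∧ (C z d).card = 3 := by
    by_contra! hcon
    refine hC.averaging_three x y z 1 1 1 (fun d => ?_) (by omega)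
    have := key hp hq hr d
    have := hcon d
    omega
  obtain ⟨d, hx, hy, hz⟩ := hd
  refine hC.averaging_four x y z d 1 1 1 1 (fun e => ?_) ?_
  · have h₁ := key hp hq hr e
    have h₂ := key (x := d) hp (by rw [hC.symm]; exact hz) (by rw [hC.symm]; exact hy) e
    have h₃ := key (x := y) (y := x) (z := d) hx hy (by rw [hC.symm]; exact hr) e
    have h₄ := key (x := z) (y := x) (z := d) hx hz (by rw [hC.symm]; exact hq) e
    omega
  · rw [hC.symm d z]
    omega

theorem not_heavyTriangle (hC : IsDenseK4Free C) (x y z : V) (h₁ : 3 ≤ (C x y).card)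
    (h₂ : 3 ≤ (C x z).card) (h₃ : 3 ≤ (C y z).card) : False := by
  have h15 : HeavyTriangleLE C 15 := by
    intro x y z _ _ _
    have := card_le_five (C := C) y z
    have := card_le_five (C := C) x z
    have := card_le_five (C := C) x y
    omega
  have h14 : HeavyTriangleLE C 14 := h15.pred hC <| by
    intro x y z hr hqr hpq hs
    have := card_le_five (C := C) y z
    exact hC.not_triangle_of_weights h15 (x := x) (y := y) (z := z) (p := 5) (q := 5) (r := 5)
      (by omega) (by omega) (by omega) 1 1 1 (by omega) (by omega)
  have h13 : HeavyTriangleLE C 13 := h14.pred hC <| by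
    intro x y z hr hqr hpq hs
    have := card_le_five (C := C) y z
    exact hC.not_triangle_of_weights h14 (x := x) (y := y) (z := z) (p := 5) (q := 5) (r := 4)
      (by omega) (by omega) (by omega) 2 2 3 (by omega) (by omega)
  have h12 : HeavyTriangleLE C 12 := h13.pred hC <| by
    intro x y z hr hqr hpq hs
    have := card_le_five (C := C) y z
    obtain hq | hq : (C x z).card = 4 ∨ (C x z).card = 5 := by omega
    · exact hC.not_triangle_of_weights h13 (x := x) (y := y) (z := z) (p := 5) (q := 4) (r := 4)
        (by omega) (by omega) (by omega) 1 2 2 (by omega) (by omega)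
    · exact hC.not_triangle_of_weights h13 (x := x) (y := y) (z := z) (p := 5) (q := 5) (r := 3)
        (by omega) (by omega) (by omega) 3 3 7 (by omega) (by omega)
  have h11 : HeavyTriangleLE C 11 := h12.pred hC <| by
    intro x y z hr hqr hpq hs
    have := card_le_five (C := C) y z
    obtain hp | hp : (C y z).card = 4 ∨ (C y z).card = 5 := by omega
    · exact hC.not_triangle_of_weights h12 (x := x) (y := y) (z := z) (p := 4) (q := 4) (r := 4)
        (by omega) (by omega) (by omega) 1 1 1 (by omega) (by omega)
    · exact hC.not_triangle_of_weights h12 (x := x) (y := y) (z := z) (p := 5) (q := 4) (r := 3)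
        (by omega) (by omega) (by omega) 1 2 3 (by omega) (by omega)
  have h443 : ∀ x y z, ¬ ((C y z).card = 4 ∧ (C x z).card = 4 ∧ (C x y).card = 3) := by
    rintro x y z ⟨hp, hq, hr⟩
    exact hC.not_triangle_of_weights h11 hp hq hr 1 1 1 (by omega) (by omega)
  have h10 : HeavyTriangleLE C 10 := h11.pred hC <| by
    intro x y z hr hqr hpq hs
    have := card_le_five (C := C) y z
    have := h443 x y z
    exact hC.not_triangle_five_three_three h11 h443 (x := x) (y := y) (z := z)
      (by omega) (by omega) (by omega)
  have h9 : HeavyTriangleLE C 9 := h10.pred hC <| by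
    intro x y z hr hqr hpq hs
    exact hC.not_triangle_of_weights h10 (x := x) (y := y) (z := z) (p := 4) (q := 3) (r := 3)
      (by omega) (by omega) (by omega) 1 2 2 (by omega) (by omega)
  have h8 : HeavyTriangleLE C 8 := h9.pred hC <| by
    intro x y z hr hqr hpq hs
    exact hC.not_triangle_of_weights h9 (x := x) (y := y) (z := z) (p := 3) (q := 3) (r := 3)
      (by omega) (by omega) (by omega) 1 1 1 (by omega) (by omega)
  have := h8 x y z h₃ h₂ h₁
  omega

/-- The pairs of multiplicity at least three form a bipartite graph. -/
theorem exists_bipartition [Nonempty V] (hC : IsDenseK4Free C) :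
    ∃ A : Finset V, ∀ u v, (u ∈ A ↔ v ∈ A) → (C u v).card ≤ 2 := by
  classical
  let H : SimpleGraph V :=
    { Adj := fun u v => 3 ≤ (C u v).card
      symm := ⟨fun u v h => by rw [hC.symm]; exact h⟩
      loopless := ⟨fun v h => by simp [hC.irrefl v] at h⟩ }
  have hfree : H.CliqueFree 3 := by
    intro s hs
    obtain ⟨x, y, z, hxy, hxz, hyz, -⟩ := SimpleGraph.is3Clique_iff.1 hs
    exact hC.not_heavyTriangle x y z hxy hxz hyz
  have hdeg : (3 * 2 - 4) * Fintype.card V / (3 * 2 - 1) < H.minDegree := by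
    obtain ⟨v, hv⟩ := H.exists_minimal_degree_vertex
    rw [hv]
    have hsum : ∑ u, (C v u).card ≤ 2 * Fintype.card V + 3 * H.degree v := by
      calc ∑ u, (C v u).card ≤ ∑ u, (2 + if H.Adj v u then 3 else 0) := by
            refine Finset.sum_le_sum fun u _ => ?_
            have := card_le_five (C := C) v u
            split_ifs with h
            · omega
            · have : ¬ 3 ≤ (C v u).card := h
              omega
        _ = 2 * Fintype.card V + 3 * H.degree v := by
            rw [Finset.sum_add_distrib, ← Finset.sum_filter, Finset.sum_const, Finset.sum_const,
              ← SimpleGraph.neighborFinset_eq_filter, SimpleGraph.card_neighborFinset_eq_degree]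
            simp [mul_comm]
    have := hC.degree v
    have : 0 < Fintype.card V := Fintype.card_pos
    omega
  obtain ⟨c⟩ := SimpleGraph.colorable_of_cliqueFree_lt_minDegree hfree hdeg
  refine ⟨Finset.univ.filter fun v => c v = 0, fun u v huv => ?_⟩
  by_contra hcard
  have hadj : H.Adj u v := by
    change 3 ≤ (C u v).card
    omega
  have := c.valid hadj
  simp only [Finset.mem_filter, Finset.mem_univ, true_and] at huv
  omega

section Colours

variable [DecidableEq V] {A : Finset V}

/-- The multiplicity of a typical pair with respect to the bipartition `(A, Aᶜ)`. -/
def typical (A : Finset V) (u v : V) : ℕ := if u ∈ A ↔ v ∈ A then 2 else 5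

/-- The vertices whose multiplicity with `v` is less than the typical one. -/
def deficient (C : V → V → Finset (Fin 5)) (A : Finset V) (v : V) : Finset V :=
  Finset.univ.filter fun u => (C v u).card < typical A v u

theorem card_of_notMem_deficient (hA : ∀ u v, (u ∈ A ↔ v ∈ A) → (C u v).card ≤ 2) {u v : V}
    (huv : u ∈ A ↔ v ∈ A) (h : u ∉ deficient C A v) : (C v u).card = 2 := by
  have := hA v u huv.symm
  simp only [deficient, Finset.mem_filter, Finset.mem_univ, true_and, not_lt] at h
  simp only [typical, huv, if_true] at h
  omega

theorem eq_univ_of_notMem_deficient {u v : V} (huv : ¬ (u ∈ A ↔ v ∈ A))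
    (h : u ∉ deficient C A v) : C v u = Finset.univ := by
  have huv' : ¬ (v ∈ A ↔ u ∈ A) := fun e => huv e.symm
  simp only [deficient, Finset.mem_filter, Finset.mem_univ, true_and, not_lt] at h
  simp only [typical, huv', if_false] at h
  have := card_le_five (C := C) v u
  exact (Finset.card_eq_iff_eq_univ _).1 (by rw [Fintype.card_fin]; omega)

theorem card_deficient_add (hC : IsDenseK4Free C)
    (hA : ∀ u v, (u ∈ A ↔ v ∈ A) → (C u v).card ≤ 2) (v : V) :
    44 * Fintype.card V + 13 * (deficient C A v).card ≤ 13 * ∑ u, typical A v u := by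
  have h : ∑ u, ((C v u).card + if (C v u).card < typical A v u then 1 else 0)
      ≤ ∑ u, typical A v u := by
    refine Finset.sum_le_sum fun u _ => ?_
    have h₅ := card_le_five (C := C) v u
    have h₂ := hA v u
    unfold typical
    split_ifs <;> simp_all
  rw [Finset.sum_add_distrib, ← Finset.sum_filter, Finset.sum_const, smul_eq_mul, mul_one] at h
  have := hC.degree v
  unfold deficient
  omega

theorem sum_typical_of_mem {v : V} (hv : v ∈ A) :
    ∑ u, typical A v u = 2 * A.card + 5 * Aᶜ.card := by
  rw [← Finset.sum_add_sum_compl A, Finset.sum_congr rfl (g := fun _ => 2),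
    Finset.sum_congr (s₁ := Aᶜ) rfl (g := fun _ => 5)]
  · simp [mul_comm]
  · intro u hu
    simp_all [typical]
  · intro u hu
    simp_all [typical]

theorem sum_typical_of_notMem {v : V} (hv : v ∉ A) :
    ∑ u, typical A v u = 5 * A.card + 2 * Aᶜ.card := by
  rw [← Finset.sum_add_sum_compl A, Finset.sum_congr rfl (g := fun _ => 5),
    Finset.sum_congr (s₁ := Aᶜ) rfl (g := fun _ => 2)]
  · simp [mul_comm]
  · intro u hu
    simp_all [typical]
  · intro u hu
    simp_all [typical]

/-- The larger side of the bipartition only has two colours, which are missing on the other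
side. -/
theorem exists_colours [Nonempty V] (hC : IsDenseK4Free C)
    (hA : ∀ u v, (u ∈ A ↔ v ∈ A) → (C u v).card ≤ 2) (hle : Aᶜ.card ≤ A.card) :
    ∃ U : Finset (Fin 5), U.card = 2 ∧ (∀ u ∈ A, ∀ v ∈ A, C u v ⊆ U) ∧
      ∀ u ∈ Aᶜ, ∀ v ∈ Aᶜ, Disjoint (C u v) U := by
  have hcard : A.card + Aᶜ.card = Fintype.card V := Finset.card_add_card_compl A
  have hpos : 0 < Fintype.card V := Fintype.card_pos
  have hin : ∀ v ∈ A, 13 * (deficient C A v).card + 18 * A.card ≤ 21 * Aᶜ.card := by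
    intro v hv
    have := hC.card_deficient_add hA v
    rw [sum_typical_of_mem hv] at this
    omega
  have hout : ∀ v ∉ A, 13 * (deficient C A v).card + 18 * Aᶜ.card ≤ 21 * A.card := by
    intro v hv
    have := hC.card_deficient_add hA v
    rw [sum_typical_of_notMem hv] at this
    omega
  have hApos : 0 < A.card := by omega
  obtain ⟨v₀, hv₀⟩ := Finset.card_pos.1 hApos
  have hA₀ := hin v₀ hv₀
  have pick : ∀ S : Finset V, ∀ u v w : V,
      (deficient C A u).card + (deficient C A v).card + (deficient C A w).card < S.card →
      ∃ y ∈ S, y ∉ deficient C A u ∧ y ∉ deficient C A v ∧ y ∉ deficient C A w := by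
    intro S u v w h
    have h₁ := Finset.card_union_le (deficient C A u ∪ deficient C A v) (deficient C A w)
    have h₂ := Finset.card_union_le (deficient C A u) (deficient C A v)
    obtain ⟨y, hy, hy'⟩ := Finset.exists_mem_notMem_of_card_lt_card (by omega :
      (deficient C A u ∪ deficient C A v ∪ deficient C A w).card < S.card)
    simp only [Finset.mem_union, not_or] at hy'
    exact ⟨y, hy, hy'.1.1, hy'.1.2, hy'.2⟩
  have common : ∀ u ∈ A, ∀ v ∈ A, ∀ w ∈ A, ∃ y ∈ A,
      (C u y).card = 2 ∧ (C v y).card = 2 ∧ (C w y).card = 2 := by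
    intro u hu v hv w hw
    have := hin u hu
    have := hin v hv
    have := hin w hw
    obtain ⟨y, hy, h₁, h₂, h₃⟩ := pick A u v w (by omega)
    exact ⟨y, hy, card_of_notMem_deficient hA (by simp [*]) h₁,
      card_of_notMem_deficient hA (by simp [*]) h₂, card_of_notMem_deficient hA (by simp [*]) h₃⟩
  have twin : ∀ u ∈ A, ∀ v ∈ A, ∀ w ∈ A, (C u v).card = 2 → (C u w).card = 2 →
      (C v w).Nonempty → C u v = C u w ∧ C v w ⊆ C u v := by
    intro u hu v hv w hw huv huw hvw
    have := hin u hu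
    have := hin v hv
    have := hin w hw
    obtain ⟨y, hy, h₁, h₂, h₃⟩ := pick Aᶜ u v w (by omega)
    rw [Finset.mem_compl] at hy
    have h := hC.not_hasSDR u v w y
    rw [eq_univ_of_notMem_deficient (by simp [*]) h₁, eq_univ_of_notMem_deficient (by simp [*]) h₂,
      eq_univ_of_notMem_deficient (by simp [*]) h₃, Finset.inter_univ, Finset.inter_univ,
      Finset.univ_inter] at h
    exact eq_and_subset_of_not_hasSDR huv huw hvw h
  have star : ∀ u ∈ A, ∀ v ∈ A, ∀ w ∈ A, (C u v).card = 2 → (C u w).card = 2 →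
      C u v = C u w := by
    intro u hu v hv w hw huv huw
    obtain ⟨y, hy, h₁, h₂, h₃⟩ := common u hu v hv w hw
    exact (twin u hu v hv y hy huv h₁ (Finset.card_pos.1 (by omega))).1.trans
      (twin u hu w hw y hy huw h₁ (Finset.card_pos.1 (by omega))).1.symm
  obtain ⟨y₀, hy₀, hU, -, -⟩ := common v₀ hv₀ v₀ hv₀ v₀ hv₀
  have double : ∀ u ∈ A, ∀ v ∈ A, (C u v).card = 2 → C u v = C v₀ y₀ := by
    intro u hu v hv huv
    obtain ⟨y, hy, h₁, h₂, -⟩ := common v₀ hv₀ u hu u hu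
    rw [star v₀ hv₀ y₀ hy₀ y hy hU h₁, star u hu v hv y hy huv h₂, hC.symm u, hC.symm v₀]
    exact star y hy u hu v₀ hv₀ (by rwa [hC.symm]) (by rwa [hC.symm])
  refine ⟨C v₀ y₀, hU, fun u hu v hv => ?_, fun w hw w' hw' => ?_⟩
  · obtain h | h := (C u v).eq_empty_or_nonempty
    · simp [h]
    · obtain ⟨y, hy, h₁, h₂, -⟩ := common u hu v hv v hv
      rw [hC.symm] at h₁ h₂
      rw [← double y hy u hu h₁]
      exact (twin y hy u hu v hv h₁ h₂ h).2
  · rw [Finset.mem_compl] at hw hw'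
    rw [Finset.disjoint_left]
    intro c hc hcU
    have := hout w hw
    have := hout w' hw'
    obtain ⟨x, hx, h₁, h₂⟩ : ∃ x ∈ A, x ∉ deficient C A w ∧ x ∉ deficient C A w' := by
      obtain ⟨x, hx⟩ := Finset.exists_mem_notMem_of_card_lt_card
        (s := deficient C A w ∪ deficient C A w') (t := A)
        ((Finset.card_union_le _ _).trans_lt (by omega))
      simp only [Finset.mem_union, not_or] at hx
      exact ⟨x, hx.1, hx.2.1, hx.2.2⟩
    have := hin x hx
    obtain ⟨x', hx', h₃, h₄, h₅⟩ := pick A w w' x (by omega)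
    have hxx' := card_of_notMem_deficient hA (by simp [*]) h₅
    obtain ⟨j, hj⟩ : ∃ j : Fin 5, j ≠ c := exists_ne c
    obtain ⟨k, hk⟩ : ∃ k : Fin 5, k ∉ ({c, j} : Finset (Fin 5)) := by
      by_contra! h
      have := Finset.card_le_card (fun i _ => h i : Finset.univ ⊆ ({c, j} : Finset (Fin 5)))
      have := Finset.card_le_two (a := c) (b := j)
      simp at *
      omega
    simp only [Finset.mem_insert, Finset.mem_singleton, not_or] at hk
    refine hC.k4free w w' x x' c j k hj.symm (Ne.symm hk.1) (Ne.symm hk.2) hc ?_ ?_ ?_ ?_ ?_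
    · rwa [double x hx x' hx' hxx']
    · simp [eq_univ_of_notMem_deficient (by simp [*]) h₁]
    · simp [eq_univ_of_notMem_deficient (by simp [*]) h₄]
    · simp [eq_univ_of_notMem_deficient (by simp [*]) h₃]
    · simp [eq_univ_of_notMem_deficient (by simp [*]) h₂]

end Colours

theorem exists_nice [Nonempty V] [DecidableEq V] (hC : IsDenseK4Free C) :
    ∃ (A : Finset V) (U : Finset (Fin 5)), U.card = 2 ∧ (∀ u ∈ A, ∀ v ∈ A, C u v ⊆ U) ∧
      ∀ u ∈ Aᶜ, ∀ v ∈ Aᶜ, Disjoint (C u v) U ∧ (C u v).card ≤ 2 := by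
  obtain ⟨A, hA⟩ := hC.exists_bipartition
  wlog hle : Aᶜ.card ≤ A.card generalizing A
  · exact this Aᶜ (fun u v huv => hA u v (by simpa [not_iff_not] using huv))
      (by rw [compl_compl]; omega)
  obtain ⟨U, hU, hin, hout⟩ := hC.exists_colours hA hle
  refine ⟨A, U, hU, hin, fun u hu v hv => ⟨hout u hu v hv, hA u v ?_⟩⟩
  rw [Finset.mem_compl] at hu hv
  simp [hu, hv]

end IsDenseK4Free

/-- The colours of the pair `{u, v}`. -/
def pairColours {n : ℕ} (G : Fin 5 → Finset (Finset (Fin n))) (u v : Fin n) :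
    Finset (Fin 5) :=
  Finset.univ.filter fun i => ({u, v} : Finset (Fin n)) ∈ G i

theorem mem_pairColours {n : ℕ} {G : Fin 5 → Finset (Finset (Fin n))} {u v : Fin n}
    {i : Fin 5} : i ∈ pairColours G u v ↔ ({u, v} : Finset (Fin n)) ∈ G i := by
  simp [pairColours]

theorem ne_of_mem_pairColours {n : ℕ} {G : Fin 5 → Finset (Finset (Fin n))}
    (hG : IsMulti5 G) {u v : Fin n} {i : Fin 5} (h : i ∈ pairColours G u v) : u ≠ v := by
  rintro rfl
  simpa using hG i _ (mem_pairColours.1 h)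

theorem mdeg_eq_sum_card_pairColours {n : ℕ} {G : Fin 5 → Finset (Finset (Fin n))}
    (hG : IsMulti5 G) (v : Fin n) : mdeg G v = ∑ u, (pairColours G v u).card := by
  have h : ∀ i, ((G i).filter fun e => v ∈ e).card
      = (Finset.univ.filter fun u => ({v, u} : Finset (Fin n)) ∈ G i).card := by
    intro i
    refine (Finset.card_bij (fun u _ => ({v, u} : Finset (Fin n))) ?_ ?_ ?_).symm
    · intro u hu
      simpa using hu
    · intro u hu w hw huw
      have hu' : v ≠ u := ne_of_mem_pairColours hG (mem_pairColours.2 (Finset.mem_filter.1 hu).2)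
      have : u ∈ ({v, w} : Finset (Fin n)) := huw ▸ by simp
      simp only [Finset.mem_insert, Finset.mem_singleton] at this
      exact this.resolve_left hu'.symm
    · intro e he
      obtain ⟨he, hv⟩ := Finset.mem_filter.1 he
      obtain ⟨a, b, -, rfl⟩ := Finset.card_eq_two.1 (hG i e he)
      simp only [Finset.mem_insert, Finset.mem_singleton] at hv
      obtain rfl | rfl := hv
      · exact ⟨b, by simpa using he, rfl⟩
      · exact ⟨a, by simpa [Finset.pair_comm] using he, Finset.pair_comm _ _⟩
  simp only [mdeg, h, pairColours, Finset.card_filter]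
  exact Finset.sum_comm

theorem isDenseK4Free_pairColours {n : ℕ} {G : Fin 5 → Finset (Finset (Fin n))}
    (hG : IsMulti5 G) (hK4 : ¬ ContainsK4 G)
    (hdeg : ∀ v : Fin n, (44 : ℝ) * n / 13 ≤ (mdeg G v : ℝ)) :
    IsDenseK4Free (pairColours G) where
  symm u v := by simp only [pairColours, Finset.pair_comm]
  irrefl v := Finset.eq_empty_of_forall_notMem fun _ h => ne_of_mem_pairColours hG h rfl
  k4free a b c d i j k hij hik hjk hab hcd hac hbd had hbc :=
    hK4 ⟨i, j, k, a, b, c, d, hij, hik, hjk, ne_of_mem_pairColours hG hab,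
      ne_of_mem_pairColours hG hac, ne_of_mem_pairColours hG had, ne_of_mem_pairColours hG hbc,
      ne_of_mem_pairColours hG hbd, ne_of_mem_pairColours hG hcd, mem_pairColours.1 hab,
      mem_pairColours.1 hcd, mem_pairColours.1 hac, mem_pairColours.1 hbd,
      mem_pairColours.1 had, mem_pairColours.1 hbc⟩
  degree v := by
    have h := hdeg v
    rw [div_le_iff₀ (by norm_num), mul_comm (mdeg G v : ℝ)] at h
    rw [← mdeg_eq_sum_card_pairColours hG, Fintype.card_fin]
    exact_mod_cast h

theorem exists_perm_of_card_eq_two {U : Finset (Fin 5)} (hU : U.card = 2) :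
    ∃ σ : Equiv.Perm (Fin 5), σ 0 ∈ U ∧ σ 1 ∈ U ∧ σ 2 ∉ U ∧ σ 3 ∉ U ∧ σ 4 ∉ U := by
  have hcard : Fintype.card {i : Fin 5 // i ∈ ({0, 1} : Finset (Fin 5))}
      = Fintype.card {i // i ∈ U} := by
    rw [Fintype.card_coe, Fintype.card_coe, hU]
    rfl
  have key := Equiv.extendSubtype_mem (Fintype.equivOfCardEq hcard)
  have key' := Equiv.extendSubtype_not_mem (Fintype.equivOfCardEq hcard)
  exact ⟨_, key 0 (by decide), key 1 (by decide), key' 2 (by decide), key' 3 (by decide),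
    key' 4 (by decide)⟩

/-- Every 𝕂₄-free 5-multigraph on n ≥ 1 vertices with minimum degree
at least 44n/13 admits a nice partition. -/
theorem multigraph_nice_partition (n : ℕ) (hn : 0 < n)
    (G : Fin 5 → Finset (Finset (Fin n))) (hG : IsMulti5 G) (hK4 : ¬ ContainsK4 G)
    (hdeg : ∀ v : Fin n, (44 : ℝ) * n / 13 ≤ (mdeg G v : ℝ)) :
    NicePartition G := by
  have : Nonempty (Fin n) := ⟨⟨0, hn⟩⟩
  obtain ⟨A, U, hU, hin, hout⟩ := (isDenseK4Free_pairColours hG hK4 hdeg).exists_nice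
  obtain ⟨σ, h₀, h₁, h₂, h₃, h₄⟩ := exists_perm_of_card_eq_two hU
  have hA : ∀ i ∉ U, ∀ e ∈ G i, ¬ e ⊆ A := by
    intro i hi e he heA
    obtain ⟨u, v, -, rfl⟩ := Finset.card_eq_two.1 (hG i e he)
    exact hi (hin u (heA (by simp)) v (heA (by simp)) (mem_pairColours.2 he))
  have hAc : ∀ i ∈ U, ∀ e ∈ G i, ¬ e ⊆ Aᶜ := by
    intro i hi e he heA
    obtain ⟨u, v, -, rfl⟩ := Finset.card_eq_two.1 (hG i e he)
    exact Finset.disjoint_left.1 (hout u (heA (by simp)) v (heA (by simp))).1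
      (mem_pairColours.2 he) hi
  exact ⟨A, σ, hAc _ h₀, hAc _ h₁, hA _ h₂, hA _ h₃, hA _ h₄,
    fun u v _ hu hv => (hout u hu v hv).2⟩
end

section
/- Let n be a positive integer and let 𝒢 = (G₁,…,G₅) be a 𝕂₄-free 5-multigraph on n vertices. If δ(𝒢) ≥ 58n/17, then 𝒢 admits a good partition. -/
/-- A partition `V₁ ∪ V₁ᶜ` of the vertex set is *good* if, after some permutation `σ` of
the indices, `G₁[V₂] = G₂[V₂] = G₃[V₁] = G₄[V₁] = G₅[V₁] = G₅[V₂] = ∅` (with `V₂ = V₁ᶜ`). -/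
def GoodPartition {n : ℕ} (G : Fin 5 → Finset (Finset (Fin n))) : Prop :=
  ∃ (V₁ : Finset (Fin n)) (σ : Equiv.Perm (Fin 5)),
    (∀ e ∈ G (σ 0), ¬ e ⊆ V₁ᶜ) ∧ (∀ e ∈ G (σ 1), ¬ e ⊆ V₁ᶜ) ∧
    (∀ e ∈ G (σ 2), ¬ e ⊆ V₁) ∧ (∀ e ∈ G (σ 3), ¬ e ⊆ V₁) ∧
    (∀ e ∈ G (σ 4), ¬ e ⊆ V₁) ∧ (∀ e ∈ G (σ 4), ¬ e ⊆ V₁ᶜ)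

/-- The sizes `x, y, z` do not force three sets of these sizes to have a system of distinct
representatives. -/
def NoRep (x y z : ℕ) : Prop :=
  x = 0 ∨ y = 0 ∨ z = 0 ∨ (x ≤ 1 ∧ y ≤ 1) ∨ (x ≤ 1 ∧ z ≤ 1) ∨ (y ≤ 1 ∧ z ≤ 1) ∨
    (x ≤ 2 ∧ y ≤ 2 ∧ z ≤ 2)

instance (x y z : ℕ) : Decidable (NoRep x y z) := by unfold NoRep; infer_instance

theorem NoRep.mono {x y z x' y' z' : ℕ} (h : NoRep x y z) (hx : x' ≤ x) (hy : y' ≤ y)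
    (hz : z' ≤ z) : NoRep x' y' z' := by
  unfold NoRep at *; omega

/-- A vertex joined with weights `x, y, z` to a triangle `abc` with weights `bc, ac, ab` satisfies
the numerical consequences of being `𝕂₄`-free. -/
def Extends3 (bc ac ab x y z : ℕ) : Prop := NoRep (x + bc - 5) (y + ac - 5) (z + ab - 5)

instance (bc ac ab x y z : ℕ) : Decidable (Extends3 bc ac ab x y z) := by
  unfold Extends3; infer_instance

/-- The numerical consequences of being `𝕂₄`-free for a vertex joined with weights `x, y, z, t` to
four vertices `a, b, c, d` with the given weights. -/
def Extends4 (ab ac ad bc bd cd x y z t : ℕ) : Prop :=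
  Extends3 bc ac ab x y z ∧ Extends3 bd ad ab x y t ∧ Extends3 cd ad ac x z t ∧
    Extends3 cd bd bc y z t

instance (ab ac ad bc bd cd x y z t : ℕ) : Decidable (Extends4 ab ac ad bc bd cd x y z t) := by
  unfold Extends4; infer_instance

/-- The weights `x, y, z` of a triangle are not `5, 5, m'` with `m ≤ m'` in some order. -/
def Flat (m x y z : ℕ) : Prop :=
  ¬ (x = 5 ∧ y = 5 ∧ m ≤ z) ∧ ¬ (x = 5 ∧ z = 5 ∧ m ≤ y) ∧ ¬ (y = 5 ∧ z = 5 ∧ m ≤ x)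

instance (m x y z : ℕ) : Decidable (Flat m x y z) := by unfold Flat; infer_instance

/-- The multiplicities of a `𝕂₄`-free 5-multigraph of large minimum degree. -/
structure DenseWeight {V : Type*} [Fintype V] (w : V → V → ℕ) : Prop where
  symm : ∀ a b, w a b = w b a
  le_five : ∀ a b, w a b < 6
  loop : ∀ a, w a a = 0
  ext : ∀ a b c d, Extends3 (w b c) (w a c) (w a b) (w a d) (w b d) (w c d)
  deg : ∀ v, 58 * Fintype.card V ≤ 17 * ∑ u, w v u

namespace DenseWeight

set_option synthInstance.maxSize 2000

variable {V : Type*} [Fintype V] {w : V → V → ℕ}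

/-- The weight of a pair as an element of `Fin 6`. -/
def fin (h : DenseWeight w) (a b : V) : Fin 6 := ⟨w a b, h.le_five a b⟩

theorem sum_ge (h : DenseWeight w) (L : List (ℕ × V)) :
    ∑ _g : V, 58 * (L.map Prod.fst).sum ≤ ∑ g, 17 * (L.map fun p => p.1 * w p.2 g).sum := by
  induction L with
  | nil => simp
  | cons p L ih =>
    have h1 : p.1 * (58 * Fintype.card V) ≤ p.1 * (17 * ∑ u, w p.2 u) :=
      Nat.mul_le_mul_left _ (h.deg p.2)
    have h2 : ∑ g, 17 * (((p :: L).map fun p => p.1 * w p.2 g).sum) =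
        p.1 * (17 * ∑ u, w p.2 u) + ∑ g, 17 * (L.map fun p => p.1 * w p.2 g).sum := by
      simp only [List.map_cons, List.sum_cons, mul_add, Finset.sum_add_distrib, Finset.mul_sum]
      congr 1
      exact Finset.sum_congr rfl fun _ _ => by ring
    rw [h2]
    simp only [List.map_cons, List.sum_cons, Finset.sum_const, Finset.card_univ, smul_eq_mul]
      at ih ⊢
    linarith

theorem exists_heavy [Nonempty V] (h : DenseWeight w) (L : List (ℕ × V)) :
    ∃ g, 58 * (L.map Prod.fst).sum ≤ 17 * (L.map fun p => p.1 * w p.2 g).sum := by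
  obtain ⟨g, -, hg⟩ := Finset.exists_le_of_sum_le Finset.univ_nonempty (h.sum_ge L)
  exact ⟨g, hg⟩

theorem exists_heavier (h : DenseWeight w) (L : List (ℕ × V)) {g₀ : V}
    (h₀ : 17 * (L.map fun p => p.1 * w p.2 g₀).sum < 58 * (L.map Prod.fst).sum) :
    ∃ g, 58 * (L.map Prod.fst).sum < 17 * (L.map fun p => p.1 * w p.2 g).sum := by
  by_contra! hle
  exact absurd (h.sum_ge L) (not_le.2
    (Finset.sum_lt_sum (fun g _ => hle g) ⟨g₀, Finset.mem_univ _, h₀⟩))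

theorem ext₄ (h : DenseWeight w) (a b c d e : V) :
    Extends4 (w a b) (w a c) (w a d) (w b c) (w b d) (w c d) (w a e) (w b e) (w c e) (w d e) :=
  ⟨h.ext a b c e, h.ext a b d e, h.ext a c d e, h.ext b c d e⟩

theorem exists_heavy_triple [Nonempty V] (h : DenseWeight w) (a b c : V) :
    ∃ g, 11 ≤ w a g + w b g + w c g := by
  obtain ⟨g, hg⟩ := h.exists_heavy [(1, a), (1, b), (1, c)]
  simp only [List.map_cons, List.map_nil, List.sum_cons, List.sum_nil] at hg
  exact ⟨g, by omega⟩

theorem exists_heavy_quadruple [Nonempty V] (h : DenseWeight w) (a b c d : V) :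
    ∃ g, 14 ≤ w a g + w b g + w c g + w d g := by
  obtain ⟨g, hg⟩ := h.exists_heavy [(1, a), (1, b), (1, c), (1, d)]
  simp only [List.map_cons, List.map_nil, List.sum_cons, List.sum_nil] at hg
  exact ⟨g, by omega⟩

theorem exists_heavy_quintuple [Nonempty V] (h : DenseWeight w) (a b c d e : V) :
    ∃ g, 45 ≤ 3 * (w a g + w b g + w c g + w d g) + w e g := by
  obtain ⟨g, hg⟩ := h.exists_heavy [(3, a), (3, b), (3, c), (3, d), (1, e)]
  simp only [List.map_cons, List.map_nil, List.sum_cons, List.sum_nil] at hg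
  exact ⟨g, by omega⟩

theorem flat (h : DenseWeight w) {m : ℕ}
    (hm : ∀ {a b c}, w a b = 5 → w a c = 5 → w b c < m) (a b c : V) :
    Flat m (w a b) (w a c) (w b c) := by
  refine ⟨fun ⟨h₁, h₂, h₃⟩ => ?_, fun ⟨h₁, h₂, h₃⟩ => ?_, fun ⟨h₁, h₂, h₃⟩ => ?_⟩
  · exact absurd (hm h₁ h₂) (not_lt.2 h₃)
  · exact absurd (hm ((h.symm b a).trans h₁) h₂) (not_lt.2 h₃)
  · exact absurd (hm ((h.symm c a).trans h₁) ((h.symm c b).trans h₂)) (not_lt.2 h₃)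

theorem lt_five_of_five_five [Nonempty V] (h : DenseWeight w) {a b c : V}
    (hab : w a b = 5) (hac : w a c = 5) : w b c < 5 := by
  by_contra! hlt
  have hbc : w b c = 5 := by have := h.le_five b c; omega
  obtain ⟨g, hg⟩ := h.exists_heavy_triple a b c
  have e := h.ext a b c g
  rw [hab, hac, hbc] at e
  have key : ∀ x y z : Fin 6, Extends3 5 5 5 x y z → ¬ 11 ≤ x.1 + y + z := by decide
  exact key (h.fin a g) (h.fin b g) (h.fin c g) e hg

theorem lt_four_of_five_five [Nonempty V] (h : DenseWeight w) {a b c : V}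
    (hab : w a b = 5) (hac : w a c = 5) : w b c < 4 := by
  by_contra! hlt
  have hflat := h.flat h.lt_five_of_five_five
  have hbc : w b c = 4 := by have := h.lt_five_of_five_five hab hac; omega
  obtain ⟨d, hd⟩ := h.exists_heavy_triple a b c
  obtain ⟨had, hbd, hcd⟩ : w a d = 1 ∧ w b d = 5 ∧ w c d = 5 := by
    have key : ∀ x y z : Fin 6, Extends3 4 5 5 x y z → 11 ≤ x.1 + y + z →
        Flat 5 5 x y → Flat 5 5 x z → x.1 = 1 ∧ y.1 = 5 ∧ z.1 = 5 := by decide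
    have e := h.ext a b c d
    have f₁ := hflat a b d
    have f₂ := hflat a c d
    rw [hab, hac, hbc] at e
    rw [hab] at f₁
    rw [hac] at f₂
    exact key (h.fin a d) (h.fin b d) (h.fin c d) e hd f₁ f₂
  obtain ⟨g, hg⟩ := h.exists_heavy [(2, a), (2, b), (2, c), (1, d)]
  simp only [List.map_cons, List.map_nil, List.sum_cons, List.sum_nil] at hg
  have e := h.ext₄ a b c d g
  have f₁ := hflat a b g
  have f₂ := hflat a c g
  rw [hab, hac, had, hbc, hbd, hcd] at e
  rw [hab] at f₁
  rw [hac] at f₂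
  have key : ∀ x y z t : Fin 6, Extends4 5 5 1 4 5 5 x y z t →
      Flat 5 5 x y → Flat 5 5 x z → 2 * x.1 + 2 * y + 2 * z + t ≤ 23 := by decide +kernel
  have : 2 * w a g + 2 * w b g + 2 * w c g + w d g ≤ 23 :=
    key (h.fin a g) (h.fin b g) (h.fin c g) (h.fin d g) e f₁ f₂
  omega

theorem lt_three_of_five_five [Nonempty V] (h : DenseWeight w) {a b c : V}
    (hab : w a b = 5) (hac : w a c = 5) : w b c < 3 := by
  by_contra! hlt
  have hflat := h.flat h.lt_four_of_five_five
  have hbc : w b c = 3 := by have := h.lt_four_of_five_five hab hac; omega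
  have improve : ∀ d, 11 ≤ w a d + w b d + w c d → ∀ e,
      14 ≤ w a e + w b e + w c e + w d e → w a e = 2 ∧ w b e = 5 ∧ w c e = 5 ∧ w d e = 2 := by
    intro d hd e he
    have hq := h.ext₄ a b c d e
    have ht := h.ext a b c d
    have f₁ := hflat a b e
    have f₂ := hflat a c e
    have f₄ := hflat b d e
    have f₅ := hflat c d e
    rw [hab, hac, hbc] at hq ht
    rw [hab] at f₁
    rw [hac] at f₂
    have key₁ : ∀ x y z : Fin 6, Extends3 3 5 5 x y z → 11 ≤ x.1 + y + z →
        (x.1, y.1, z.1) ∈ [(1, 5, 5), (2, 4, 5), (2, 5, 4), (2, 5, 5)] := by decide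
    have key₂ : ∀ p ∈ [(1, 5, 5), (2, 4, 5), (2, 5, 4), (2, 5, 5)],
        ∀ x y z t : Fin 6, 14 ≤ x.1 + y + z + t →
        Flat 4 5 x y → Flat 4 5 x z → Flat 4 p.2.1 y t → Flat 4 p.2.2 z t →
        Extends4 5 5 p.1 3 p.2.1 p.2.2 x y z t →
        x.1 = 2 ∧ y.1 = 5 ∧ z.1 = 5 ∧ t.1 = 2 := by decide +kernel
    exact key₂ _ (key₁ (h.fin a d) (h.fin b d) (h.fin c d) ht hd)
      (h.fin a e) (h.fin b e) (h.fin c e) (h.fin d e) he f₁ f₂ f₄ f₅ hq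
  obtain ⟨d₀, hd₀⟩ := h.exists_heavy_triple a b c
  obtain ⟨d, hd⟩ := h.exists_heavy_quadruple a b c d₀
  obtain ⟨had, hbd, hcd, -⟩ := improve d₀ hd₀ d hd
  obtain ⟨e, he⟩ := h.exists_heavy_quadruple a b c d
  obtain ⟨hae, hbe, hce, hde⟩ := improve d (by omega) e he
  obtain ⟨g, hg⟩ := h.exists_heavy_quintuple a b c d e
  have hq := h.ext₄ a b c d g
  have ht := h.ext b c e g
  have f₁ := hflat a b g
  have f₂ := hflat a c g
  rw [hab, hac, had, hbc, hbd, hcd] at hq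
  rw [hbc, hbe, hce] at ht
  rw [hab] at f₁
  rw [hac] at f₂
  have key₁ : ∀ x y z t : Fin 6, 14 ≤ x.1 + y + z + t → Flat 4 5 x y →
      Flat 4 5 x z → Extends4 5 5 2 3 5 5 x y z t → x.1 + y + z + t = 14 ∧ y.1 = 5 ∧ z.1 = 5 := by
    decide +kernel
  have key₂ : ∀ s : Fin 6, Extends3 5 5 3 5 5 s → s.1 ≤ 2 := by decide
  have hs := h.le_five e g
  obtain ⟨h14, hbg, hcg⟩ : w a g + w b g + w c g + w d g = 14 ∧ w b g = 5 ∧ w c g = 5 :=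
    key₁ (h.fin a g) (h.fin b g) (h.fin c g) (h.fin d g)
      (by change 14 ≤ w a g + w b g + w c g + w d g; omega) f₁ f₂ hq
  rw [hbg, hcg] at ht
  have : w e g ≤ 2 := key₂ (h.fin e g) ht
  omega

theorem exists_seed_of_five_five_two [Nonempty V] (h : DenseWeight w) {a b c : V}
    (hab : w a b = 5) (hac : w a c = 5) (hbc : w b c = 2) :
    ∃ a b c d, w a b = 2 ∧ w c d = 2 ∧ w a c = 5 ∧ w a d = 5 ∧ w b c = 5 ∧ w b d = 5 := by
  by_contra! hno
  have hflat := h.flat h.lt_three_of_five_five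
  have hno' : ∀ d, w a d = 2 → w b d = 5 → w c d ≠ 5 := fun d had hbd hcd =>
    hno a d b c had hbc hab hac ((h.symm _ _).trans hbd) ((h.symm _ _).trans hcd)
  have no_344 : ∀ d, w a d = 3 → w b d = 4 → w c d ≠ 4 := by
    intro d had hbd hcd
    obtain ⟨e, he⟩ := h.exists_heavy_quadruple a b c d
    obtain ⟨hae, hbe, hce, hde⟩ : w a e = 1 ∧ w b e = 5 ∧ w c e = 5 ∧ w d e = 3 := by
      have key : ∀ x y z t : Fin 6, 14 ≤ x.1 + y + z + t → Flat 3 5 x y → Flat 3 5 x z →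
          Flat 3 3 x t → Extends4 5 5 3 2 4 4 x y z t → x.1 = 1 ∧ y.1 = 5 ∧ z.1 = 5 ∧ t.1 = 3 := by
        decide +kernel
      have hq := h.ext₄ a b c d e
      have f₁ := hflat a b e
      have f₂ := hflat a c e
      have f₃ := hflat a d e
      rw [hab, hac, had, hbc, hbd, hcd] at hq
      rw [hab] at f₁
      rw [hac] at f₂
      rw [had] at f₃
      exact key (h.fin a e) (h.fin b e) (h.fin c e) (h.fin d e) he f₁ f₂ f₃ hq
    obtain ⟨g, hg⟩ := h.exists_heavy [(2, a), (3, b), (3, c), (2, d), (2, e)]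
    simp only [List.map_cons, List.map_nil, List.sum_cons, List.sum_nil] at hg
    have key : ∀ x y z t s : Fin 6, 41 ≤ 2 * x.1 + 3 * y + 3 * z + 2 * t + 2 * s →
        Flat 3 3 x t → Extends4 5 5 3 2 4 4 x y z t → Extends4 5 5 1 2 5 5 x y z s →
        ¬ Extends4 2 4 5 4 5 3 y z t s := by
      decide +kernel
    have hq₁ := h.ext₄ a b c d g
    have hq₂ := h.ext₄ a b c e g
    have hq₃ := h.ext₄ b c d e g
    have f := hflat a d g
    rw [hab, hac, had, hbc, hbd, hcd] at hq₁
    rw [hab, hac, hae, hbc, hbe, hce] at hq₂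
    rw [hbc, hbd, hbe, hcd, hce, hde] at hq₃
    rw [had] at f
    exact key (h.fin a g) (h.fin b g) (h.fin c g) (h.fin d g) (h.fin e g)
      (by change 41 ≤ 2 * w a g + 3 * w b g + 3 * w c g + 2 * w d g + 2 * w e g; omega)
      f hq₁ hq₂ hq₃
  obtain ⟨d, hd⟩ := h.exists_heavy_triple a b c
  obtain ⟨e, he⟩ := h.exists_heavy_quadruple a b c d
  have hdcase : (w a d, w b d, w c d) ∈ [(1, 5, 5), (2, 4, 5), (2, 5, 4)] := by
    have key : ∀ x y z : Fin 6, 11 ≤ x.1 + y + z → Flat 3 5 x y → Flat 3 5 x z →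
        Extends3 2 5 5 x y z → (x.1 = 2 → y.1 = 5 → z.1 ≠ 5) → (x.1 = 3 → y.1 = 4 → z.1 ≠ 4) →
        (x.1, y.1, z.1) ∈ [(1, 5, 5), (2, 4, 5), (2, 5, 4)] := by
      decide +kernel
    have hq := h.ext a b c d
    have f₁ := hflat a b d
    have f₂ := hflat a c d
    rw [hab, hac, hbc] at hq
    rw [hab] at f₁
    rw [hac] at f₂
    exact key (h.fin a d) (h.fin b d) (h.fin c d) hd f₁ f₂ hq (hno' d) (no_344 d)
  obtain ⟨hae, hbe, hce, hde⟩ : w a e = 5 ∧ w b e = 2 ∧ w c e = 2 ∧ w d e = 5 := by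
    have key : ∀ p ∈ [(1, 5, 5), (2, 4, 5), (2, 5, 4)], ∀ x y z t : Fin 6,
        14 ≤ x.1 + y + z + t → Flat 3 5 x y → Flat 3 5 x z → Flat 3 p.2.1 y t →
        Flat 3 p.2.2 z t → Extends4 5 5 p.1 2 p.2.1 p.2.2 x y z t →
        (x.1 = 2 → y.1 = 5 → z.1 ≠ 5) → (x.1 = 3 → y.1 = 4 → z.1 ≠ 4) →
        x.1 = 5 ∧ y.1 = 2 ∧ z.1 = 2 ∧ t.1 = 5 := by
      decide +kernel
    have hq := h.ext₄ a b c d e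
    have f₁ := hflat a b e
    have f₂ := hflat a c e
    have f₃ := hflat b d e
    have f₄ := hflat c d e
    rw [hab, hac, hbc] at hq
    rw [hab] at f₁
    rw [hac] at f₂
    exact key _ hdcase (h.fin a e) (h.fin b e) (h.fin c e) (h.fin d e) he f₁ f₂ f₃ f₄ hq
      (hno' e) (no_344 e)
  simp only [List.mem_cons, Prod.mk.injEq, List.not_mem_nil, or_false] at hdcase
  rcases hdcase with ⟨had, hbd, hcd⟩ | ⟨had, hbd, hcd⟩ | ⟨had, hbd, hcd⟩
  · obtain ⟨g, hg⟩ := h.exists_heavy_quintuple a b c d e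
    have key₁ : ∀ x y z t : Fin 6, 14 ≤ x.1 + y + z + t → Flat 3 5 x y → Flat 3 5 x z →
        Flat 3 5 y t → Flat 3 5 z t → Extends4 5 5 1 2 5 5 x y z t →
        (x.1 = 2 → y.1 = 5 → z.1 ≠ 5) → (x.1 = 3 → y.1 = 4 → z.1 ≠ 4) →
        x.1 = 5 ∧ y.1 = 2 ∧ z.1 = 2 ∧ t.1 = 5 := by
      decide +kernel
    have key₂ : ∀ s : Fin 6, Extends3 2 5 5 5 2 s → s.1 ≤ 2 := by decide
    have hq := h.ext₄ a b c d g
    have ht := h.ext a b e g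
    have f₁ := hflat a b g
    have f₂ := hflat a c g
    have f₃ := hflat b d g
    have f₄ := hflat c d g
    rw [hab, hac, had, hbc, hbd, hcd] at hq
    rw [hab, hae, hbe] at ht
    rw [hab] at f₁
    rw [hac] at f₂
    rw [hbd] at f₃
    rw [hcd] at f₄
    have hs := h.le_five e g
    obtain ⟨hag, hbg, hcg, hdg⟩ : w a g = 5 ∧ w b g = 2 ∧ w c g = 2 ∧ w d g = 5 :=
      key₁ (h.fin a g) (h.fin b g) (h.fin c g) (h.fin d g)
        (by change 14 ≤ w a g + w b g + w c g + w d g; omega) f₁ f₂ f₃ f₄ hq (hno' g) (no_344 g)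
    rw [hag, hbg] at ht
    have : w e g ≤ 2 := key₂ (h.fin e g) ht
    omega
  · exact hno a d e c had ((h.symm e c).trans hce) hae hac hde ((h.symm d c).trans hcd)
  · exact hno a d e b had ((h.symm e b).trans hbe) hae hab hde ((h.symm d b).trans hbd)

theorem exists_seed [Nonempty V] (h : DenseWeight w) :
    ∃ a b c d, w a b = 2 ∧ w c d = 2 ∧ w a c = 5 ∧ w a d = 5 ∧ w b c = 5 ∧ w b d = 5 := by
  by_contra! hno
  have hlt : ∀ {a b c}, w a b = 5 → w a c = 5 → w b c < 2 := by
    intro a b c hab hac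
    have := h.lt_three_of_five_five hab hac
    by_contra! hle
    obtain ⟨a, b, c, d, h₁, h₂, h₃, h₄, h₅, h₆⟩ :=
      h.exists_seed_of_five_five_two hab hac (by omega)
    exact hno a b c d h₁ h₂ h₃ h₄ h₅ h₆
  have hflat := h.flat hlt
  have no_five : ∀ a b, w a b ≠ 5 := by
    intro a b hab
    obtain ⟨c, hc⟩ := h.exists_heavy [(1, a), (1, b)]
    simp only [List.map_cons, List.map_nil, List.sum_cons, List.sum_nil] at hc
    obtain ⟨d, hd⟩ := h.exists_heavy_triple a b c
    obtain ⟨e, he⟩ := h.exists_heavy_quadruple a b c d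
    have key₁ : ∀ x y : Fin 6, 7 ≤ x.1 + y → Flat 2 5 x y →
        (x.1, y.1) ∈ [(3, 4), (4, 3), (4, 4)] := by
      decide
    have key₂ : ∀ p ∈ [(3, 4), (4, 3), (4, 4)], ∀ x y z : Fin 6, 11 ≤ x.1 + y + z →
        Flat 2 5 x y → Flat 2 p.1 x z → Flat 2 p.2 y z → Extends3 p.2 p.1 5 x y z →
        (p, x.1, y.1, z.1) ∈ [((3, 4), 4, 2, 5), ((4, 3), 2, 4, 5)] := by
      decide +kernel
    have key₃ : ∀ q ∈ [((3, 4), 4, 2, 5), ((4, 3), 2, 4, 5)], ∀ x y z t : Fin 6,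
        14 ≤ x.1 + y + z + t → Flat 2 5 x y → Flat 2 q.2.2.2 z t →
        ¬ Extends4 5 q.1.1 q.2.1 q.1.2 q.2.2.1 q.2.2.2 x y z t := by
      decide +kernel
    have f₁ := hflat a b c
    have f₂ := hflat a b d
    have f₃ := hflat a b e
    have hd' := h.ext a b c d
    have he' := h.ext₄ a b c d e
    rw [hab] at f₁ f₂ f₃ hd' he'
    have hp := key₁ (h.fin a c) (h.fin b c) (by change 7 ≤ w a c + w b c; omega) f₁
    have hq := key₂ _ hp (h.fin a d) (h.fin b d) (h.fin c d) hd f₂ (hflat a c d) (hflat b c d) hd'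
    exact key₃ _ hq (h.fin a e) (h.fin b e) (h.fin c e) (h.fin d e) he f₃ (hflat c d e) he'
  obtain ⟨a⟩ := ‹Nonempty V›
  obtain ⟨b, hb⟩ := h.exists_heavy [(1, a)]
  obtain ⟨c, hc⟩ := h.exists_heavy [(1, a), (1, b)]
  simp only [List.map_cons, List.map_nil, List.sum_cons, List.sum_nil] at hb hc
  obtain ⟨d, hd⟩ := h.exists_heavy_triple a b c
  have key : ∀ p q r x y z : Fin 5, 4 ≤ p.1 → 7 ≤ q.1 + r → 11 ≤ x.1 + y + z →
      ¬ Extends3 r q p x y z := by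
    decide +kernel
  have hlt : ∀ u v, w u v < 5 := fun u v =>
    lt_of_le_of_ne (Nat.lt_succ_iff.1 (h.le_five u v)) (no_five u v)
  exact key ⟨_, hlt a b⟩ ⟨_, hlt a c⟩ ⟨_, hlt b c⟩ ⟨_, hlt a d⟩ ⟨_, hlt b d⟩ ⟨_, hlt c d⟩
    (by change 4 ≤ w a b; omega) (by change 7 ≤ w a c + w b c; omega) hd (h.ext a b c d)

end DenseWeight

/-- The edge colours of a `𝕂₄`-free 5-multigraph of large minimum degree. -/
structure DenseColoring {V : Type*} [Fintype V] (col : V → V → Finset (Fin 5)) : Prop where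
  symm : ∀ a b, col a b = col b a
  loop : ∀ a, col a a = ∅
  free : ∀ a b c d i j k, i ≠ j → i ≠ k → j ≠ k → i ∈ col a b → i ∈ col c d → j ∈ col a c →
    j ∈ col b d → k ∈ col a d → k ∉ col b c
  deg : ∀ v, 58 * Fintype.card V ≤ 17 * ∑ u, (col v u).card

theorem exists_rep_of_card_le {α : Type*} [DecidableEq α] {X Y Z : Finset α} (hX : 1 ≤ X.card)
    (hY : 2 ≤ Y.card) (hZ : 3 ≤ Z.card) :
    ∃ x ∈ X, ∃ y ∈ Y, ∃ z ∈ Z, x ≠ y ∧ x ≠ z ∧ y ≠ z := by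
  obtain ⟨x, hx⟩ := Finset.card_pos.1 hX
  obtain ⟨y, hy, hyx⟩ := Finset.exists_mem_ne hY x
  obtain ⟨z, hz, hz'⟩ : ∃ z ∈ Z, z ∉ ({x, y} : Finset α) := by
    by_contra! hsub
    have := Finset.card_le_card (show Z ⊆ {x, y} from hsub)
    have := Finset.card_le_two (a := x) (b := y)
    omega
  simp only [Finset.mem_insert, Finset.mem_singleton, not_or] at hz'
  exact ⟨x, hx, y, hy, z, hz, hyx.symm, Ne.symm hz'.1, Ne.symm hz'.2⟩

theorem noRep_card {α : Type*} [DecidableEq α] {X Y Z : Finset α}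
    (h : ∀ x ∈ X, ∀ y ∈ Y, ∀ z ∈ Z, x ≠ y → x ≠ z → y = z) : NoRep X.card Y.card Z.card := by
  by_contra hno
  have hcase : (1 ≤ X.card ∧ 2 ≤ Y.card ∧ 3 ≤ Z.card) ∨ (1 ≤ X.card ∧ 2 ≤ Z.card ∧ 3 ≤ Y.card) ∨
      (1 ≤ Y.card ∧ 2 ≤ X.card ∧ 3 ≤ Z.card) ∨ (1 ≤ Y.card ∧ 2 ≤ Z.card ∧ 3 ≤ X.card) ∨
      (1 ≤ Z.card ∧ 2 ≤ X.card ∧ 3 ≤ Y.card) ∨ (1 ≤ Z.card ∧ 2 ≤ Y.card ∧ 3 ≤ X.card) := by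
    unfold NoRep at hno; omega
  rcases hcase with h' | h' | h' | h' | h' | h' <;>
    obtain ⟨x, hx, y, hy, z, hz, hxy, hxz, hyz⟩ := exists_rep_of_card_le h'.1 h'.2.1 h'.2.2 <;>
    grind

theorem subset_of_no_rep {α : Type*} [DecidableEq α] {P A B : Finset α} (hP : 2 ≤ P.card)
    (hB : B.Nonempty) (hAB : 3 ≤ A.card + B.card)
    (h : ∀ x ∈ P, ∀ y ∈ A, ∀ z ∈ B, x ≠ y → x ≠ z → y = z) : A ⊆ P := by
  intro a ha
  by_contra haP
  by_cases hb : ∃ b ∈ B, b ≠ a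
  · obtain ⟨b, hb, hba⟩ := hb
    obtain ⟨p, hp, hpb⟩ := Finset.exists_mem_ne hP b
    exact hba (h p hp a ha b hb (fun hpa => haP (hpa ▸ hp)) hpb).symm
  · push Not at hb
    obtain ⟨b, hbB⟩ := hB
    have hcard : B.card ≤ 1 := Finset.card_le_one.2 fun x hx y hy => (hb x hx).trans (hb y hy).symm
    obtain ⟨a', ha', hne⟩ := Finset.exists_mem_ne (s := A) (by omega) a
    obtain ⟨p, hp, hpa'⟩ := Finset.exists_mem_ne hP a'
    have hba := hb b hbB
    subst hba
    exact hne (h p hp a' ha' b hbB hpa' (fun hpb => haP (hpb ▸ hp)))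

theorem subset_of_no_rep' {α : Type*} [DecidableEq α] {X P : Finset α} (hP : 2 ≤ P.card)
    (h : ∀ x ∈ X, ∀ y ∈ P, ∀ z ∈ P, x ≠ y → x ≠ z → y = z) : X ⊆ P := by
  intro x hx
  by_contra hxP
  obtain ⟨p, hp, q, hq, hpq⟩ := Finset.one_lt_card.1 hP
  exact hpq (h x hx p hp q hq (fun hxp => hxP (hxp ▸ hp)) (fun hxq => hxP (hxq ▸ hq)))

/-- Vertices `a, b, c, d` with maximal possible total multiplicity: the pairs `ab` and `cd` carry
the disjoint colour pairs `P₁` and `P₂`, all other pairs carry all five colours. -/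
structure Seed {V : Type*} (col : V → V → Finset (Fin 5)) (P₁ P₂ : Finset (Fin 5)) (a b c d : V) :
    Prop where
  ab : col a b = P₁
  cd : col c d = P₂
  ac : col a c = Finset.univ
  ad : col a d = Finset.univ
  bc : col b c = Finset.univ
  bd : col b d = Finset.univ
  card₁ : P₁.card = 2
  card₂ : P₂.card = 2
  disj : Disjoint P₁ P₂

namespace DenseColoring

variable {V : Type*} [Fintype V] {col : V → V → Finset (Fin 5)} {P₁ P₂ : Finset (Fin 5)}
  {a b c d : V}

theorem no_rep (h : DenseColoring col) (a b c d : V) :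
    ∀ i ∈ col a b ∩ col c d, ∀ j ∈ col a c ∩ col b d, ∀ k ∈ col a d ∩ col b c,
      i ≠ j → i ≠ k → j = k := by
  intro i hi j hj k hk hij hik
  simp only [Finset.mem_inter] at hi hj hk
  by_contra hjk
  exact h.free a b c d i j k hij hik hjk hi.1 hi.2 hj.1 hj.2 hk.1 hk.2

theorem card_add_sub_le (X Y : Finset (Fin 5)) : X.card + Y.card - 5 ≤ (X ∩ Y).card := by
  have h₁ := Finset.card_union_add_card_inter X Y
  have h₂ := Finset.card_le_univ (X ∪ Y)
  rw [Fintype.card_fin] at h₂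
  omega

theorem denseWeight (h : DenseColoring col) : DenseWeight fun a b => (col a b).card where
  symm a b := by rw [h.symm]
  le_five a b := Nat.lt_succ_iff.2 ((Finset.card_le_univ _).trans_eq (Fintype.card_fin 5))
  loop a := by simp [h.loop]
  ext a b c d := by
    have := noRep_card (h.no_rep d a b c)
    rw [h.symm d a, h.symm d b, h.symm d c] at this
    exact this.mono (card_add_sub_le _ _) (card_add_sub_le _ _) (card_add_sub_le _ _)
  deg := h.deg

end DenseColoring

namespace Seed

variable {V : Type*} [Fintype V] {col : V → V → Finset (Fin 5)} {P₁ P₂ : Finset (Fin 5)}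
  {a b c d e g : V}

theorem flip (h : DenseColoring col) (s : Seed col P₁ P₂ a b c d) : Seed col P₂ P₁ c d a b where
  ab := s.cd
  cd := s.ab
  ac := (h.symm _ _).trans s.ac
  ad := (h.symm _ _).trans s.bc
  bc := (h.symm _ _).trans s.ad
  bd := (h.symm _ _).trans s.bd
  card₁ := s.card₂
  card₂ := s.card₁
  disj := s.disj.symm

theorem swap_left (h : DenseColoring col) (s : Seed col P₁ P₂ a b c d) :
    Seed col P₁ P₂ b a c d where
  ab := (h.symm _ _).trans s.ab
  cd := s.cd
  ac := s.bc
  ad := s.bd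
  bc := s.ac
  bd := s.ad
  card₁ := s.card₁
  card₂ := s.card₂
  disj := s.disj

theorem swap_right (h : DenseColoring col) (s : Seed col P₁ P₂ a b c d) :
    Seed col P₁ P₂ a b d c :=
  ((s.flip h).swap_left h).flip h

end Seed

theorem DenseColoring.exists_seed {V : Type*} [Fintype V] [Nonempty V]
    {col : V → V → Finset (Fin 5)} (h : DenseColoring col) :
    ∃ P₁ P₂ a b c d, Seed col P₁ P₂ a b c d := by
  obtain ⟨a, b, c, d, hab, hcd, hac, had, hbc, hbd⟩ := h.denseWeight.exists_seed
  have huniv : ∀ {X : Finset (Fin 5)}, X.card = 5 → X = Finset.univ := fun {X} hX =>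
    (Finset.card_eq_iff_eq_univ X).1 (hX.trans (Fintype.card_fin 5).symm)
  refine ⟨col a b, col c d, a, b, c, d, rfl, rfl, huniv hac, huniv had, huniv hbc, huniv hbd,
    hab, hcd, Finset.disjoint_left.2 fun i hi hi' => ?_⟩
  have hrep := noRep_card (h.no_rep a b c d)
  rw [huniv hac, huniv had, huniv hbc, huniv hbd] at hrep
  have : 0 < (col a b ∩ col c d).card := Finset.card_pos.2 ⟨i, Finset.mem_inter.2 ⟨hi, hi'⟩⟩
  simp only [Finset.inter_self, Finset.card_univ, Fintype.card_fin] at hrep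
  unfold NoRep at hrep
  omega

/-- The numerical consequences of `𝕂₄`-freeness for the multiplicities `x, y, z, t` between a vertex
and the four vertices of a seed. -/
def SeedProfile (x y z t : ℕ) : Prop :=
  Extends4 2 5 5 5 5 2 x y z t ∧ Flat 3 5 x z ∧ Flat 3 5 x t ∧ Flat 3 5 y z ∧ Flat 3 5 y t

instance (x y z t : ℕ) : Decidable (SeedProfile x y z t) := by unfold SeedProfile; infer_instance

namespace Seed

variable {V : Type*} [Fintype V] {col : V → V → Finset (Fin 5)} {P₁ P₂ : Finset (Fin 5)}
  {a b c d e g : V}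

theorem profile [Nonempty V] (h : DenseColoring col) (s : Seed col P₁ P₂ a b c d) (e : V) :
    SeedProfile (col a e).card (col b e).card (col c e).card (col d e).card := by
  have hflat := h.denseWeight.flat h.denseWeight.lt_three_of_five_five
  have hq := h.denseWeight.ext₄ a b c d e
  have f₁ := hflat a c e
  have f₂ := hflat a d e
  have f₃ := hflat b c e
  have f₄ := hflat b d e
  simp only [s.ab, s.cd, s.ac, s.ad, s.bc, s.bd, s.card₁, s.card₂, Finset.card_univ,
    Fintype.card_fin] at hq f₁ f₂ f₃ f₄
  exact ⟨hq, f₁, f₂, f₃, f₄⟩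

theorem sum_le [Nonempty V] (h : DenseColoring col) (s : Seed col P₁ P₂ a b c d) (e : V) :
    (col a e).card + (col b e).card + (col c e).card + (col d e).card ≤ 14 := by
  have key : ∀ x y z t : Fin 6, SeedProfile x y z t → x.1 + y + z + t ≤ 14 := by decide +kernel
  exact key (h.denseWeight.fin a e) (h.denseWeight.fin b e) (h.denseWeight.fin c e)
    (h.denseWeight.fin d e) (s.profile h e)

theorem le_two_of_thirteen_le [Nonempty V] (h : DenseColoring col) (s : Seed col P₁ P₂ a b c d)
    (he : 13 ≤ (col a e).card + (col b e).card + (col c e).card + (col d e).card) :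
    (col a e).card ≤ 2 ∧ (col b e).card ≤ 2 ∨ (col c e).card ≤ 2 ∧ (col d e).card ≤ 2 := by
  have key : ∀ x y z t : Fin 6, SeedProfile x y z t → 13 ≤ x.1 + y + z + t →
      x.1 ≤ 2 ∧ y.1 ≤ 2 ∨ z.1 ≤ 2 ∧ t.1 ≤ 2 := by decide +kernel
  exact key (h.denseWeight.fin a e) (h.denseWeight.fin b e) (h.denseWeight.fin c e)
    (h.denseWeight.fin d e) (s.profile h e) he

theorem card_le_five (X : Finset (Fin 5)) : X.card ≤ 5 :=
  (Finset.card_le_univ X).trans_eq (Fintype.card_fin 5)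

theorem eq_univ {X : Finset (Fin 5)} (hX : X.card = 5) : X = Finset.univ :=
  (Finset.card_eq_iff_eq_univ X).1 (hX.trans (Fintype.card_fin 5).symm)

theorem subset_of_le_two (h : DenseColoring col) (s : Seed col P₁ P₂ a b c d)
    (hae : (col a e).card ≤ 2) (hbe : (col b e).card ≤ 2)
    (he : 13 ≤ (col a e).card + (col b e).card + (col c e).card + (col d e).card) :
    col a e ⊆ P₁ ∧ col b e ⊆ P₁ := by
  wlog hd : (col d e).card = 5 generalizing c d
  · have hc₅ := card_le_five (col c e)
    have hd₅ := card_le_five (col d e)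
    exact this (s.swap_right h) (by omega) (by omega)
  have hrep := h.no_rep a b d e
  rw [s.ab, s.ad, s.bd, h.symm d e, eq_univ ((congrArg _ (h.symm e d)).trans hd)] at hrep
  simp only [Finset.inter_univ, Finset.univ_inter] at hrep
  have := card_le_five (col c e)
  constructor
  · exact subset_of_no_rep s.card₁.ge (B := col b e) (Finset.card_pos.1 (by omega))
      (by omega) fun x hx y hy z hz hxy hxz => (hrep x hx z hz y hy hxz hxy).symm
  · exact subset_of_no_rep s.card₁.ge (B := col a e) (Finset.card_pos.1 (by omega))
      (by omega) hrep

theorem subset_or_subset [Nonempty V] (h : DenseColoring col) (s : Seed col P₁ P₂ a b c d)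
    (he : 13 ≤ (col a e).card + (col b e).card + (col c e).card + (col d e).card) :
    col a e ⊆ P₁ ∧ col b e ⊆ P₁ ∨ col c e ⊆ P₂ ∧ col d e ⊆ P₂ := by
  obtain ⟨ha, hb⟩ | ⟨hc, hd⟩ := s.le_two_of_thirteen_le h he
  · exact .inl (s.subset_of_le_two h ha hb he)
  · exact .inr ((s.flip h).subset_of_le_two h hc hd (by omega))

/-- A vertex that can replace both `a` and `b` in the seed `a, b, c, d`. -/
structure Twin (col : V → V → Finset (Fin 5)) (P₁ P₂ : Finset (Fin 5)) (a b c d e : V) :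
    Prop where
  left : Seed col P₁ P₂ e b c d
  right : Seed col P₁ P₂ a e c d

theorem twin_of_subset (h : DenseColoring col) (s : Seed col P₁ P₂ a b c d)
    (ha : col a e ⊆ P₁) (hb : col b e ⊆ P₁)
    (he : 14 ≤ (col a e).card + (col b e).card + (col c e).card + (col d e).card) :
    Twin col P₁ P₂ a b c d e := by
  have h₁ := s.card₁
  have hac := Finset.card_le_card ha
  have hbc := Finset.card_le_card hb
  have hc₅ := card_le_five (col c e)
  have hd₅ := card_le_five (col d e)
  have ha' : col a e = P₁ := Finset.eq_of_subset_of_card_le ha (by omega)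
  have hb' : col b e = P₁ := Finset.eq_of_subset_of_card_le hb (by omega)
  have hc' : col c e = Finset.univ := eq_univ (by omega)
  have hd' : col d e = Finset.univ := eq_univ (by omega)
  exact ⟨{ s with
      ab := (h.symm _ _).trans hb'
      ac := (h.symm _ _).trans hc'
      ad := (h.symm _ _).trans hd' }, { s with
      ab := ha'
      bc := (h.symm _ _).trans hc'
      bd := (h.symm _ _).trans hd' }⟩

theorem twin_or_twin [Nonempty V] (h : DenseColoring col) (s : Seed col P₁ P₂ a b c d)
    (he : 14 ≤ (col a e).card + (col b e).card + (col c e).card + (col d e).card) :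
    Twin col P₁ P₂ a b c d e ∨ Twin col P₂ P₁ c d a b e := by
  obtain ⟨ha, hb⟩ | ⟨hc, hd⟩ := s.subset_or_subset (e := e) h (by omega)
  · exact .inl (s.twin_of_subset h ha hb he)
  · exact .inr ((s.flip h).twin_of_subset h hc hd (by omega))

/-- Two vertices that are twins for the same seed are joined by colours of its first pair only. -/
theorem Twin.subset (h : DenseColoring col) (hP : P₁.card = 2) (he : Twin col P₁ P₂ a b c d e)
    (hg : Twin col P₁ P₂ a b c d g) : col e g ⊆ P₁ := by
  have hrep := h.no_rep e g a c
  rw [h.symm e a, he.right.ab, h.symm g a, hg.right.ab, he.left.ac, hg.left.ac, hg.right.ac,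
    Finset.inter_univ, Finset.inter_univ, Finset.univ_inter] at hrep
  exact subset_of_no_rep' hP.ge hrep

end Seed

/-- A seed `a, b, c, d` with colour pairs `P₁, P₂` whose total multiplicity to `e` is maximal among
all such seeds, but smaller than `14`. -/
structure BestSeed {V : Type*} (col : V → V → Finset (Fin 5)) (P₁ P₂ : Finset (Fin 5))
    (a b c d e : V) : Prop where
  seed : Seed col P₁ P₂ a b c d
  sum_lt : (col a e).card + (col b e).card + (col c e).card + (col d e).card < 14
  maximal : ∀ a' b' c' d', Seed col P₁ P₂ a' b' c' d' →
    (col a' e).card + (col b' e).card + (col c' e).card + (col d' e).card ≤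
      (col a e).card + (col b e).card + (col c e).card + (col d e).card

namespace BestSeed

variable {V : Type*} [Fintype V] {col : V → V → Finset (Fin 5)} {P₁ P₂ : Finset (Fin 5)}
  {a b c d e : V}

theorem flip (h : DenseColoring col) (m : BestSeed col P₁ P₂ a b c d e) :
    BestSeed col P₂ P₁ c d a b e where
  seed := m.seed.flip h
  sum_lt := by have := m.sum_lt; omega
  maximal a' b' c' d' s' := by have := m.maximal _ _ _ _ (s'.flip h); omega

theorem swap_right (h : DenseColoring col) (m : BestSeed col P₁ P₂ a b c d e) :
    BestSeed col P₁ P₂ a b d c e where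
  seed := m.seed.swap_right h
  sum_lt := by have := m.sum_lt; omega
  maximal a' b' c' d' s' := by have := m.maximal _ _ _ _ s'; omega

theorem of_twin (h : DenseColoring col) (m : BestSeed col P₁ P₂ a b c d e) {g : V}
    (ht : Seed.Twin col P₁ P₂ a b c d g) :
    (col a g).card = 2 ∧ (col b g).card = 2 ∧ (col c g).card = 5 ∧ (col d g).card = 5 ∧
      (col e g).card ≤ (col a e).card ∧ (col e g).card ≤ (col b e).card := by
  have h₁ := m.maximal _ _ _ _ ht.left
  have h₂ := m.maximal _ _ _ _ ht.right
  rw [h.symm g e] at h₁ h₂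
  rw [ht.right.ab, h.symm b g, ht.left.ab, h.symm c g, ht.left.ac, h.symm d g, ht.left.ad]
  exact ⟨m.seed.card₁, m.seed.card₁, rfl, rfl, by omega, by omega⟩

theorem of_fourteen_le [Nonempty V] (h : DenseColoring col) (m : BestSeed col P₁ P₂ a b c d e)
    {g : V} (hg : 14 ≤ (col a g).card + (col b g).card + (col c g).card + (col d g).card) :
    ((col a g).card = 2 ∧ (col b g).card = 2 ∧ (col c g).card = 5 ∧ (col d g).card = 5 ∧
      (col e g).card ≤ (col a e).card ∧ (col e g).card ≤ (col b e).card) ∨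
    ((col c g).card = 2 ∧ (col d g).card = 2 ∧ (col a g).card = 5 ∧ (col b g).card = 5 ∧
      (col e g).card ≤ (col c e).card ∧ (col e g).card ≤ (col d e).card) := by
  obtain ht | ht := m.seed.twin_or_twin h hg
  · exact .inl (m.of_twin h ht)
  · exact .inr ((m.flip h).of_twin h ht)

theorem three_le_or [Nonempty V] (h : DenseColoring col) (m : BestSeed col P₁ P₂ a b c d e) :
    (3 ≤ (col a e).card ∧ 3 ≤ (col b e).card) ∨ (3 ≤ (col c e).card ∧ 3 ≤ (col d e).card) := by
  by_contra hno
  obtain ⟨g, hg⟩ := h.denseWeight.exists_heavy [(10, a), (10, b), (10, c), (10, d), (3, e)]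
  simp only [List.map_cons, List.map_nil, List.sum_cons, List.sum_nil] at hg
  have := Seed.card_le_five (col e g)
  have := m.of_fourteen_le h (g := g)
  have := m.seed.sum_le h g
  omega

theorem noRep (h : DenseColoring col) (m : BestSeed col P₁ P₂ a b c d e) (g : V) :
    NoRep ((col a g).card + (col b e).card - 5) ((col b g).card + (col a e).card - 5)
      ((col e g).card - 3) := by
  have := h.denseWeight.ext a b e g
  simp only [m.seed.ab, m.seed.card₁] at this
  exact this

theorem not_three_le [Nonempty V] (h : DenseColoring col) (m : BestSeed col P₁ P₂ a b c d e)
    (ha : 3 ≤ (col a e).card) (hb : 3 ≤ (col b e).card) (hc : 3 ≤ (col c e).card)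
    (hd : 3 ≤ (col d e).card) : False := by
  have hall : (col a e).card = 3 ∧ (col b e).card = 3 ∧ (col c e).card = 3 ∧
      (col d e).card = 3 := by
    have key : ∀ x y z t : Fin 6, 3 ≤ x.1 → 3 ≤ y.1 → 3 ≤ z.1 → 3 ≤ t.1 → SeedProfile x y z t →
        x.1 = 3 ∧ y.1 = 3 ∧ z.1 = 3 ∧ t.1 = 3 := by decide +kernel
    exact key (h.denseWeight.fin a e) (h.denseWeight.fin b e) (h.denseWeight.fin c e)
      (h.denseWeight.fin d e) ha hb hc hd (m.seed.profile h e)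
  obtain ⟨g, hg⟩ := h.denseWeight.exists_heavy [(1, a), (1, b), (1, c), (1, d), (1, e)]
  simp only [List.map_cons, List.map_nil, List.sum_cons, List.sum_nil] at hg
  have h₁ := m.noRep h g
  have h₂ := (m.flip h).noRep h g
  unfold NoRep at h₁ h₂
  have := Seed.card_le_five (col a g)
  have := Seed.card_le_five (col b g)
  have := Seed.card_le_five (col c g)
  have := Seed.card_le_five (col d g)
  have := Seed.card_le_five (col e g)
  have := m.of_fourteen_le h (g := g)
  have := m.seed.le_two_of_thirteen_le h (e := g)
  have := m.seed.sum_le h g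
  omega

theorem not_three_le_of_eq_three [Nonempty V] (h : DenseColoring col)
    (m : BestSeed col P₁ P₂ a b c d e) (ha : 3 ≤ (col a e).card) (hb : 3 ≤ (col b e).card)
    (hab : (col a e).card = 3 ∨ (col b e).card = 3)
    (hcd : (col c e).card ≤ 2 ∨ (col d e).card ≤ 2) : False := by
  have hae := Seed.card_le_five (col a e)
  obtain ⟨g, hg⟩ := h.denseWeight.exists_heavier [(8, a), (8, b), (7, c), (7, d), (4, e)]
    (g₀ := a) (by
      simp only [List.map_cons, List.map_nil, List.sum_cons, List.sum_nil, h.loop, h.symm b a,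
        h.symm c a, h.symm d a, h.symm e a, m.seed.ab, m.seed.ac, m.seed.ad, m.seed.card₁,
        Finset.card_univ, Fintype.card_fin, Finset.card_empty]
      omega)
  simp only [List.map_cons, List.map_nil, List.sum_cons, List.sum_nil] at hg
  have h₁ := m.noRep h g
  unfold NoRep at h₁
  have := Seed.card_le_five (col a g)
  have := Seed.card_le_five (col b g)
  have := Seed.card_le_five (col e g)
  have := m.of_fourteen_le h (g := g)
  have := m.seed.le_two_of_thirteen_le h (e := g)
  have := m.seed.sum_le h g
  omega

theorem not_four_le_of_eq_four [Nonempty V] (h : DenseColoring col)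
    (m : BestSeed col P₁ P₂ a b c d e) (ha : 4 ≤ (col a e).card) (hb : 4 ≤ (col b e).card)
    (hab : (col a e).card = 4 ∨ (col b e).card = 4)
    (hcd : (col c e).card ≤ 2 ∨ (col d e).card ≤ 2) : False := by
  have hae := Seed.card_le_five (col a e)
  obtain ⟨g, hg⟩ := h.denseWeight.exists_heavier [(4, a), (4, b), (3, c), (3, d), (3, e)]
    (g₀ := a) (by
      simp only [List.map_cons, List.map_nil, List.sum_cons, List.sum_nil, h.loop, h.symm b a,
        h.symm c a, h.symm d a, h.symm e a, m.seed.ab, m.seed.ac, m.seed.ad, m.seed.card₁,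
        Finset.card_univ, Fintype.card_fin, Finset.card_empty]
      omega)
  simp only [List.map_cons, List.map_nil, List.sum_cons, List.sum_nil] at hg
  have h₁ := m.noRep h g
  unfold NoRep at h₁
  have := Seed.card_le_five (col a g)
  have := Seed.card_le_five (col b g)
  have := Seed.card_le_five (col e g)
  have := m.of_fourteen_le h (g := g)
  have := m.seed.le_two_of_thirteen_le h (e := g)
  have := m.seed.sum_le h g
  omega

theorem card_le_of_replaces (h : DenseColoring col) (m : BestSeed col P₁ P₂ a b c d e) {g : V}
    (hag : (col a g).card = 5) (hbg : (col b g).card = 5) (hcg : 1 ≤ (col c g).card)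
    (hdg : (col d g).card = 2) : (col e g).card ≤ (col c e).card := by
  have hrep := h.no_rep g a d c
  have hag' := Seed.eq_univ hag
  have hgc := h.symm g c
  rw [h.symm g a, hag', h.symm d c, m.seed.cd, m.seed.ac, m.seed.ad, Finset.univ_inter,
    Finset.inter_univ, Finset.inter_univ, h.symm g c, h.symm g d] at hrep
  have hsub := subset_of_no_rep m.seed.card₂.ge (Finset.card_pos.1 hcg) (by omega) hrep
  have hd : col d g = P₂ := Finset.eq_of_subset_of_card_le hsub (by rw [m.seed.card₂, hdg])
  have s : Seed col P₁ P₂ a b g d := { m.seed with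
    cd := (h.symm _ _).trans hd
    ac := hag'
    bc := Seed.eq_univ hbg }
  have := m.maximal _ _ _ _ s
  rw [h.symm g e] at this
  omega

set_option synthInstance.maxSize 2000 in
theorem not_eq_five [Nonempty V] (h : DenseColoring col) (m : BestSeed col P₁ P₂ a b c d e)
    (ha : (col a e).card = 5) (hb : (col b e).card = 5) : False := by
  wlog hcd : (col c e).card ≤ (col d e).card generalizing c d
  · exact this (m.swap_right h) (by omega)
  have hc : (col c e).card ≤ 1 := by have := m.sum_lt; omega
  obtain ⟨g, hg⟩ := h.denseWeight.exists_heavier [(9, a), (9, b), (3, c), (7, d), (6, e)]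
    (g₀ := a) (by
      simp only [List.map_cons, List.map_nil, List.sum_cons, List.sum_nil, h.loop, h.symm b a,
        h.symm c a, h.symm d a, h.symm e a, m.seed.ab, m.seed.ac, m.seed.ad, m.seed.card₁,
        Finset.card_univ, Fintype.card_fin, Finset.card_empty]
      omega)
  simp only [List.map_cons, List.map_nil, List.sum_cons, List.sum_nil] at hg
  have h₁ := m.noRep h g
  have hflat := h.denseWeight.flat h.denseWeight.lt_three_of_five_five
  have f₁ := hflat a e g
  have f₂ := hflat b e g
  simp only [ha, hb, Nat.add_sub_cancel] at h₁ f₁ f₂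
  have h₂ : (col a g).card = 5 → (col b g).card = 5 → 1 ≤ (col c g).card → (col d g).card = 2 →
      (col e g).card ≤ 1 := fun hag hbg hcg hdg =>
    (m.card_le_of_replaces h hag hbg hcg hdg).trans hc
  have h116 : 116 < 9 * (col a g).card + 9 * (col b g).card + 3 * (col c g).card +
      7 * (col d g).card + 6 * (col e g).card := by omega
  have key : ∀ x y z t s : Fin 6, 116 < 9 * x.1 + 9 * y + 3 * z + 7 * t + 6 * s →
      NoRep x y (s - 3) → Flat 3 5 x s → Flat 3 5 y s → SeedProfile x y z t →
      ¬ (x.1 = 5 → y.1 = 5 → 1 ≤ z.1 → t.1 = 2 → s.1 ≤ 1) := by decide +kernel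
  exact key (h.denseWeight.fin a g) (h.denseWeight.fin b g) (h.denseWeight.fin c g)
    (h.denseWeight.fin d g) (h.denseWeight.fin e g) h116 h₁ f₁ f₂
    (m.seed.profile h g) h₂

theorem false_of_three_le [Nonempty V] (h : DenseColoring col)
    (m : BestSeed col P₁ P₂ a b c d e) (ha : 3 ≤ (col a e).card) (hb : 3 ≤ (col b e).card) :
    False := by
  by_cases hcd : 3 ≤ (col c e).card ∧ 3 ≤ (col d e).card
  · exact m.not_three_le h ha hb hcd.1 hcd.2
  by_cases h₃ : (col a e).card = 3 ∨ (col b e).card = 3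
  · exact m.not_three_le_of_eq_three h ha hb h₃ (by omega)
  by_cases h₄ : (col a e).card = 4 ∨ (col b e).card = 4
  · exact m.not_four_le_of_eq_four h (by omega) (by omega) h₄ (by omega)
  have := Seed.card_le_five (col a e)
  have := Seed.card_le_five (col b e)
  exact m.not_eq_five h (by omega) (by omega)

theorem false [Nonempty V] (h : DenseColoring col) (m : BestSeed col P₁ P₂ a b c d e) : False := by
  obtain ⟨h₁, h₂⟩ | ⟨h₁, h₂⟩ := m.three_le_or h
  · exact m.false_of_three_le h h₁ h₂
  · exact (m.flip h).false_of_three_le h h₁ h₂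

end BestSeed

theorem Seed.exists_seed_of_mem {V : Type*} [Fintype V] [Nonempty V]
    {col : V → V → Finset (Fin 5)} {P₁ P₂ : Finset (Fin 5)} {a b c d : V} (h : DenseColoring col)
    (s : Seed col P₁ P₂ a b c d) (e : V) :
    (∃ b c d, Seed col P₁ P₂ e b c d) ∨ ∃ b c d, Seed col P₂ P₁ e b c d := by
  let total (q : V × V × V × V) : ℕ :=
    (col q.1 e).card + (col q.2.1 e).card + (col q.2.2.1 e).card + (col q.2.2.2 e).card
  obtain ⟨⟨a', b', c', d'⟩, hq, hmax⟩ := Set.exists_max_image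
    {q : V × V × V × V | Seed col P₁ P₂ q.1 q.2.1 q.2.2.1 q.2.2.2} total (Set.toFinite _)
    ⟨(a, b, c, d), s⟩
  by_cases hlt : total (a', b', c', d') < 14
  · exact (BestSeed.false h ⟨hq, hlt, fun a b c d s => hmax (a, b, c, d) s⟩).elim
  · obtain ht | ht := Seed.twin_or_twin h hq (not_lt.1 hlt)
    · exact .inl ⟨_, _, _, ht.left⟩
    · exact .inr ⟨_, _, _, ht.left⟩

theorem exists_ne_mem {α : Type*} {A B : Finset α} (hA : A.Nonempty) (hB : B.Nonempty)
    (hAB : 3 ≤ A.card + B.card) : ∃ x ∈ A, ∃ y ∈ B, x ≠ y := by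
  obtain ⟨x, hx⟩ := hA
  obtain ⟨y, hy⟩ := hB
  by_cases h : 2 ≤ A.card
  · obtain ⟨x, hx, hne⟩ := Finset.exists_mem_ne h y
    exact ⟨x, hx, y, hy, hne⟩
  · obtain ⟨y, hy, hne⟩ := Finset.exists_mem_ne (s := B) (by omega) x
    exact ⟨x, hx, y, hy, hne.symm⟩

namespace Seed

variable {V : Type*} [Fintype V] {col : V → V → Finset (Fin 5)} {P₁ P₂ : Finset (Fin 5)}
  {v b c d v' b' c' d' x g : V}

theorem exists_sum_eq_fourteen [Nonempty V] (h : DenseColoring col) (s : Seed col P₁ P₂ v b c d)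
    {Q₁ Q₂ : Finset (Fin 5)} (s' : Seed col Q₁ Q₂ v' b' c' d') : ∃ k,
    14 ≤ (col v k).card + (col b k).card + (col c k).card + (col d k).card ∧
    14 ≤ (col v' k).card + (col b' k).card + (col c' k).card + (col d' k).card := by
  obtain ⟨k, hk⟩ := h.denseWeight.exists_heavy
    [(1, v), (1, b), (1, c), (1, d), (1, v'), (1, b'), (1, c'), (1, d')]
  simp only [List.map_cons, List.map_nil, List.sum_cons, List.sum_nil] at hk
  have := s.sum_le h k
  have := s'.sum_le h k
  exact ⟨k, by omega, by omega⟩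

theorem not_twin_of_thirteen_le [Nonempty V] (h : DenseColoring col)
    (s : Seed col P₁ P₂ v b c d) (s' : Seed col P₂ P₁ v b' c' d') (ht : Twin col P₁ P₂ v b c d g)
    (hg : 13 ≤ (col v g).card + (col b' g).card + (col c' g).card + (col d' g).card) : False := by
  have hvg := ht.right.ab
  have h₁ := s.card₁
  obtain ⟨hsub, -⟩ | ⟨hc, hd⟩ := s'.subset_or_subset h hg
  · rw [hvg] at hsub
    have := Finset.disjoint_self_iff_empty _ |>.1 (s.disj.mono_right hsub)
    simp [this] at h₁
  · have := Finset.card_le_card hc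
    have := Finset.card_le_card hd
    have := card_le_five (col b' g)
    rw [hvg] at hg
    omega

theorem not_both [Nonempty V] (h : DenseColoring col) (s : Seed col P₁ P₂ v b c d)
    (s' : Seed col P₂ P₁ v b' c' d') : False := by
  have twin : ∀ g, 14 ≤ (col v g).card + (col b g).card + (col c g).card + (col d g).card →
      13 ≤ (col v g).card + (col b' g).card + (col c' g).card + (col d' g).card →
      Twin col P₂ P₁ c d v b g := fun g h₁ h₂ =>
    (s.twin_or_twin h h₁).resolve_left fun ht => s.not_twin_of_thirteen_le h s' ht h₂
  have twin' : ∀ g, 14 ≤ (col v g).card + (col b' g).card + (col c' g).card + (col d' g).card →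
      13 ≤ (col v g).card + (col b g).card + (col c g).card + (col d g).card →
      Twin col P₁ P₂ c' d' v b' g := fun g h₁ h₂ =>
    (s'.twin_or_twin h h₁).resolve_left fun ht => s'.not_twin_of_thirteen_le h s ht h₂
  obtain ⟨k, hk₁, hk₂⟩ := s.exists_sum_eq_fourteen h s'
  obtain ⟨g, hg⟩ := h.denseWeight.exists_heavy
    [(4, v), (2, b), (2, c), (2, d), (2, b'), (2, c'), (2, d'), (1, k)]
  simp only [List.map_cons, List.map_nil, List.sum_cons, List.sum_nil] at hg
  have hkg := card_le_five (col k g)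
  have hg₁ := s.sum_le h g
  have hg₂ := s'.sum_le h g
  have hP₁ := s.card₁
  have hP₂ := s.card₂
  have hsub₂ : 14 ≤ (col v g).card + (col b g).card + (col c g).card + (col d g).card →
      col k g ⊆ P₂ := fun h₁ =>
    (twin k hk₁ (by omega)).subset h hP₂ (twin g h₁ (by omega))
  have hsub₁ : 14 ≤ (col v g).card + (col b' g).card + (col c' g).card + (col d' g).card →
      col k g ⊆ P₁ := fun h₁ =>
    (twin' k hk₂ (by omega)).subset h hP₁ (twin' g h₁ (by omega))
  by_cases h₁ : 14 ≤ (col v g).card + (col b g).card + (col c g).card + (col d g).card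
  · have hle := Finset.card_le_card (hsub₂ h₁)
    by_cases h₂ : 14 ≤ (col v g).card + (col b' g).card + (col c' g).card + (col d' g).card
    · have hempty : (col k g).card = 0 := Finset.card_eq_zero.2
        ((Finset.disjoint_self_iff_empty _).1 (s.disj.mono (hsub₁ h₂) (hsub₂ h₁)))
      omega
    · omega
  · by_cases h₂ : 14 ≤ (col v g).card + (col b' g).card + (col c' g).card + (col d' g).card
    · have hle := Finset.card_le_card (hsub₁ h₂)
      omega
    · omega

theorem exists_three_le [Nonempty V] (h : DenseColoring col) (s : Seed col P₁ P₂ v b c d)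
    (s' : Seed col P₁ P₂ v' b' c' d') (x : V) : ∃ g, 3 ≤ (col x g).card ∧
    13 ≤ (col v g).card + (col b g).card + (col c g).card + (col d g).card ∧
    13 ≤ (col v' g).card + (col b' g).card + (col c' g).card + (col d' g).card ∧
    27 ≤ (col v g).card + (col b g).card + (col c g).card + (col d g).card +
      ((col v' g).card + (col b' g).card + (col c' g).card + (col d' g).card) := by
  obtain ⟨g, hg⟩ := h.denseWeight.exists_heavy
    [(3, v), (3, b), (3, c), (3, d), (3, v'), (3, b'), (3, c'), (3, d'), (2, x)]
  simp only [List.map_cons, List.map_nil, List.sum_cons, List.sum_nil] at hg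
  have := s.sum_le h g
  have := s'.sum_le h g
  have := card_le_five (col x g)
  exact ⟨g, by omega, by omega, by omega, by omega⟩

end Seed

namespace DenseColoring

variable {V : Type*} [Fintype V] {col : V → V → Finset (Fin 5)} {P₁ P₂ : Finset (Fin 5)}
  {v b c d v' b' c' d' x g : V}

theorem subset_of_inter_nonempty (h : DenseColoring col) {P : Finset (Fin 5)}
    (hv : P ⊆ col v x) (hv' : P ⊆ col v' x) (hx : col x g = Finset.univ)
    (hvg : 1 ≤ (col v g ∩ P).card) (hvg' : 1 ≤ (col v' g ∩ P).card)
    (hcard : 3 ≤ (col v g ∩ P).card + (col v' g ∩ P).card) : col v v' ⊆ P := by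
  intro i hi
  by_contra hiP
  obtain ⟨j, hj, k, hk, hjk⟩ := exists_ne_mem (Finset.card_pos.1 hvg) (Finset.card_pos.1 hvg') hcard
  rw [Finset.mem_inter] at hj hk
  refine h.free v v' g x i j k (fun hij => hiP (hij ▸ hj.2)) (fun hik => hiP (hik ▸ hk.2)) hjk hi
    ?_ hj.1 (hv' hj.2) (hv hk.2) hk.1
  rw [h.symm, hx]
  exact Finset.mem_univ i

theorem subset_of_common_right [Nonempty V] (h : DenseColoring col)
    (s : Seed col P₁ P₂ v b x d) (s' : Seed col P₁ P₂ v' b' x d') : col v v' ⊆ P₁ := by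
  obtain ⟨g, hx, h₁, h₂, h₃⟩ := s.exists_three_le h s' x
  have hP₁ := s.card₁
  have hP₂ := s.card₂
  obtain ⟨hv, hb⟩ | ⟨hx', -⟩ := s.subset_or_subset h h₁
  · obtain ⟨hv', hb'⟩ | ⟨hx', -⟩ := s'.subset_or_subset h h₂
    · have := Finset.card_le_card hv
      have := Finset.card_le_card hb
      have := Finset.card_le_card hv'
      have := Finset.card_le_card hb'
      have := Seed.card_le_five (col x g)
      have := Seed.card_le_five (col d g)
      have := Seed.card_le_five (col d' g)
      refine h.subset_of_inter_nonempty (x := x) (g := g) ?_ ?_ (Seed.eq_univ (by omega)) ?_ ?_ ?_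
      · rw [s.ac]; exact Finset.subset_univ _
      · rw [s'.ac]; exact Finset.subset_univ _
      all_goals simp only [Finset.inter_eq_left.2 hv, Finset.inter_eq_left.2 hv']; omega
    · have := Finset.card_le_card hx'; omega
  · have := Finset.card_le_card hx'; omega

theorem subset_of_common_left [Nonempty V] (h : DenseColoring col)
    (s : Seed col P₁ P₂ v x c d) (s' : Seed col P₁ P₂ v' x c' d') : col v v' ⊆ P₁ := by
  obtain ⟨g, hx, h₁, h₂, h₃⟩ := s.exists_three_le h s' x
  have hP₁ := s.card₁
  have hP₂ := s.card₂
  obtain ⟨-, hx'⟩ | ⟨hc, hd⟩ := s.subset_or_subset h h₁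
  · have := Finset.card_le_card hx'; omega
  obtain ⟨-, hx'⟩ | ⟨hc', hd'⟩ := s'.subset_or_subset h h₂
  · have := Finset.card_le_card hx'; omega
  have := Finset.card_le_card hc
  have := Finset.card_le_card hd
  have := Finset.card_le_card hc'
  have := Finset.card_le_card hd'
  have := Seed.card_le_five (col x g)
  have := Seed.card_le_five (col v g)
  have := Seed.card_le_five (col v' g)
  have := card_add_sub_le (col v g) P₁
  have := card_add_sub_le (col v' g) P₁
  exact h.subset_of_inter_nonempty (g := g) s.ab.ge s'.ab.ge (Seed.eq_univ (by omega)) (by omega)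
    (by omega) (by omega)

theorem subset_of_seed [Nonempty V] (h : DenseColoring col) (s : Seed col P₁ P₂ v b c d)
    (s' : Seed col P₁ P₂ v' b' c' d') : col v v' ⊆ P₁ := by
  obtain ⟨k, hk, hk'⟩ := s.exists_sum_eq_fourteen h s'
  obtain ht | ht := s.twin_or_twin h hk <;> obtain ht' | ht' := s'.twin_or_twin h hk'
  · exact h.subset_of_common_left ht.right ht'.right
  · exact (ht.left.not_both h ht'.left).elim
  · exact (ht'.left.not_both h ht.left).elim
  · exact h.subset_of_common_right (ht.left.flip h) (ht'.left.flip h)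

theorem exists_partition [Nonempty V] (h : DenseColoring col) :
    ∃ (P₁ P₂ : Finset (Fin 5)) (A : Set V), P₁.card = 2 ∧ P₂.card = 2 ∧ Disjoint P₁ P₂ ∧
      (∀ u ∈ A, ∀ v ∈ A, col u v ⊆ P₁) ∧ ∀ u ∉ A, ∀ v ∉ A, col u v ⊆ P₂ := by
  obtain ⟨P₁, P₂, a, b, c, d, s⟩ := h.exists_seed
  refine ⟨P₁, P₂, {v | ∃ b c d, Seed col P₁ P₂ v b c d}, s.card₁, s.card₂, s.disj,
    fun u ⟨_, _, _, hu⟩ v ⟨_, _, _, hv⟩ => h.subset_of_seed hu hv, fun u hu v hv => ?_⟩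
  obtain ⟨_, _, _, hu⟩ := (s.exists_seed_of_mem h u).resolve_left hu
  obtain ⟨_, _, _, hv⟩ := (s.exists_seed_of_mem h v).resolve_left hv
  exact h.subset_of_seed hu hv

end DenseColoring

theorem exists_perm_of_disjoint {P₁ P₂ : Finset (Fin 5)} (h₁ : P₁.card = 2) (h₂ : P₂.card = 2)
    (hdisj : Disjoint P₁ P₂) : ∃ σ : Equiv.Perm (Fin 5), σ 0 ∉ P₂ ∧ σ 1 ∉ P₂ ∧ σ 2 ∉ P₁ ∧
      σ 3 ∉ P₁ ∧ σ 4 ∉ P₁ ∧ σ 4 ∉ P₂ := by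
  obtain ⟨p, q, hpq, rfl⟩ := Finset.card_eq_two.1 h₁
  obtain ⟨r, s, hrs, rfl⟩ := Finset.card_eq_two.1 h₂
  obtain ⟨t, -, ht⟩ := Finset.exists_mem_notMem_of_card_lt_card
    (s := ({p, q} ∪ {r, s} : Finset (Fin 5))) (t := Finset.univ) (by
      rw [Finset.card_union_of_disjoint hdisj, h₁, h₂, Finset.card_univ, Fintype.card_fin]
      norm_num)
  simp only [Finset.disjoint_left, Finset.mem_union, Finset.mem_insert, Finset.mem_singleton]
    at hdisj ht ⊢
  have hinj : Function.Injective ![p, q, r, s, t] := by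
    intro i j hij
    fin_cases i <;> fin_cases j <;> simp at hij ⊢ <;> grind
  refine ⟨Equiv.ofBijective _ (Finite.injective_iff_bijective.1 hinj), ?_⟩
  simp only [Equiv.ofBijective_apply]
  change ¬(p = r ∨ p = s) ∧ ¬(q = r ∨ q = s) ∧ ¬(r = p ∨ r = q) ∧ ¬(s = p ∨ s = q) ∧
    ¬(t = p ∨ t = q) ∧ ¬(t = r ∨ t = s)
  grind

/-- The colours of the pair `u, v`: the indices of the graphs in which it is an edge. -/
def edgeColors {n : ℕ} (G : Fin 5 → Finset (Finset (Fin n))) (u v : Fin n) : Finset (Fin 5) :=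
  Finset.univ.filter fun i => ({u, v} : Finset (Fin n)) ∈ G i

theorem mem_edgeColors {n : ℕ} {G : Fin 5 → Finset (Finset (Fin n))} {u v : Fin n} {i : Fin 5} :
    i ∈ edgeColors G u v ↔ ({u, v} : Finset (Fin n)) ∈ G i := by
  simp [edgeColors]

theorem IsMulti5.ne {n : ℕ} {G : Fin 5 → Finset (Finset (Fin n))} (hG : IsMulti5 G) {u v : Fin n}
    {i : Fin 5} (h : ({u, v} : Finset (Fin n)) ∈ G i) : u ≠ v := by
  rintro rfl
  simpa using hG i _ h

theorem IsMulti5.mdeg_eq {n : ℕ} {G : Fin 5 → Finset (Finset (Fin n))} (hG : IsMulti5 G)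
    (v : Fin n) : mdeg G v = ∑ u, (edgeColors G v u).card := by
  simp only [mdeg, edgeColors]
  refine Eq.trans ?_ (Finset.sum_card_bipartiteAbove_eq_sum_card_bipartiteBelow
    (fun u i => ({v, u} : Finset (Fin n)) ∈ G i)).symm
  refine Finset.sum_congr rfl fun i _ => (Finset.card_bij (fun u _ => {v, u}) ?_ ?_ ?_).symm
  · intro u hu
    simpa [Finset.bipartiteBelow] using hu
  · intro u hu u' _ huu'
    have hne := hG.ne (Finset.mem_filter.1 hu).2
    have : u ∈ ({v, u'} : Finset (Fin n)) :=
      huu' ▸ Finset.mem_insert_of_mem (Finset.mem_singleton_self u)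
    simpa [hne.symm] using this
  · intro e he
    obtain ⟨heG, hve⟩ := Finset.mem_filter.1 he
    obtain ⟨x, y, -, rfl⟩ := Finset.card_eq_two.1 (hG i e heG)
    simp only [Finset.mem_insert, Finset.mem_singleton] at hve
    obtain rfl | rfl := hve
    · exact ⟨y, by simpa [Finset.bipartiteBelow] using heG, rfl⟩
    · exact ⟨x, by simpa [Finset.bipartiteBelow, Finset.pair_comm] using heG, Finset.pair_comm _ _⟩

theorem IsMulti5.denseColoring {n : ℕ} {G : Fin 5 → Finset (Finset (Fin n))} (hG : IsMulti5 G)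
    (hK4 : ¬ ContainsK4 G) (hdeg : ∀ v : Fin n, (58 : ℝ) * n / 17 ≤ (mdeg G v : ℝ)) :
    DenseColoring (edgeColors G) where
  symm a b := by simp only [edgeColors, Finset.pair_comm]
  loop a := by
    refine Finset.eq_empty_of_forall_notMem fun i hi => ?_
    exact hG.ne (mem_edgeColors.1 hi) rfl
  free a b c d i j k hij hik hjk hab hcd hac hbd had hbc := by
    simp only [mem_edgeColors] at *
    exact hK4 ⟨i, j, k, a, b, c, d, hij, hik, hjk, hG.ne hab, hG.ne hac, hG.ne had, hG.ne hbc,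
      hG.ne hbd, hG.ne hcd, hab, hcd, hac, hbd, had, hbc⟩
  deg v := by
    have h := hdeg v
    rw [div_le_iff₀ (by norm_num), mul_comm _ (17 : ℝ), hG.mdeg_eq] at h
    rw [Fintype.card_fin]
    exact_mod_cast h

theorem IsMulti5.not_subset {n : ℕ} {G : Fin 5 → Finset (Finset (Fin n))} (hG : IsMulti5 G)
    {S : Finset (Fin n)} {P : Finset (Fin 5)} (hS : ∀ u ∈ S, ∀ v ∈ S, edgeColors G u v ⊆ P)
    {i : Fin 5} (hi : i ∉ P) : ∀ e ∈ G i, ¬ e ⊆ S := by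
  intro e he hsub
  obtain ⟨x, y, -, rfl⟩ := Finset.card_eq_two.1 (hG i e he)
  exact hi (hS x (hsub (by simp)) y (hsub (by simp)) (mem_edgeColors.2 he))

/-- Every 𝕂₄-free 5-multigraph on n ≥ 1 vertices with minimum degree
at least 58n/17 admits a good partition. -/
theorem multigraph_good_partition (n : ℕ) (hn : 0 < n)
    (G : Fin 5 → Finset (Finset (Fin n))) (hG : IsMulti5 G) (hK4 : ¬ ContainsK4 G)
    (hdeg : ∀ v : Fin n, (58 : ℝ) * n / 17 ≤ (mdeg G v : ℝ)) :
    GoodPartition G := by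
  have : Nonempty (Fin n) := ⟨⟨0, hn⟩⟩
  obtain ⟨P₁, P₂, A, h₁, h₂, hdisj, hA, hA'⟩ := (hG.denseColoring hK4 hdeg).exists_partition
  obtain ⟨σ, h0, h1, h2, h3, h4, h4'⟩ := exists_perm_of_disjoint h₁ h₂ hdisj
  classical
  let V₁ : Finset (Fin n) := Finset.univ.filter (· ∈ A)
  have hV₁ : ∀ u ∈ V₁, ∀ v ∈ V₁, edgeColors G u v ⊆ P₁ := fun u hu v hv =>
    hA u (Finset.mem_filter.1 hu).2 v (Finset.mem_filter.1 hv).2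
  have hV₂ : ∀ u ∈ V₁ᶜ, ∀ v ∈ V₁ᶜ, edgeColors G u v ⊆ P₂ := fun u hu v hv =>
    hA' u (by simpa [V₁] using hu) v (by simpa [V₁] using hv)
  exact ⟨V₁, σ, hG.not_subset hV₂ h0, hG.not_subset hV₂ h1, hG.not_subset hV₁ h2,
    hG.not_subset hV₁ h3, hG.not_subset hV₁ h4, hG.not_subset hV₂ h4'⟩
end
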